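/- Bootstrap lower bound leading to norm inflation: there exists a constant C>0 such that for all sufficiently large N∈ℕ⁺ the following holds. Let u be the unique solution of the R-CH equation on [0, 2N^{−1/2}] with the explicit initial datum u₀ defined from N. If sup_{t∈[0,2N^{−1/2}]} ‖u_x(t)‖_{B^0_{∞,1}} < ln N, then for every t∈[0, N^{−1/2}] one has ‖u(t)‖_{B^1_{∞,1}} ≥ (1/8)·t·N^{3/5} − C; in particular sup_{t∈[0,N^{−1/2}]} ‖u(t)‖_{B^1_{∞,1}} ≥ (1/16)·N^{1/10} − C > ln N, contradicting the hypothesis. Hence sup_{t∈[0,2N^{−1/2}]} ‖u_x(t)‖_{B^0_{∞,1}} ≥ ln N. -/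

import Mathlib

open MeasureTheory Set Filter
open scoped ENNReal NNReal Topology

noncomputable section

/-- Littlewood–Paley data on `ℝ`: a radial smooth even cutoff `chi` supported in
`{|ξ| ≤ 4/3}`, and a radial smooth cutoff `phi` supported in `{3/4 ≤ |ξ| ≤ 8/3}`,
forming a dyadic partition of unity. -/
structure LPData where
  chi : ℝ → ℝ
  phi : ℝ → ℝ
  chi_smooth : ContDiff ℝ (⊤ : ℕ∞) chi
  chi_even : ∀ ξ, chi (-ξ) = chi ξ
  chi_mem : ∀ ξ, chi ξ ∈ Set.Icc (0:ℝ) 1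
  chi_supp : ∀ ξ : ℝ, (4:ℝ)/3 < |ξ| → chi ξ = 0
  phi_smooth : ContDiff ℝ (⊤ : ℕ∞) phi
  phi_mem : ∀ ξ, phi ξ ∈ Set.Icc (0:ℝ) 1
  phi_supp : ∀ ξ : ℝ, (|ξ| < 3/4 ∨ (8:ℝ)/3 < |ξ|) → phi ξ = 0
  partition : ∀ ξ : ℝ, chi ξ + ∑' j : ℕ, phi ((2:ℝ) ^ (-(j:ℤ)) * ξ) = 1

/-- The inverse Fourier transform `𝓕⁻¹ g (x) = (2π)⁻¹ ∫ e^{i x ξ} g(ξ) dξ`. -/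
def invFT (g : ℝ → ℂ) : ℝ → ℂ :=
  fun x => (1 / (2 * Real.pi) : ℂ) * ∫ ξ : ℝ, Complex.exp (Complex.I * (x:ℂ) * (ξ:ℂ)) * g ξ

/-- The Littlewood–Paley block `Δ_j f`: `Δ_{-1} f = 𝓕⁻¹(χ 𝓕 f)`,
`Δ_j f = 𝓕⁻¹(φ(2^{-j}·) 𝓕 f)` for `j ≥ 0` and `Δ_j f = 0` for `j ≤ -2`;
realized as convolution with the inverse Fourier transform of the cutoff. -/
def LPblock (D : LPData) (j : ℤ) (f : ℝ → ℝ) : ℝ → ℝ :=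
  if j = -1 then
    fun x => (∫ y : ℝ, invFT (fun ξ => (D.chi ξ : ℂ)) y * (f (x - y) : ℂ)).re
  else if 0 ≤ j then
    fun x => (∫ y : ℝ, invFT (fun ξ => (D.phi ((2:ℝ) ^ (-j) * ξ) : ℂ)) y * (f (x - y) : ℂ)).re
  else fun _ => 0

/-- The nonhomogeneous Besov norm `‖f‖_{B^s_{p,1}} = ∑_{j ≥ -1} 2^{js} ‖Δ_j f‖_{L^p}`. -/
def besovNorm (D : LPData) (s : ℝ) (p : ℝ≥0∞) (f : ℝ → ℝ) : ℝ≥0∞ :=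
  ∑' j : ℤ, ENNReal.ofReal ((2:ℝ) ^ ((j:ℝ) * s)) * eLpNorm (LPblock D j f) p volume

/-- The logarithmic Besov norm `‖f‖_{B^s_{∞,∞,1}} = sup_{j ≥ 1} j · 2^{js} ‖Δ_j f‖_{L^∞}`. -/
def besovLogNorm (D : LPData) (s : ℝ) (f : ℝ → ℝ) : ℝ≥0∞ :=
  ⨆ j : ℕ, (j : ℝ≥0∞) * ENNReal.ofReal ((2:ℝ) ^ ((j:ℝ) * s)) *
    eLpNorm (LPblock D (j : ℤ) f) ⊤ volume

/-- The operator `(1 - ∂_{xx})⁻¹`, the Fourier multiplier with symbol `(1+ξ²)⁻¹`,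
realized as convolution with its kernel `½ e^{-|x|}`. -/
def invOneSub (f : ℝ → ℝ) : ℝ → ℝ :=
  fun x => (1/2) * ∫ y : ℝ, Real.exp (-|y|) * f (x - y)

/-- `sup`-norm of a real function. -/
def supNormR (f : ℝ → ℝ) : ℝ := ⨆ x : ℝ, |f x|

/-- The `C^{0,1}` norm `‖f‖_{L^∞} + ‖f_x‖_{L^∞}`. -/
def C01NormR (f : ℝ → ℝ) : ℝ := supNormR f + supNormR (deriv f)

/-- Membership in `C^{0,1}(ℝ)`: bounded and Lipschitz. -/
def MemC01 (f : ℝ → ℝ) : Prop :=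
  (∃ K : ℝ≥0, LipschitzWith K f) ∧ BddAbove (Set.range fun x => |f x|)

/-- The nonlocal force term of the R-CH equation:
`G(u) = -∂_x (1-∂_{xx})⁻¹ (½ u_x² + c₁ u² + c₂ u³ + c₃ u⁴)`. -/
def RCHForce (c₁ c₂ c₃ : ℝ) (v : ℝ → ℝ) : ℝ → ℝ :=
  fun x => - deriv (invOneSub (fun y =>
      (deriv v y) ^ 2 / 2 + c₁ * v y ^ 2 + c₂ * v y ^ 3 + c₃ * v y ^ 4)) x

/-- `u` solves the R-CH equation `u_t + u u_x = G(u)` on the time interval `[0,T]`. -/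
def IsRCHSol (c₁ c₂ c₃ T : ℝ) (u : ℝ → ℝ → ℝ) : Prop :=
  ∀ t ∈ Set.Icc (0:ℝ) T, ∀ x : ℝ,
    HasDerivAt (fun s => u s x)
      (- u t x * deriv (u t) x + RCHForce c₁ c₂ c₃ (u t) x) t

/-- `E(v) = -∂_x (1-∂_{xx})⁻¹ (v_x²/2)`. -/
def Edef (v : ℝ → ℝ) : ℝ → ℝ :=
  fun x => - deriv (invOneSub fun y => (deriv v y) ^ 2 / 2) x

/-- The Heaviside function `1_{x ≥ 0}`. -/
def heaviside : ℝ → ℝ := fun x => if 0 ≤ x then 1 else 0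

/-- The partial sum `S_N f = ∑_{-1 ≤ j < N} Δ_j f`. -/
def SNsum (D : LPData) (N : ℕ) (f : ℝ → ℝ) : ℝ → ℝ :=
  fun x => ∑ j ∈ Finset.range (N + 1), LPblock D ((j : ℤ) - 1) f x

/-- The explicit initial datum
`u₀(x) = -N^{-1/10} (1-∂_{xx})⁻¹ ∂_x [cos(2^{N+5} x) (1 + N^{-1/10} S_N h(x))]`. -/
def u0def (D : LPData) (N : ℕ) : ℝ → ℝ :=
  fun x => -((N:ℝ) ^ (-(1:ℝ)/10)) *
    invOneSub (deriv (fun y =>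
      Real.cos ((2:ℝ) ^ (N + 5) * y) *
        (1 + (N:ℝ) ^ (-(1:ℝ)/10) * SNsum D N heaviside y))) x

/-- Continuity in time with values in the Besov space `B^s_{p,1}`, on `[0,T]`. -/
def BesovContOn (D : LPData) (s : ℝ) (p : ℝ≥0∞) (T : ℝ) (u : ℝ → ℝ → ℝ) : Prop :=
  (∀ t ∈ Set.Icc (0:ℝ) T, besovNorm D s p (u t) < ⊤) ∧
  ∀ t ∈ Set.Icc (0:ℝ) T, ∀ ε : ℝ, 0 < ε → ∃ δ > (0:ℝ), ∀ t' ∈ Set.Icc (0:ℝ) T,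
    |t' - t| < δ → besovNorm D s p (fun x => u t' x - u t x) < ENNReal.ofReal ε

/-- The source term `F` in the transport equation satisfied by
`E = -(1-∂_{xx})⁻¹ ∂_x (u_x²/2)`. -/
def RCH_F (c₁ c₂ c₃ : ℝ) (v : ℝ → ℝ) : ℝ → ℝ := fun x =>
  c₁/3 * v x ^ 3 + c₂/4 * v x ^ 4 + c₃/5 * v x ^ 5
    - v x * invOneSub (fun y => (deriv v y) ^ 2 / 2) x
    - invOneSub (fun y =>
        c₁/3 * v y ^ 3 + c₂/4 * v y ^ 4 + c₃/5 * v y ^ 5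
          - (1/2) * v y * (deriv v y) ^ 2
          - deriv (fun z => deriv v z *
              invOneSub (fun w =>
                (deriv v w) ^ 2 / 2 + c₁ * v w ^ 2 + c₂ * v w ^ 3 + c₃ * v w ^ 4) z) y) x

end


section

open MeasureTheory Set Filter
open scoped ENNReal NNReal Topology

open scoped FourierTransform SchwartzMap Convolution

/-- the cutoff `χ(2πη/s)` as a Schwartz function -/
theorem exists_chiS (D : LPData) (s : ℝ) (hs : 0 < s) :
    ∃ A : 𝓢(ℝ, ℂ), ∀ η, A η = (D.chi (2 * Real.pi * η / s) : ℂ) := by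
  have h1 : HasCompactSupport (fun η : ℝ => (D.chi (2 * Real.pi * η / s) : ℂ)) := by
    apply HasCompactSupport.intro (K := Set.Icc (-s) s) isCompact_Icc
    intro x hx
    have : (4:ℝ)/3 < |2 * Real.pi * x / s| := by
      have hx' : s < |x| := by
        by_contra hcon
        push Not at hcon
        exact hx (abs_le.mp hcon)
      have hp := Real.pi_gt_three
      rw [abs_div, abs_mul, abs_of_pos hs, abs_of_pos (by positivity : (0:ℝ) < 2 * Real.pi),
        lt_div_iff₀ hs]
      nlinarith
    simp [D.chi_supp _ this]
  have h2 : ContDiff ℝ (⊤ : ℕ∞) (fun η : ℝ => (D.chi (2 * Real.pi * η / s) : ℂ)) := by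
    apply Complex.ofRealCLM.contDiff.comp
    apply D.chi_smooth.comp
    fun_prop
  exact ⟨h1.toSchwartzMap h2, fun η => rfl⟩

theorem invFT_eq_fourierInv (g : ℝ → ℂ) (x : ℝ) :
    invFT g x = 𝓕⁻ (fun η : ℝ => g (2 * Real.pi * η)) x := by
  rw [Real.fourierInv_eq']
  unfold invFT
  have h := MeasureTheory.Measure.integral_comp_mul_left
    (fun ξ : ℝ => Complex.exp (Complex.I * (x:ℂ) * (ξ:ℂ)) * g ξ) (2 * Real.pi)
  have hp : (0:ℝ) < 2 * Real.pi := by positivity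
  rw [abs_of_pos (by positivity)] at h
  have e : (1 / (2 * Real.pi) : ℂ) * ∫ ξ : ℝ, Complex.exp (Complex.I * (x:ℂ) * (ξ:ℂ)) * g ξ
     = (2 * Real.pi)⁻¹ • ∫ ξ : ℝ, Complex.exp (Complex.I * (x:ℂ) * (ξ:ℂ)) * g ξ := by
    rw [Complex.real_smul]; push_cast; simp
  rw [e, ← h]
  congr 1
  ext v
  simp only [smul_eq_mul]
  congr 2
  push_cast
  simp
  ring

theorem invFT_scale (g : ℝ → ℂ) (s : ℝ) (hs : 0 < s) (x : ℝ) :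
    invFT (fun ξ => g (s⁻¹ * ξ)) x = s * invFT g (s * x) := by
  unfold invFT
  have h := MeasureTheory.Measure.integral_comp_mul_left
    (fun ξ : ℝ => Complex.exp (Complex.I * ((s * x : ℝ):ℂ) * (ξ:ℂ)) * g ξ) (s⁻¹)
  rw [inv_inv, abs_of_pos hs, Complex.real_smul] at h
  have : ∀ ξ : ℝ, Complex.I * ((s * x : ℝ):ℂ) * ((s⁻¹ * ξ : ℝ):ℂ) = Complex.I * (x:ℂ) * (ξ:ℂ) := by
    intro ξ
    have : (s:ℂ) ≠ 0 := by exact_mod_cast hs.ne'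
    push_cast
    field_simp
  simp only [this] at h
  rw [h]
  push_cast
  ring

/-- The basic real kernel. -/
noncomputable def KK (D : LPData) (x : ℝ) : ℝ := (invFT (fun ξ => (D.chi ξ : ℂ)) x).re

theorem invFT_even (g : ℝ → ℝ) (hg : ∀ ξ, g (-ξ) = g ξ) (x : ℝ) :
    invFT (fun ξ => (g ξ : ℂ)) (-x) = invFT (fun ξ => (g ξ : ℂ)) x := by
  unfold invFT
  rw [← integral_neg_eq_self]
  simp [hg]

theorem invFT_chi_real (D : LPData) (x : ℝ) :
    invFT (fun ξ => (D.chi ξ : ℂ)) x = (KK D x : ℂ) := by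
  have h : (starRingEnd ℂ) (invFT (fun ξ => (D.chi ξ : ℂ)) x) = invFT (fun ξ => (D.chi ξ : ℂ)) x := by
    conv_rhs => rw [← invFT_even _ D.chi_even]
    unfold invFT
    rw [map_mul, ← integral_conj]
    simp [← Complex.exp_conj]
    left
    exact Complex.conj_ofNat 2
  exact (Complex.conj_eq_iff_re.mp h).symm

theorem KK_even (D : LPData) (x : ℝ) : KK D (-x) = KK D x := by
  unfold KK; rw [invFT_even _ D.chi_even]

theorem exists_KS (D : LPData) (s : ℝ) (hs : 0 < s) :
    ∃ A F : 𝓢(ℝ, ℂ), (∀ η, A η = (D.chi (2 * Real.pi * η / s) : ℂ)) ∧ 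
      F = 𝓕⁻ A ∧ ∀ x, F x = ((s * KK D (s * x) : ℝ) : ℂ) := by
  obtain ⟨A, hA⟩ := exists_chiS D s hs
  refine ⟨A, 𝓕⁻ A, hA, rfl, fun x => ?_⟩
  have h1 := invFT_scale (fun ξ => (D.chi ξ : ℂ)) s hs x
  rw [invFT_eq_fourierInv, invFT_chi_real] at h1
  rw [SchwartzMap.fourierInv_coe]
  push_cast
  rw [← h1]
  have : (A : ℝ → ℂ) = fun η : ℝ => ((D.chi (s⁻¹ * (2 * Real.pi * η)) : ℝ) : ℂ) := by
    ext η
    rw [hA]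
    congr 2
    field_simp
  rw [this]

theorem KK_contDiff (D : LPData) : ContDiff ℝ 2 (KK D) := by
  obtain ⟨A, F, -, -, hF⟩ := exists_KS D 1 one_pos
  have : KK D = fun x => Complex.reCLM (F x) := by
    ext x; simp [hF]
  rw [this]
  exact Complex.reCLM.contDiff.comp (F.smooth 2)

theorem KK_decay (D : LPData) : ∃ C : ℝ, 0 < C ∧ (∀ x, |KK D x| * (1 + x^2)^2 ≤ C) ∧
    (∀ x, |deriv (KK D) x| * (1 + x^2) ≤ C) := by
  obtain ⟨A, F, -, -, hF⟩ := exists_KS D 1 one_pos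
  have hK : KK D = fun x => Complex.reCLM (F x) := by
    ext x; simp [hF]
  obtain ⟨C0, -, h0⟩ := F.decay 0 0
  obtain ⟨C4, -, h4⟩ := F.decay 4 0
  obtain ⟨B0, -, b0⟩ := F.decay 0 1
  obtain ⟨B2, -, b2⟩ := F.decay 2 1
  have hn : ∀ x, ‖F x‖ = |KK D x| := by intro x; rw [hF]; simp
  have hd : ∀ x, |deriv (KK D) x| ≤ ‖deriv F x‖ := by
    intro x
    have : HasDerivAt (KK D) (Complex.reCLM (deriv F x)) x := by
      rw [hK]
      exact Complex.reCLM.hasFDerivAt.comp_hasDerivAt x (F.differentiableAt.hasDerivAt)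
    rw [this.deriv]
    exact Complex.abs_re_le_norm _
  simp only [norm_iteratedFDeriv_eq_norm_iteratedDeriv, iteratedDeriv_one, iteratedDeriv_zero, hn,
    pow_zero, one_mul, Real.norm_eq_abs] at h0 h4 b0 b2
  refine ⟨2 * |C0| + 2 * |C4| + |B0| + |B2| + 1, by positivity, fun x => ?_, fun x => ?_⟩
  · have e := h0 x
    have e4 := h4 x
    have : |x|^4 = x^4 := by rw [← abs_pow]; exact abs_of_nonneg (by positivity)
    rw [this] at e4
    have : (1 + x^2)^2 ≤ 2 + 2 * x^4 := by nlinarith [sq_nonneg (x^2 - 1)]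
    have := mul_le_mul_of_nonneg_left this (abs_nonneg (KK D x))
    have := le_abs_self C0
    have := le_abs_self C4
    have := abs_nonneg B0
    have := abs_nonneg B2
    nlinarith
  · have e := b0 x
    have e2 := b2 x
    rw [sq_abs] at e2
    have hdx := hd x
    have := mul_le_mul_of_nonneg_right hdx (by positivity : 0 ≤ 1 + x^2)
    have := le_abs_self B0
    have := le_abs_self B2
    have := abs_nonneg C0
    have := abs_nonneg C4
    nlinarith

theorem chi_eq_one (D : LPData) (ξ : ℝ) (h : |ξ| < 3/4) : D.chi ξ = 1 := by
  have := D.partition ξ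
  have h0 : ∀ j : ℕ, D.phi ((2:ℝ) ^ (-(j:ℤ)) * ξ) = 0 := by
    intro j
    apply D.phi_supp
    left
    rw [abs_mul, abs_of_pos (by positivity)]
    have : (2:ℝ) ^ (-(j:ℤ)) ≤ 1 := by
      apply zpow_le_one_of_nonpos₀ (by norm_num) (by simp)
    nlinarith [abs_nonneg ξ]
  simpa only [h0, tsum_zero, add_zero] using this

theorem KK_integrable (D : LPData) : Integrable (KK D) := by
  obtain ⟨A, F, -, -, hF⟩ := exists_KS D 1 one_pos
  have hK : KK D = fun x => (F x).re := by
    ext x; simp [hF]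
  rw [hK]
  exact F.integrable.re

theorem KK_integral (D : LPData) : ∫ x, KK D x = 1 := by
  obtain ⟨A, F, hA, hFA, hF⟩ := exists_KS D 1 one_pos
  have h1 : 𝓕 F = A := by rw [hFA]; simp
  have h2 : 𝓕 F 0 = 1 := by
    rw [h1, hA]; simp [chi_eq_one D 0 (by norm_num)]
  rw [SchwartzMap.fourier_coe, Real.fourier_eq'] at h2
  simp [hF] at h2
  rw [integral_complex_ofReal] at h2
  exact_mod_cast h2

theorem KK_conv (D : LPData) (s : ℝ) (hs : 2 ≤ s) (x : ℝ) :
    ∫ y, (s * KK D (s * y)) * KK D (x - y) = KK D x := by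
  have hs0 : 0 < s := by linarith
  obtain ⟨A, F, hA, hFA, hF⟩ := exists_KS D s hs0
  obtain ⟨A1, F1, hA1, hFA1, hF1⟩ := exists_KS D 1 one_pos
  have h := SchwartzMap.convolution_apply (ContinuousLinearMap.mul ℂ ℂ) F F1 x
  have h2 : SchwartzMap.convolution (ContinuousLinearMap.mul ℂ ℂ) F F1 = F1 := by
    have e : 𝓕 (SchwartzMap.convolution (ContinuousLinearMap.mul ℂ ℂ) F F1) = 𝓕 F1 := by
      rw [SchwartzMap.fourier_convolution, hFA, hFA1]
      ext η
      simp [hA, hA1]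
      norm_cast
      by_cases hc : (4:ℝ)/3 < |2 * Real.pi * η|
      · rw [D.chi_supp _ hc]; simp
      · push Not at hc
        rw [chi_eq_one D (2 * Real.pi * η / s)]
        · simp
        · rw [abs_div, abs_of_pos hs0, div_lt_iff₀ hs0]
          linarith
    have := congrArg (fun G : 𝓢(ℝ, ℂ) => 𝓕⁻ G) e
    simpa using this
  rw [h2] at h
  rw [MeasureTheory.convolution_def] at h
  simp only [ContinuousLinearMap.mul_apply', hF, hF1, one_mul] at h
  have h3 : ((KK D x : ℝ) : ℂ) = ((∫ y, (s * KK D (s * y)) * KK D (x - y) : ℝ) : ℂ) := by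
    rw [h, ← integral_complex_ofReal]
    push_cast
    rfl
  exact_mod_cast h3.symm

theorem phi_eq (D : LPData) (ξ : ℝ) : D.phi ξ = D.chi (ξ / 2) - D.chi ξ := by
  have h1 := D.partition ξ
  have h2 := D.partition (ξ / 2)
  have hsum : Summable (fun j : ℕ => D.phi ((2:ℝ) ^ (-(j:ℤ)) * ξ)) := by
    obtain ⟨n, hn⟩ := exists_nat_gt (2 * |ξ|)
    apply summable_of_ne_finset_zero (s := Finset.range n)
    intro j hj
    apply D.phi_supp
    left
    rw [abs_mul, abs_of_pos (by positivity), zpow_neg, zpow_natCast, inv_mul_lt_iff₀ (by positivity)]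
    have : (j:ℝ) < 2 ^ j := by exact_mod_cast Nat.lt_two_pow_self
    have : (n:ℝ) ≤ j := by
      have := Finset.mem_range.not.mp hj
      exact_mod_cast (not_lt.mp this)
    linarith
  rw [hsum.tsum_eq_zero_add] at h1
  have e : ∀ j : ℕ, (2:ℝ) ^ (-((j + 1 : ℕ):ℤ)) * ξ = (2:ℝ) ^ (-(j:ℤ)) * (ξ / 2) := by
    intro j
    push_cast
    rw [neg_add, zpow_add₀ (by norm_num)]
    norm_num
    ring
  simp only [e] at h1
  simp at h1 h2
  linarith

/-- smoothing operator at frequency `s`. -/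
noncomputable def SS (D : LPData) (s : ℝ) (f : ℝ → ℝ) (x : ℝ) : ℝ :=
  ∫ y, (s * KK D (s * y)) * f (x - y)

theorem LPblock_neg_one (D : LPData) (f : ℝ → ℝ) (x : ℝ) : LPblock D (-1) f x = SS D 1 f x := by
  unfold LPblock SS
  simp only [if_true, invFT_chi_real]
  norm_cast
  simp

theorem KK_scale_integrable (D : LPData) {s : ℝ} (hs : 0 < s) :
    Integrable (fun y => s * KK D (s * y)) :=
  ((KK_integrable D).comp_mul_left' hs.ne').const_mul s

theorem SS_integrable (D : LPData) {s : ℝ} (hs : 0 < s) {f : ℝ → ℝ} (hf : Measurable f) {M : ℝ}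
    (hM : ∀ x, |f x| ≤ M) (x : ℝ) :
    Integrable (fun y => (s * KK D (s * y)) * f (x - y)) := by
  apply (KK_scale_integrable D hs).mul_bdd (c := M)
  · exact (hf.comp (measurable_const.sub measurable_id)).aestronglyMeasurable
  · exact Filter.Eventually.of_forall fun y => hM _

theorem LPblock_nat (D : LPData) (j : ℕ) {f : ℝ → ℝ} (hf : Measurable f) {M : ℝ}
    (hM : ∀ x, |f x| ≤ M) (x : ℝ) :
    LPblock D (j : ℤ) f x = SS D (2 ^ (j + 1)) f x - SS D (2 ^ j) f x := by
  have h1 : (j:ℤ) ≠ -1 := by omega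
  have h2 : (0:ℤ) ≤ j := by omega
  unfold LPblock
  simp only [h1, h2, if_true, if_false]
  have p1 : (0:ℝ) < 2 ^ j := by positivity
  have p2 : (0:ℝ) < 2 ^ (j + 1) := by positivity
  have hk : ∀ y, invFT (fun ξ => (D.phi ((2:ℝ) ^ (-(j:ℤ)) * ξ) : ℂ)) y =
      ((2 ^ (j + 1) * KK D (2 ^ (j + 1) * y) - 2 ^ j * KK D (2 ^ j * y) : ℝ) : ℂ) := by
    intro y
    have e1 := invFT_scale (fun ξ => (D.chi ξ : ℂ)) _ p1 y
    have e2 := invFT_scale (fun ξ => (D.chi ξ : ℂ)) _ p2 y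
    rw [invFT_chi_real] at e1 e2
    push_cast at e1 e2 ⊢
    rw [← e1, ← e2]
    unfold invFT
    rw [← mul_sub]
    have hInt0 : ∀ s : ℝ, 0 < s → Integrable
        (fun ξ : ℝ => Complex.exp (Complex.I * (y:ℂ) * (ξ:ℂ)) * (D.chi (s⁻¹ * ξ) : ℂ)) := by
      intro s hs
      have hc : Continuous (fun ξ : ℝ => Complex.exp (Complex.I * (y:ℂ) * (ξ:ℂ)) * (D.chi (s⁻¹ * ξ) : ℂ)) := by
        have := D.chi_smooth.continuous
        fun_prop
      apply hc.integrable_of_hasCompactSupport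
      apply HasCompactSupport.intro (K := Set.Icc (-(2 * s)) (2 * s)) isCompact_Icc
      intro z hz
      rw [D.chi_supp]
      · simp
      · have hx' : 2 * s < |z| := by
          by_contra hcon
          push Not at hcon
          exact hz (abs_le.mp hcon)
        rw [abs_mul, abs_of_pos (by positivity), lt_inv_mul_iff₀ hs]
        linarith
    have i1 := hInt0 _ p1
    have i2 := hInt0 _ p2
    rw [← integral_sub i2 i1]
    congr 2
    ext ξ
    beta_reduce
    rw [phi_eq, ← mul_sub]
    congr 1
    push_cast
    congr 3
    · rw [zpow_neg, zpow_natCast, pow_succ]; field_simp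
    · rw [zpow_neg, zpow_natCast]
  simp only [hk]
  unfold SS
  rw [← integral_sub (SS_integrable D p2 hf hM x) (SS_integrable D p1 hf hM x)]
  norm_cast
  congr 1
  ext y
  ring

end


section

open MeasureTheory Set Filter
open scoped ENNReal NNReal Topology

theorem KK_continuous (D : LPData) : Continuous (KK D) := (KK_contDiff D).continuous

theorem KK_hasDerivAt (D : LPData) (x : ℝ) : HasDerivAt (KK D) (deriv (KK D) x) x :=
  ((KK_contDiff D).differentiable (by norm_num) x).hasDerivAt

theorem KK_abs_mul_integrable (D : LPData) : Integrable (fun y => |y| * |KK D y|) := by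
  obtain ⟨C, hC, h1, -⟩ := KK_decay D
  have hi : Integrable (fun y : ℝ => C * (1 + y^2)⁻¹) := integrable_inv_one_add_sq.const_mul C
  apply hi.mono'
  · exact (continuous_abs.mul (KK_continuous D).abs).aestronglyMeasurable
  · refine Filter.Eventually.of_forall fun y => ?_
    have := h1 y
    rw [Real.norm_eq_abs, abs_of_nonneg (by positivity), ← div_eq_mul_inv, le_div_iff₀ (by positivity)]
    have h2 : |y| ≤ 1 + y^2 := by
      rw [← sq_abs]; nlinarith [sq_nonneg (|y| - 1), abs_nonneg y]
    calc |y| * |KK D y| * (1 + y^2) ≤ (1 + y^2) * |KK D y| * (1 + y^2) := by gcongr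
      _ = |KK D y| * (1 + y^2)^2 := by ring
      _ ≤ C := this

theorem KK_shift (D : LPData) : ∃ B : ℝ, 0 < B ∧ ∀ h : ℝ, ∫ z, |KK D (z + h) - KK D z| ≤ B * |h| := by
  obtain ⟨C, hC, h1, h2⟩ := KK_decay D
  set A := ∫ z, |KK D z|
  have hA : 0 ≤ A := integral_nonneg fun z => abs_nonneg _
  have hi : Integrable (fun y : ℝ => (1 + y^2)⁻¹) := integrable_inv_one_add_sq
  set E := ∫ y : ℝ, (1 + y^2)⁻¹
  have hE : 0 ≤ E := integral_nonneg fun z => by positivity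
  refine ⟨4 * C * E + 2 * A + 1, by positivity, fun h => ?_⟩
  have hInt0 : Integrable (fun z => |KK D (z + h) - KK D z|) :=
    (((KK_integrable D).comp_add_right h).sub (KK_integrable D)).abs
  by_cases hh : |h| ≤ 1
  · have : ∀ z, |KK D (z + h) - KK D z| ≤ (4 * C * |h|) * (1 + z^2)⁻¹ := by
      intro z
      have key : ∀ ζ ∈ Set.uIcc z (z + h), ‖deriv (KK D) ζ‖ ≤ 4 * C * (1 + z^2)⁻¹ := by
        intro ζ hζ
        have hd : |z - ζ| ≤ 1 := by
          have := Set.abs_sub_left_of_mem_uIcc hζ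
          rw [abs_sub_comm] at this
          simp at this
          linarith
        have := h2 ζ
        rw [← div_eq_mul_inv, le_div_iff₀ (by positivity), Real.norm_eq_abs]
        have hz : 1 + z^2 ≤ 4 * (1 + ζ^2) := by
          have := abs_le.mp hd
          nlinarith [sq_nonneg (z - ζ), sq_nonneg (z - 2 * ζ)]
        calc |deriv (KK D) ζ| * (1 + z^2) ≤ |deriv (KK D) ζ| * (4 * (1 + ζ^2)) := by gcongr
          _ ≤ 4 * C := by linarith
      have := Convex.norm_image_sub_le_of_norm_deriv_le (f := KK D)
        (fun x _ => (KK_hasDerivAt D x).differentiableAt) key (convex_uIcc z (z + h))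
        Set.left_mem_uIcc Set.right_mem_uIcc
      simp only [Real.norm_eq_abs, add_sub_cancel_left] at this
      linarith
    calc ∫ z, |KK D (z + h) - KK D z| ≤ ∫ z : ℝ, (4 * C * |h|) * (1 + z^2)⁻¹ :=
          integral_mono hInt0 (hi.const_mul _) this
      _ = 4 * C * |h| * E := by rw [integral_const_mul]
      _ ≤ _ := by nlinarith [abs_nonneg h, mul_nonneg hA (abs_nonneg h)]
  · push Not at hh
    have e : ∫ z, |KK D (z + h)| = A := integral_add_right_eq_self (fun z => |KK D z|) h
    calc ∫ z, |KK D (z + h) - KK D z| ≤ ∫ z, (|KK D (z + h)| + |KK D z|) :=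
          integral_mono hInt0 (((KK_integrable D).comp_add_right h).abs.add (KK_integrable D).abs)
            (fun z => abs_sub _ _)
      _ = 2 * A := by
          rw [integral_add ((KK_integrable D).comp_add_right h).abs (KK_integrable D).abs, e]; ring
      _ ≤ _ := by nlinarith [mul_nonneg (mul_nonneg hC.le hE) (abs_nonneg h)]

theorem integral_scale (g : ℝ → ℝ) {s : ℝ} (hs : 0 < s) : ∫ y, s * g (s * y) = ∫ y, g y := by
  rw [integral_const_mul, Measure.integral_comp_mul_left, abs_of_pos (by positivity), smul_eq_mul]
  field_simp

theorem SS_bound (D : LPData) {s : ℝ} (hs : 0 < s) {f : ℝ → ℝ} {M : ℝ}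
    (hM : ∀ x, |f x| ≤ M) (x : ℝ) : |SS D s f x| ≤ (∫ z, |KK D z|) * M := by
  unfold SS
  have e := integral_scale (fun z => |KK D z|) hs
  rw [← e, ← integral_mul_const, ← Real.norm_eq_abs]
  apply norm_integral_le_of_norm_le
  · have := ((KK_scale_integrable D hs).abs).mul_const M
    simpa only [abs_mul, abs_of_pos hs] using this
  · refine Filter.Eventually.of_forall fun y => ?_
    rw [norm_mul, Real.norm_eq_abs, Real.norm_eq_abs, abs_mul, abs_of_pos hs]
    exact mul_le_mul_of_nonneg_left (hM _) (by positivity)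

theorem SS_eq_left (D : LPData) {s : ℝ} (f : ℝ → ℝ) (x : ℝ) :
    SS D s f x = ∫ y, (s * KK D (s * (x - y))) * f y := by
  unfold SS
  rw [← integral_sub_left_eq_self _ volume x]
  simp

theorem SS_lip (D : LPData) : ∃ B : ℝ, 0 < B ∧ ∀ s : ℝ, 0 < s → ∀ f : ℝ → ℝ, Measurable f →
    ∀ M : ℝ, (∀ x, |f x| ≤ M) → ∀ x y, |SS D s f x - SS D s f y| ≤ B * s * M * |x - y| := by
  obtain ⟨B, hB, h⟩ := KK_shift D
  refine ⟨B, hB, fun s hs f hf M hM x y => ?_⟩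
  have hM0 : 0 ≤ M := (abs_nonneg _).trans (hM 0)
  rw [SS_eq_left, SS_eq_left]
  have hi : ∀ x, Integrable (fun z => (s * KK D (s * (x - z))) * f z) := by
    intro x
    have := (SS_integrable D hs hf hM x).comp_sub_left x
    simpa using this
  rw [← integral_sub (hi x) (hi y), ← Real.norm_eq_abs]
  have hi2 : ∀ x, Integrable (fun z => s * KK D (s * (x - z))) := fun x =>
    (KK_scale_integrable D hs).comp_sub_left x
  have hInt0 : Integrable (fun z => |s * KK D (s * (x - z)) - s * KK D (s * (y - z))| * M) :=
    ((hi2 x).sub (hi2 y)).abs.mul_const M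
  have := norm_integral_le_of_norm_le hInt0 (f := fun z => s * KK D (s * (x - z)) * f z - s * KK D (s * (y - z)) * f z)
    (Filter.Eventually.of_forall fun z => by
      rw [← sub_mul, norm_mul, Real.norm_eq_abs, Real.norm_eq_abs]
      exact mul_le_mul_of_nonneg_left (hM _) (by positivity))
  refine this.trans ?_
  rw [integral_mul_const]
  have e : ∫ z, |s * KK D (s * (x - z)) - s * KK D (s * (y - z))| =
      ∫ z, |KK D (z + s * (x - y)) - KK D z| := by
    rw [← integral_scale (fun z => |KK D (z + s * (x - y)) - KK D z|) hs,
      ← integral_sub_left_eq_self (fun z => |s * KK D (s * (x - z)) - s * KK D (s * (y - z))|) volume y]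
    congr 1
    ext z
    rw [← mul_sub, abs_mul, abs_of_pos hs]
    have e1 : s * (x - (y - z)) = s * z + s * (x - y) := by ring
    have e2 : s * (y - (y - z)) = s * z := by ring
    rw [e1, e2]
  rw [e]
  have := mul_le_mul_of_nonneg_right (h (s * (x - y))) hM0
  rw [abs_mul, abs_of_pos hs] at this
  linarith

theorem SS_continuous (D : LPData) {s : ℝ} (hs : 0 < s) {f : ℝ → ℝ} (hf : Measurable f) {M : ℝ}
    (hM : ∀ x, |f x| ≤ M) : Continuous (SS D s f) := by
  obtain ⟨B, hB, h⟩ := SS_lip D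
  have hM0 : 0 ≤ M := (abs_nonneg _).trans (hM 0)
  have : LipschitzWith (B * s * M).toNNReal (SS D s f) := by
    apply LipschitzWith.of_dist_le_mul
    intro x y
    rw [Real.coe_toNNReal _ (by positivity)]
    exact h s hs f hf M hM x y
  exact this.continuous

theorem SS_approx (D : LPData) {s : ℝ} (hs : 0 < s) {f : ℝ → ℝ} (hf : Measurable f) {M l : ℝ}
    (hM : ∀ x, |f x| ≤ M) (hl : ∀ x y, |f x - f y| ≤ l * |x - y|) (x : ℝ) :
    |SS D s f x - f x| ≤ (∫ y, |y| * |KK D y|) * l / s := by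
  have e1 : f x = ∫ y, (s * KK D (s * y)) * f x := by
    rw [integral_mul_const, integral_scale _ hs, KK_integral, one_mul]
  have hl0 : 0 ≤ l := by
    have := (abs_nonneg _).trans (hl 0 1)
    simpa using this
  conv_lhs => rw [e1]
  unfold SS
  rw [← integral_sub (SS_integrable D hs hf hM x) ((KK_scale_integrable D hs).mul_const _),
    ← Real.norm_eq_abs]
  have e2 := integral_scale (fun y => |y| * |KK D y|) hs
  have hi : Integrable (fun y => s * (|s * y| * |KK D (s * y)|) * (l / s)) :=
    (((KK_abs_mul_integrable D).comp_mul_left' hs.ne').const_mul s).mul_const _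
  have := norm_integral_le_of_norm_le hi (f := fun y => s * KK D (s * y) * f (x - y) - s * KK D (s * y) * f x)
    (Filter.Eventually.of_forall fun z => by
      rw [← mul_sub, norm_mul, Real.norm_eq_abs, Real.norm_eq_abs, abs_mul, abs_of_pos hs, abs_mul,
        abs_of_pos hs]
      have := hl (x - z) x
      have e : |x - z - x| = |z| := by simp
      rw [e] at this
      calc s * |KK D (s * z)| * |f (x - z) - f x| ≤ s * |KK D (s * z)| * (l * |z|) := by gcongr
        _ = _ := by field_simp)
  refine this.trans (le_of_eq ?_)
  rw [integral_mul_const, e2]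
  ring

theorem SS_hasDerivAt (D : LPData) {s : ℝ} (hs : 0 < s) {v : ℝ → ℝ} {k : ℝ≥0}
    (hk : LipschitzWith k v) {M : ℝ} (hM : ∀ x, |v x| ≤ M) (x : ℝ) :
    HasDerivAt (SS D s v) (SS D s (deriv v) x) x := by
  unfold SS
  have hm : Measurable v := hk.continuous.measurable
  have := hasDerivAt_integral_of_dominated_loc_of_lip (μ := volume) (x₀ := x) (s := Set.univ)
    (F := fun x y => s * KK D (s * y) * v (x - y))
    (F' := fun y => s * KK D (s * y) * deriv v (x - y))
    (bound := fun y => |s * KK D (s * y)| * k) Filter.univ_mem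
    (Filter.Eventually.of_forall fun x => (SS_integrable D hs hm hM x).aestronglyMeasurable)
    (SS_integrable D hs hm hM x) ?_ ?_ ((KK_scale_integrable D hs).abs.mul_const _) ?_
  · exact this.2
  · apply AEStronglyMeasurable.mul
    · exact (KK_scale_integrable D hs).aestronglyMeasurable
    · exact ((measurable_deriv v).comp (measurable_const.sub measurable_id)).aestronglyMeasurable
  · refine Filter.Eventually.of_forall fun y => ?_
    rw [lipschitzOnWith_univ]
    apply LipschitzWith.of_dist_le_mul
    intro a b
    rw [Real.dist_eq, ← mul_sub, abs_mul, Real.coe_nnabs, abs_of_nonneg (by positivity : 0 ≤ |s * KK D (s * y)| * (k:ℝ)), mul_assoc]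
    apply mul_le_mul_of_nonneg_left _ (abs_nonneg _)
    have := hk.dist_le_mul (a - y) (b - y)
    rw [Real.dist_eq, Real.dist_eq] at this
    rw [Real.dist_eq]
    simpa using this
  · have h1 := hk.ae_differentiableAt_real
    have h2 : ∀ᵐ y : ℝ, DifferentiableAt ℝ v (x - y) := by
      have hq := (Measure.measurePreserving_sub_left volume x).quasiMeasurePreserving
      exact hq.ae h1
    filter_upwards [h2] with y hy
    have h3 : HasDerivAt (fun z => v (z - y)) (deriv v (x - y)) x := by
      exact HasDerivAt.comp_sub_const x y hy.hasDerivAt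
    exact h3.const_mul _

theorem SS_SS (D : LPData) {r s : ℝ} (hr : 0 < r) (hrs : 2 * r ≤ s) {f : ℝ → ℝ} (hf : Measurable f) {M : ℝ}
    (hM : ∀ x, |f x| ≤ M) (x : ℝ) : SS D s (SS D r f) x = SS D r f x := by
  have hs : 0 < s := by linarith
  have hconv : ∀ w, ∫ y, (s * KK D (s * y)) * (r * KK D (r * (w - y))) = r * KK D (r * w) := by
    intro w
    have h := KK_conv D (s / r) (by rw [le_div_iff₀ hr]; exact hrs) (r * w)
    rw [← h, ← integral_const_mul]
    symm
    rw [← integral_scale _ hr]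
    congr 1
    ext y
    have : s / r * (r * y) = s * y := by field_simp
    rw [this]
    field_simp
  have e1 : SS D s (SS D r f) x = ∫ y, ∫ w, (s * KK D (s * y)) * (r * KK D (r * (w - y))) * f (x - w) := by
    conv_lhs => unfold SS
    congr 1
    ext y
    rw [← integral_const_mul]
    rw [← integral_sub_right_eq_self _ y]
    congr 1
    ext w
    have : x - y - (w - y) = x - w := by ring
    rw [this]
    ring
  rw [e1, integral_integral_swap]
  · unfold SS
    congr 1
    ext w
    rw [integral_mul_const, hconv]
  · have i1 : Integrable (fun p : ℝ × ℝ => (s * KK D (s * p.1)) * (r * KK D (r * p.2))) (volume.prod volume) :=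
      (KK_scale_integrable D hs).mul_prod (KK_scale_integrable D hr)
    have mp : MeasurePreserving (fun p : ℝ × ℝ => (p.1, p.2 - p.1)) (volume.prod volume) (volume.prod volume) := by
      apply MeasurePreserving.skew_product (g := fun a b => b - a) (MeasurePreserving.id _)
      · exact (measurable_snd.sub measurable_fst)
      · refine Filter.Eventually.of_forall fun y => ?_
        exact (measurePreserving_sub_right volume y).map_eq
    have i2 := mp.integrable_comp_of_integrable i1
    have := i2.mul_bdd (c := M) (g := fun p : ℝ × ℝ => f (x - p.2)) ?_ ?_
    · exact this
    · exact (hf.comp (measurable_const.sub measurable_snd)).aestronglyMeasurable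
    · exact Filter.Eventually.of_forall fun y => hM _

theorem SS_SS' (D : LPData) {r s : ℝ} (hr : 0 < r) (hrs : 2 * r ≤ s) {f : ℝ → ℝ} (hf : Measurable f) {M : ℝ}
    (hM : ∀ x, |f x| ≤ M) (x : ℝ) : SS D r (SS D s f) x = SS D r f x := by
  have hs : 0 < s := by linarith
  rw [← SS_SS D hr hrs hf hM]
  -- commute
  have comm : ∀ {a b : ℝ}, 0 < a → 0 < b → SS D a (SS D b f) x =
      ∫ y, ∫ w, (a * KK D (a * y)) * (b * KK D (b * w)) * f (x - (y + w)) := by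
    intro a b ha hb
    unfold SS
    congr 1
    ext y
    rw [← integral_const_mul]
    congr 1
    ext w
    rw [sub_sub]; ring
  rw [comm hr hs, comm hs hr, integral_integral_swap]
  · congr 1; ext y; congr 1; ext w; rw [add_comm w y]; ring
  · have i1 : Integrable (fun p : ℝ × ℝ => (r * KK D (r * p.1)) * (s * KK D (s * p.2))) (volume.prod volume) :=
      (KK_scale_integrable D hr).mul_prod (KK_scale_integrable D hs)
    have := i1.mul_bdd (c := M) (g := fun p : ℝ × ℝ => f (x - (p.1 + p.2))) ?_ ?_
    · exact this
    · exact (hf.comp (measurable_const.sub (measurable_fst.add measurable_snd))).aestronglyMeasurable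
    · exact Filter.Eventually.of_forall fun y => hM _

end


section

open MeasureTheory Set Filter
open scoped ENNReal NNReal Topology

/-- the n-th Littlewood–Paley block (n = j+1) via `SS`. -/
noncomputable def blk (D : LPData) (n : ℕ) (f : ℝ → ℝ) (x : ℝ) : ℝ :=
  match n with
  | 0 => SS D 1 f x
  | j + 1 => SS D (2 ^ (j + 1)) f x - SS D (2 ^ j) f x

theorem blk_sum (D : LPData) (f : ℝ → ℝ) (n : ℕ) (x : ℝ) :
    ∑ i ∈ Finset.range (n + 1), blk D i f x = SS D (2 ^ n) f x := by
  induction n with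
  | zero => simp [blk]
  | succ n ih => rw [Finset.sum_range_succ, ih]; simp [blk]

theorem LPblock_blk (D : LPData) (n : ℕ) {f : ℝ → ℝ} (hf : Measurable f) {M : ℝ} (hM : ∀ x, |f x| ≤ M) (x : ℝ) :
    LPblock D ((n : ℤ) - 1) f x = blk D n f x := by
  cases n with
  | zero => simpa [blk] using LPblock_neg_one D f x
  | succ j =>
    have : ((j + 1 : ℕ) : ℤ) - 1 = (j : ℤ) := by push_cast; ring
    rw [this]
    exact LPblock_nat D j hf hM x

theorem blk_continuous (D : LPData) (n : ℕ) {f : ℝ → ℝ} (hf : Measurable f) {M : ℝ}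
    (hM : ∀ x, |f x| ≤ M) : Continuous (blk D n f) := by
  cases n with
  | zero => exact SS_continuous D one_pos hf hM
  | succ j => exact (SS_continuous D (by positivity) hf hM).sub (SS_continuous D (by positivity) hf hM)

theorem cont_le_eLpNorm {f : ℝ → ℝ} (hf : Continuous f) (h : eLpNorm f ⊤ volume ≠ ⊤) (x : ℝ) :
    |f x| ≤ (eLpNorm f ⊤ volume).toReal := by
  have h1 : ∀ᵐ x, ‖f x‖ₑ ≤ eLpNorm f ⊤ volume := by
    rw [eLpNorm_exponent_top]; exact ae_le_eLpNormEssSup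
  have ho : IsOpen {x | eLpNorm f ⊤ volume < ‖f x‖ₑ} := isOpen_lt continuous_const hf.enorm
  have h2 : volume {x | eLpNorm f ⊤ volume < ‖f x‖ₑ} = 0 := by
    rw [ae_iff] at h1; simpa using h1
  rw [ho.measure_eq_zero_iff volume] at h2
  have h3 : x ∉ {x | eLpNorm f ⊤ volume < ‖f x‖ₑ} := by rw [h2]; simp
  simp only [mem_setOf_eq, not_lt] at h3
  have := ENNReal.toReal_mono h h3
  simpa using this

theorem besov_e (D : LPData) {g : ℝ → ℝ} (hg : Measurable g) {M : ℝ} (hM : ∀ x, |g x| ≤ M) {L : ℝ}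
    (hL : 0 ≤ L) (hb : besovNorm D 0 ⊤ g ≤ ENNReal.ofReal L) :
    ∃ e : ℕ → ℝ, (∀ n, 0 ≤ e n) ∧ Summable e ∧ ∑' n, e n ≤ L ∧ ∀ n x, |blk D n g x| ≤ e n := by
  set E : ℕ → ℝ≥0∞ := fun n => eLpNorm (blk D n g) ⊤ volume with hE
  have hEb : ∑' n, E n ≤ ENNReal.ofReal L := by
    refine le_trans ?_ hb
    unfold besovNorm
    have hinj : Function.Injective (fun n : ℕ => (n : ℤ) - 1) := by
      intro a b h; simpa using h
    refine le_trans (le_of_eq ?_) (ENNReal.tsum_comp_le_tsum_of_injective hinj _)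
    congr 1
    ext n
    have : LPblock D ((n : ℤ) - 1) g = blk D n g := by
      ext x; exact LPblock_blk D n hg hM x
    simp [this, hE]
  have hne : ∑' n, E n ≠ ⊤ := (hEb.trans_lt ENNReal.ofReal_lt_top).ne
  have hn : ∀ n, E n ≠ ⊤ := fun n => ENNReal.ne_top_of_tsum_ne_top hne n
  refine ⟨fun n => (E n).toReal, fun n => ENNReal.toReal_nonneg, ENNReal.summable_toReal hne, ?_, ?_⟩
  · rw [← ENNReal.tsum_toReal_eq hn]
    exact ENNReal.toReal_le_of_le_ofReal hL hEb
  · intro n x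
    exact cont_le_eLpNorm (blk_continuous D n hg hM) (hn n) x

theorem SS_sub (D : LPData) {s : ℝ} (hs : 0 < s) {f g : ℝ → ℝ} (hf : Measurable f) (hg : Measurable g) {M M' : ℝ}
    (hM : ∀ x, |f x| ≤ M) (hM' : ∀ x, |g x| ≤ M') (x : ℝ) :
    SS D s (fun y => f y - g y) x = SS D s f x - SS D s g x := by
  unfold SS
  rw [← integral_sub (SS_integrable D hs hf hM x) (SS_integrable D hs hg hM' x)]
  congr 1; ext y; ring

theorem D2_bound {v g : ℝ → ℝ} {l : ℝ} (hl : 0 ≤ l) (hv : ∀ x, HasDerivAt v (g x) x)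
    (hg : ∀ x y, |g x - g y| ≤ l * |x - y|) (q z : ℝ) : |v (q + z) + v (q - z) - 2 * v q| ≤ 2 * l * z ^ 2 := by
  have hd : ∀ y, HasDerivAt (fun y => v (q + y) + v (q - y)) (g (q + y) - g (q - y)) y := by
    intro y
    have h1 := HasDerivAt.comp_const_add q y (hv (q + y))
    have h2 := HasDerivAt.comp_const_sub q y (hv (q - y))
    exact (h1.add h2).congr_deriv (by ring)
  have := Convex.norm_image_sub_le_of_norm_hasDerivWithin_le (f := fun y => v (q + y) + v (q - y))
    (f' := fun y => g (q + y) - g (q - y)) (s := uIcc 0 z) (C := 2 * l * |z|) (x := 0) (y := z)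
    (fun y _ => (hd y).hasDerivWithinAt) (fun y hy => by
      have h := hg (q + y) (q - y)
      have e : q + y - (q - y) = 2 * y := by ring
      rw [e, abs_mul, abs_two] at h
      have : |y| ≤ |z| := by
        have := Set.abs_sub_left_of_mem_uIcc hy
        simpa using this
      rw [Real.norm_eq_abs]
      nlinarith) (convex_uIcc _ _) left_mem_uIcc right_mem_uIcc
  simp only [Real.norm_eq_abs, add_zero, sub_zero] at this
  have e2 : v (q + z) + v (q - z) - 2 * v q = v (q + z) + v (q - z) - (v q + v q) := by ring
  rw [e2, ← sq_abs z]
  nlinarith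

theorem lint_scale {c s : ℝ} (hc : 0 ≤ c) (hs : 0 < s) {d : ℝ → ℝ} (h1 : ∀ z, |d z| ≤ c / s)
    (h2 : ∀ z, |d z| ≤ c * s * z ^ 2) :
    ∫⁻ z, ENNReal.ofReal (|d z| / z ^ 2) ≤ ENNReal.ofReal (2 * Real.pi * c) := by
  have hi : Integrable (fun z : ℝ => (2 * c) * (s * (1 + (s * z) ^ 2)⁻¹)) :=
    ((integrable_inv_one_add_sq.comp_mul_left' hs.ne').const_mul s).const_mul _
  have e : ∫ z : ℝ, (2 * c) * (s * (1 + (s * z) ^ 2)⁻¹) = 2 * Real.pi * c := by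
    rw [integral_const_mul, integral_scale (fun z => (1 + z ^ 2)⁻¹) hs, integral_univ_inv_one_add_sq]
    ring
  rw [← e, ofReal_integral_eq_lintegral_ofReal hi (Eventually.of_forall fun z => by positivity)]
  apply lintegral_mono
  intro z
  apply ENNReal.ofReal_le_ofReal
  by_cases hz : z = 0
  · subst hz; simp; positivity
  · have hz2 : 0 < z ^ 2 := by positivity
    rw [div_le_iff₀ hz2]
    have h1 := h1 z
    have h2 := h2 z
    rw [le_div_iff₀ hs] at h1
    have : 2 * c * (s * (1 + (s * z) ^ 2)⁻¹) * z ^ 2 = 2 * c * s * z ^ 2 / (1 + (s * z) ^ 2) := by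
      field_simp
    rw [this, le_div_iff₀ (by positivity)]
    have : |d z| * s * (s * z ^ 2) ≤ c * (s * z ^ 2) := mul_le_mul_of_nonneg_right h1 (by positivity)
    nlinarith

theorem lemF (D : LPData) : ∃ C : ℝ, 0 < C ∧ ∀ (v : ℝ → ℝ) (k : ℝ≥0) (M L : ℝ), LipschitzWith k v →
    (∀ x, |v x| ≤ M) → 0 ≤ L → besovNorm D 0 ⊤ (deriv v) ≤ ENNReal.ofReal L →
    (∀ x, HasDerivAt v (deriv v x) x) ∧ Continuous (deriv v) ∧ (∀ x, |deriv v x| ≤ L) ∧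
    ∀ q, ∫⁻ z, ENNReal.ofReal (|v (q + z) + v (q - z) - 2 * v q| / z ^ 2) ≤ ENNReal.ofReal (C * (L + M)) := by
  obtain ⟨B, hB, hlip⟩ := SS_lip D
  set A0 := ∫ z, |KK D z| with hA0d
  have hA0 : 0 ≤ A0 := integral_nonneg fun z => abs_nonneg _
  set A1 := ∫ y, |y| * |KK D y| with hA1d
  have hA1 : 0 ≤ A1 := integral_nonneg fun z => by positivity
  refine ⟨2 * Real.pi * (4 * A0 + 8 * (A1 + B)) + 1, by positivity, ?_⟩
  intro v k M L hv hM hL hb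
  have hvm : Measurable v := hv.continuous.measurable
  set g := deriv v with hg
  have hgm : Measurable g := measurable_deriv v
  have hgb : ∀ x, |g x| ≤ k := fun x => norm_deriv_le_of_lipschitz hv
  have hM0 : 0 ≤ M := (abs_nonneg _).trans (hM 0)
  obtain ⟨e, he0, hes, hesum, hebd⟩ := besov_e D hgm hgb hL hb
  have happ : ∀ x, Tendsto (fun n : ℕ => SS D (2 ^ n) v x) atTop (𝓝 (v x)) := by
    intro x
    rw [tendsto_iff_dist_tendsto_zero]
    refine squeeze_zero (fun n => dist_nonneg) (g := fun n : ℕ => (A1 * k) * (1 / 2) ^ n) (fun n => ?_) ?_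
    · have := SS_approx D (s := 2 ^ n) (by positivity) hvm (l := k) hM (fun a b => hv.dist_le_mul a b) x
      rw [Real.dist_eq]
      refine this.trans (le_of_eq ?_)
      rw [one_div, inv_pow]; rfl
    · simpa using (tendsto_pow_atTop_nhds_zero_of_lt_one (by norm_num) (by norm_num : (1 / 2 : ℝ) < 1)).const_mul (A1 * (k : ℝ))
  set γ : ℝ → ℝ := fun x => ∑' n, blk D n g x with hγ
  have hder : ∀ x, HasDerivAt v (γ x) x := by
    have hu := tendstoUniformly_tsum_nat (f := fun n x => blk D n g x) hes (fun n x => hebd n x)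
    apply hasDerivAt_of_tendstoUniformly (f := fun n : ℕ => SS D (2 ^ n) v) (f' := fun n : ℕ => SS D (2 ^ n) g)
      (l := atTop)
    · intro u hu'
      have := (tendsto_add_atTop_nat 1).eventually (hu u hu')
      filter_upwards [this] with n hn x
      have := hn x
      rw [blk_sum] at this
      exact this
    · exact Eventually.of_forall fun n x => SS_hasDerivAt D (by positivity) hv hM x
    · exact happ
  have hgγ : g = γ := by ext x; exact (hder x).deriv
  have hgc : Continuous g := by
    rw [hgγ]
    exact continuous_tsum (fun n => blk_continuous D n hgm hgb) hes (fun n x => hebd n x)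
  have hgL : ∀ x, |g x| ≤ L := by
    intro x
    rw [hgγ]
    exact (tsum_of_norm_bounded (f := fun n => blk D n g x) hes.hasSum (fun n => hebd n x)).trans hesum
  refine ⟨fun x => by rw [hgγ]; exact hder x, hgc, hgL, ?_⟩
  intro q
  -- blocks of v
  set d : ℕ → ℝ → ℝ := fun n z => blk D n v (q + z) + blk D n v (q - z) - 2 * blk D n v q with hd
  set cc : ℕ → ℝ := fun n => 8 * (A1 + B) * e n + (if n = 0 then 4 * A0 * M else 0) with hcc
  have hcc0 : ∀ n, 0 ≤ cc n := by
    intro n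
    have := he0 n
    simp only [hcc]
    split_ifs <;> positivity
  have hccs : HasSum cc (8 * (A1 + B) * (∑' n, e n) + 4 * A0 * M) :=
    (hes.hasSum.mul_left _).add (hasSum_ite_eq 0 _)
  have hblk : ∀ n, ∫⁻ z, ENNReal.ofReal (|d n z| / z ^ 2) ≤ ENNReal.ofReal (2 * Real.pi * cc n) := by
    intro n
    have hderb : ∀ x, HasDerivAt (blk D n v) (blk D n g x) x := by
      intro x
      cases n with
      | zero => exact SS_hasDerivAt D one_pos hv hM x
      | succ j => exact (SS_hasDerivAt D (by positivity) hv hM x).sub (SS_hasDerivAt D (by positivity) hv hM x)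
    have hlipb : ∀ x y, |blk D n g x - blk D n g y| ≤ B * 2 ^ (n + 1) * e n * |x - y| := by
      have hrep : ∀ x, SS D (2 ^ (n + 1)) (blk D n g) x = blk D n g x := by
        intro x
        cases n with
        | zero => exact SS_SS D one_pos (by norm_num) hgm hgb x
        | succ j =>
          have h1 := SS_SS D (r := 2 ^ (j + 1)) (s := 2 ^ (j + 1 + 1)) (by positivity) (by rw [pow_succ _ (j + 1)]; linarith) hgm hgb x
          have h2 := SS_SS D (r := 2 ^ j) (s := 2 ^ (j + 1 + 1)) (by positivity)
            (by rw [pow_succ, pow_succ]; nlinarith [pow_pos (two_pos : (0:ℝ) < 2) j]) hgm hgb x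
          have h3 := SS_sub D (s := 2 ^ (j + 1 + 1)) (by positivity)
            (SS_continuous D (s := 2 ^ (j + 1)) (by positivity) hgm hgb).measurable
            (SS_continuous D (s := 2 ^ j) (by positivity) hgm hgb).measurable
            (SS_bound D (by positivity) hgb) (SS_bound D (by positivity) hgb) x
          rw [h1, h2] at h3
          exact h3
      intro x y
      rw [← hrep x, ← hrep y]
      exact hlip _ (by positivity) _ (blk_continuous D n hgm hgb).measurable _ (hebd n) x y
    have hD2 := fun z => D2_bound (l := B * 2 ^ (n + 1) * e n) (by have := he0 n; positivity) hderb hlipb q z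
    apply lint_scale (hcc0 n) (s := 2 ^ n / 2 ^ (if n = 0 then 0 else 1)) (by positivity)
    · intro z
      cases n with
      | zero =>
        have hb := fun x => SS_bound D one_pos hM x
        have h1 := abs_le.mp (hb (q + z))
        have h2 := abs_le.mp (hb (q - z))
        have h3 := abs_le.mp (hb q)
        simp only [hd, hcc, blk]
        simp only [if_true, pow_zero, div_one]
        have := mul_nonneg (add_nonneg hA1 hB.le) (he0 0)
        rw [← hA0d] at h1 h2 h3
        rw [abs_le]
        constructor <;> linarith
      | succ j =>
        have hvb : ∀ x, |blk D (j + 1) v x| ≤ A1 * e (j + 1) / (2 ^ j / 2) := by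
          intro x
          have hcv := blk_continuous D (j + 1) hvm hM
          have hbb : ∀ x, |blk D (j + 1) v x| ≤ A0 * M + A0 * M := fun x =>
            (abs_sub _ _).trans (add_le_add (SS_bound D (by positivity) hM x) (SS_bound D (by positivity) hM x))
          have := SS_approx D (s := 2 ^ j / 2) (by positivity) hcv.measurable (l := e (j + 1)) hbb
            (fun a b => by
              have := Convex.norm_image_sub_le_of_norm_hasDerivWithin_le (f := blk D (j + 1) v) (s := univ)
                (fun x _ => (hderb x).hasDerivWithinAt) (fun x _ => hebd (j + 1) x) convex_univ (mem_univ b) (mem_univ a)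
              exact this) x
          have h0 : SS D (2 ^ j / 2) (blk D (j + 1) v) x = 0 := by
            have h1 := SS_SS' D (r := 2 ^ j / 2) (s := 2 ^ (j + 1)) (by positivity) (by rw [pow_succ]; nlinarith [pow_pos (two_pos : (0:ℝ) < 2) j]) hvm hM x
            have h2 := SS_SS' D (r := 2 ^ j / 2) (s := 2 ^ j) (by positivity) (by linarith) hvm hM x
            have h3 := SS_sub D (s := 2 ^ j / 2) (by positivity)
              (SS_continuous D (s := 2 ^ (j + 1)) (by positivity) hvm hM).measurable
              (SS_continuous D (s := 2 ^ j) (by positivity) hvm hM).measurable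
              (SS_bound D (by positivity) hM) (SS_bound D (by positivity) hM) x
            rw [h1, h2, sub_self] at h3
            exact h3
          rw [h0, zero_sub, abs_neg] at this
          exact this
        have h1 := abs_le.mp (hvb (q + z))
        have h2 := abs_le.mp (hvb (q - z))
        have h3 := abs_le.mp (hvb q)
        have e1 : cc (j + 1) / (2 ^ (j + 1) / 2 ^ (if j + 1 = 0 then 0 else 1)) = 4 * (A1 * e (j + 1) / (2 ^ j / 2)) + 8 * B * e (j + 1) / 2 ^ j := by
          simp only [hcc, Nat.add_eq_zero_iff, one_ne_zero, and_false, if_false, pow_succ]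
          field_simp
          ring
        rw [e1]
        have : 0 ≤ 8 * B * e (j + 1) / 2 ^ j := by have := he0 (j + 1); positivity
        rw [abs_le]
        constructor <;> simp only [hd] <;> linarith
    · intro z
      refine (hD2 z).trans ?_
      have := he0 n
      cases n with
      | zero =>
        simp only [hcc, if_true, pow_zero, div_one, zero_add, pow_one, mul_one]
        have h1 := mul_nonneg hA1 this
        have h2 := mul_nonneg hA0 hM0
        have h3 := mul_nonneg hB.le this
        apply mul_le_mul_of_nonneg_right _ (sq_nonneg z)
        linarith
      | succ j =>
        simp only [hcc, Nat.add_eq_zero_iff, one_ne_zero, and_false, if_false]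
        apply mul_le_mul_of_nonneg_right _ (sq_nonneg z)
        have h1 : (8 * (A1 + B) * e (j + 1) + 0) * (2 ^ (j + 1) / 2 ^ 1) = 8 * A1 * e (j + 1) * 2 ^ j + 2 * (B * 2 ^ (j + 1 + 1) * e (j + 1)) := by
          rw [pow_succ, pow_succ]; ring
        rw [h1]
        have : 0 ≤ 8 * A1 * e (j + 1) * 2 ^ j := by positivity
        linarith
  have hpt : ∀ z, ENNReal.ofReal (|v (q + z) + v (q - z) - 2 * v q| / z ^ 2) ≤ ∑' n, ENNReal.ofReal (|d n z| / z ^ 2) := by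
    intro z
    have ht : Tendsto (fun n : ℕ => ENNReal.ofReal (|SS D (2 ^ n) v (q + z) + SS D (2 ^ n) v (q - z) - 2 * SS D (2 ^ n) v q| / z ^ 2)) atTop
        (𝓝 (ENNReal.ofReal (|v (q + z) + v (q - z) - 2 * v q| / z ^ 2))) := by
      apply ENNReal.tendsto_ofReal
      exact (((happ (q + z)).add (happ (q - z))).sub ((happ q).const_mul 2)).abs.div_const _
    apply le_of_tendsto' ht
    intro n
    have e1 : SS D (2 ^ n) v (q + z) + SS D (2 ^ n) v (q - z) - 2 * SS D (2 ^ n) v q = ∑ i ∈ Finset.range (n + 1), d i z := by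
      simp only [hd, Finset.sum_sub_distrib, Finset.sum_add_distrib, ← Finset.mul_sum, blk_sum]
    rw [e1]
    calc ENNReal.ofReal (|∑ i ∈ Finset.range (n + 1), d i z| / z ^ 2) ≤ ENNReal.ofReal (∑ i ∈ Finset.range (n + 1), |d i z| / z ^ 2) := by
          apply ENNReal.ofReal_le_ofReal
          rw [← Finset.sum_div]
          exact div_le_div_of_nonneg_right (Finset.abs_sum_le_sum_abs _ _) (sq_nonneg z)
      _ = ∑ i ∈ Finset.range (n + 1), ENNReal.ofReal (|d i z| / z ^ 2) :=
          ENNReal.ofReal_sum_of_nonneg fun i _ => by positivity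
      _ ≤ _ := ENNReal.sum_le_tsum _
  have hdm : ∀ n, Measurable (fun z => ENNReal.ofReal (|d n z| / z ^ 2)) := by
    intro n
    have hc := blk_continuous D n hvm hM
    have : Continuous (d n) := by simp only [hd]; fun_prop
    exact ENNReal.measurable_ofReal.comp (this.abs.measurable.div (by fun_prop))
  calc ∫⁻ z, ENNReal.ofReal (|v (q + z) + v (q - z) - 2 * v q| / z ^ 2)
      ≤ ∫⁻ z, ∑' n, ENNReal.ofReal (|d n z| / z ^ 2) := lintegral_mono hpt
    _ = ∑' n, ∫⁻ z, ENNReal.ofReal (|d n z| / z ^ 2) := lintegral_tsum fun n => (hdm n).aemeasurable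
    _ ≤ ∑' n, ENNReal.ofReal (2 * Real.pi * cc n) := ENNReal.tsum_le_tsum hblk
    _ = ENNReal.ofReal (∑' n, 2 * Real.pi * cc n) := by
        rw [ENNReal.ofReal_tsum_of_nonneg (fun n => by have := hcc0 n; positivity) (hccs.summable.mul_left _)]
    _ ≤ _ := by
        apply ENNReal.ofReal_le_ofReal
        rw [tsum_mul_left, hccs.tsum_eq]
        have h1 : 8 * (A1 + B) * (∑' n, e n) + 4 * A0 * M ≤ (4 * A0 + 8 * (A1 + B)) * (L + M) := by
          have := mul_le_mul_of_nonneg_left hesum (by positivity : 0 ≤ 8 * (A1 + B))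
          have h2 := mul_nonneg (by positivity : 0 ≤ 8 * (A1 + B)) hM0
          have h3 := mul_nonneg (by positivity : 0 ≤ 4 * A0) hL
          nlinarith
        have := mul_le_mul_of_nonneg_left h1 (by positivity : 0 ≤ 2 * Real.pi)
        nlinarith

end


section

open MeasureTheory Set Filter
open scoped ENNReal NNReal Topology

theorem expabs_Iic : EqOn (fun y : ℝ => Real.exp (-|y|)) Real.exp (Iic 0) := by
  intro y hy; simp only [abs_of_nonpos (show y ≤ 0 from hy), neg_neg]

theorem expabs_Ioi : EqOn (fun y : ℝ => Real.exp (-|y|)) (fun y => Real.exp (-y)) (Ioi 0) := by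
  intro y hy; simp only [abs_of_pos (show 0 < y from hy)]

theorem expabs_integrable : Integrable (fun y : ℝ => Real.exp (-|y|)) := by
  rw [← integrableOn_univ, ← Iic_union_Ioi (a := (0:ℝ))]
  refine IntegrableOn.union ?_ ?_
  · exact (integrableOn_exp_Iic 0).congr_fun (fun y hy => (expabs_Iic hy).symm) measurableSet_Iic
  · exact (exp_neg_integrableOn_Ioi 0 one_pos |>.congr_fun (fun y hy => by
      simpa using (expabs_Ioi hy).symm) measurableSet_Ioi)

theorem expabs_integral : ∫ y : ℝ, Real.exp (-|y|) = 2 := by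
  rw [← intervalIntegral.integral_Iic_add_Ioi (b := 0) expabs_integrable.integrableOn expabs_integrable.integrableOn,
    setIntegral_congr_fun measurableSet_Iic expabs_Iic, setIntegral_congr_fun measurableSet_Ioi expabs_Ioi,
    integral_exp_Iic_zero, integral_exp_neg_Ioi_zero]
  norm_num

theorem inv_integrable {w : ℝ → ℝ} (hw : Continuous w) {M : ℝ} (hM : ∀ x, |w x| ≤ M) (x : ℝ) :
    Integrable (fun y => Real.exp (-|y|) * w (x - y)) :=
  expabs_integrable.mul_bdd (c := M) (hw.comp (continuous_const.sub continuous_id)).aestronglyMeasurable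
    (Eventually.of_forall fun y => hM _)

theorem invOneSub_abs_le {w : ℝ → ℝ} (x : ℝ) :
    |invOneSub w x| ≤ invOneSub (fun y => |w y|) x := by
  unfold invOneSub
  rw [abs_mul, abs_of_pos (by norm_num : (0:ℝ) < 1/2)]
  apply mul_le_mul_of_nonneg_left _ (by norm_num)
  refine (abs_integral_le_integral_abs).trans (le_of_eq ?_)
  congr 1; ext y; rw [abs_mul, Real.abs_exp]

theorem invOneSub_le {w : ℝ → ℝ} {M : ℝ} (hM : ∀ x, |w x| ≤ M) (x : ℝ) :
    invOneSub (fun y => |w y|) x ≤ M := by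
  unfold invOneSub
  have : ∫ y : ℝ, Real.exp (-|y|) * |w (x - y)| ≤ ∫ y : ℝ, Real.exp (-|y|) * M := by
    apply integral_mono_of_nonneg (Eventually.of_forall fun y => by positivity)
      (expabs_integrable.mul_const M)
    exact Eventually.of_forall fun y => mul_le_mul_of_nonneg_left (hM _) (by positivity)
  rw [integral_mul_const, expabs_integral] at this
  linarith

/-- the operator `∂ₓ(1-∂ₓₓ)⁻¹`. -/
noncomputable def A1op (w : ℝ → ℝ) (x : ℝ) : ℝ :=
  (1/2) * (-(Real.exp (-x) * ∫ z in Iic x, Real.exp z * w z) + Real.exp x * ∫ z in Ioi x, Real.exp (-z) * w z)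

theorem aInt {w : ℝ → ℝ} (hw : Continuous w) {M : ℝ} (hM : ∀ x, |w x| ≤ M) (x : ℝ) :
    IntegrableOn (fun z => Real.exp z * w z) (Iic x) :=
  Integrable.mul_bdd (c := M) (integrableOn_exp_Iic x) hw.aestronglyMeasurable (Eventually.of_forall fun y => hM _)

theorem bInt {w : ℝ → ℝ} (hw : Continuous w) {M : ℝ} (hM : ∀ x, |w x| ≤ M) (x : ℝ) :
    IntegrableOn (fun z => Real.exp (-z) * w z) (Ioi x) :=
  Integrable.mul_bdd (c := M) (show IntegrableOn (fun z => Real.exp (-z)) (Ioi x) volume by simpa using exp_neg_integrableOn_Ioi x one_pos) hw.aestronglyMeasurable (Eventually.of_forall fun y => hM _)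

theorem inv_eq {w : ℝ → ℝ} (hw : Continuous w) {M : ℝ} (hM : ∀ x, |w x| ≤ M) (x : ℝ) :
    invOneSub w x = (1/2) * ((Real.exp (-x) * ∫ z in Iic x, Real.exp z * w z) + Real.exp x * ∫ z in Ioi x, Real.exp (-z) * w z) := by
  unfold invOneSub
  congr 1
  rw [← integral_sub_left_eq_self _ volume x]
  have hi : Integrable (fun y => Real.exp (-|x - y|) * w (x - (x - y))) :=
    (inv_integrable hw hM x).comp_sub_left x
  rw [← intervalIntegral.integral_Iic_add_Ioi (b := x) hi.integrableOn hi.integrableOn, ← integral_const_mul, ← integral_const_mul]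
  congr 1
  · apply setIntegral_congr_fun measurableSet_Iic
    intro z hz
    simp only [mem_Iic] at hz
    simp only [abs_of_nonneg (sub_nonneg.mpr hz), sub_sub_cancel]
    rw [← mul_assoc, ← Real.exp_add]; ring_nf
  · apply setIntegral_congr_fun measurableSet_Ioi
    intro z hz
    simp only [mem_Ioi] at hz
    simp only [abs_of_neg (sub_neg.mpr hz), sub_sub_cancel]
    rw [← mul_assoc, ← Real.exp_add]; ring_nf

theorem A1op_abs_le {w : ℝ → ℝ} (hw : Continuous w) {M : ℝ} (hM : ∀ x, |w x| ≤ M) (x : ℝ) :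
    |A1op w x| ≤ invOneSub (fun y => |w y|) x := by
  rw [inv_eq hw.abs (M := M) (by simpa using hM) x]
  unfold A1op
  rw [abs_mul, abs_of_pos (by norm_num : (0:ℝ) < 1/2)]
  apply mul_le_mul_of_nonneg_left _ (by norm_num)
  refine (abs_add_le _ _).trans ?_
  rw [abs_neg, abs_mul, abs_mul, Real.abs_exp, Real.abs_exp]
  gcongr
  · refine (abs_integral_le_integral_abs).trans (le_of_eq ?_)
    congr 1; ext y; rw [abs_mul, Real.abs_exp]
  · refine (abs_integral_le_integral_abs).trans (le_of_eq ?_)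
    congr 1; ext y; rw [abs_mul, Real.abs_exp]

theorem a_deriv {w : ℝ → ℝ} (hw : Continuous w) {M : ℝ} (hM : ∀ x, |w x| ≤ M) (x : ℝ) :
    HasDerivAt (fun x => ∫ z in Iic x, Real.exp z * w z) (Real.exp x * w x) x := by
  have hc : Continuous (fun z => Real.exp z * w z) := Real.continuous_exp.mul hw
  have e : (fun x => ∫ z in Iic x, Real.exp z * w z) = fun x => (∫ z in Iic 0, Real.exp z * w z) + ∫ z in (0:ℝ)..x, Real.exp z * w z := by
    ext y
    rw [← intervalIntegral.integral_Iic_sub_Iic (aInt hw hM 0) (aInt hw hM y)]; ring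
  rw [e]
  exact (intervalIntegral.integral_hasDerivAt_right (hc.intervalIntegrable _ _) (hc.stronglyMeasurableAtFilter _ _) hc.continuousAt).const_add _

theorem b_deriv {w : ℝ → ℝ} (hw : Continuous w) {M : ℝ} (hM : ∀ x, |w x| ≤ M) (x : ℝ) :
    HasDerivAt (fun x => ∫ z in Ioi x, Real.exp (-z) * w z) (-(Real.exp (-x) * w x)) x := by
  have hc : Continuous (fun z => Real.exp (-z) * w z) := (Real.continuous_exp.comp continuous_neg).mul hw
  have e : (fun x => ∫ z in Ioi x, Real.exp (-z) * w z) = fun x => (∫ z in Ioi 0, Real.exp (-z) * w z) - ∫ z in (0:ℝ)..x, Real.exp (-z) * w z := by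
    ext y
    rw [← intervalIntegral.integral_interval_add_Ioi (bInt hw hM 0) (bInt hw hM y)]; ring
  rw [e]
  exact (intervalIntegral.integral_hasDerivAt_right (hc.intervalIntegrable _ _) (hc.stronglyMeasurableAtFilter _ _) hc.continuousAt).const_sub _

theorem exp_neg_deriv (x : ℝ) : HasDerivAt (fun x : ℝ => Real.exp (-x)) (-Real.exp (-x)) x := by
  have := (hasDerivAt_neg x).exp
  simpa using this

theorem inv_deriv {w : ℝ → ℝ} (hw : Continuous w) {M : ℝ} (hM : ∀ x, |w x| ≤ M) (x : ℝ) :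
    HasDerivAt (invOneSub w) (A1op w x) x := by
  have e : invOneSub w = fun x => (1/2) * ((Real.exp (-x) * ∫ z in Iic x, Real.exp z * w z) + Real.exp x * ∫ z in Ioi x, Real.exp (-z) * w z) := by
    ext y; exact inv_eq hw hM y
  rw [e]
  have h := ((((exp_neg_deriv x).mul (a_deriv hw hM x)).add ((Real.hasDerivAt_exp x).mul (b_deriv hw hM x))).const_mul (1/2:ℝ))
  refine h.congr_deriv ?_
  unfold A1op
  have h1 : Real.exp (-x) * Real.exp x = 1 := by rw [← Real.exp_add]; simp
  linear_combination (0:ℝ) * h1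

theorem A1op_deriv {w : ℝ → ℝ} (hw : Continuous w) {M : ℝ} (hM : ∀ x, |w x| ≤ M) (x : ℝ) :
    HasDerivAt (A1op w) (invOneSub w x - w x) x := by
  unfold A1op
  have h := ((((exp_neg_deriv x).mul (a_deriv hw hM x)).neg.add ((Real.hasDerivAt_exp x).mul (b_deriv hw hM x))).const_mul (1/2:ℝ))
  refine h.congr_deriv ?_
  rw [inv_eq hw hM x]
  have h1 : Real.exp (-x) * Real.exp x = 1 := by rw [← Real.exp_add]; simp
  linear_combination (- w x) * h1

theorem inv_of_deriv {F F' : ℝ → ℝ} (hF : ∀ x, HasDerivAt F (F' x) x) (hc : Continuous F') {M : ℝ}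
    (hM : ∀ x, |F x| ≤ M) (hM' : ∀ x, |F' x| ≤ M) (x : ℝ) : invOneSub F' x = A1op F x := by
  have hFc : Continuous F := continuous_iff_continuousAt.mpr fun x => (hF x).continuousAt
  have h1 := inv_deriv hFc hM x
  have h2 : HasDerivAt (invOneSub F) (invOneSub F' x) x := by
    unfold invOneSub
    apply HasDerivAt.const_mul
    have := hasDerivAt_integral_of_dominated_loc_of_deriv_le (μ := volume) (x₀ := x) (s := univ)
      (F := fun x y => Real.exp (-|y|) * F (x - y)) (F' := fun x y => Real.exp (-|y|) * F' (x - y))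
      (bound := fun y => Real.exp (-|y|) * M) univ_mem
      (Eventually.of_forall fun x => (inv_integrable hFc hM x).aestronglyMeasurable)
      (inv_integrable hFc hM x) (inv_integrable hc hM' x).aestronglyMeasurable
      (Eventually.of_forall fun y x _ => by
        rw [norm_mul, Real.norm_eq_abs, Real.abs_exp]
        exact mul_le_mul_of_nonneg_left (hM' _) (by positivity))
      (expabs_integrable.mul_const M)
      (Eventually.of_forall fun y x _ => (HasDerivAt.comp_sub_const x y (hF (x - y))).const_mul _)
    exact this.2
  exact h2.unique h1

theorem moment_bound : ∃ C : ℝ, 0 < C ∧ Integrable (fun y : ℝ => Real.exp (-|y|) * (1 + |y|) ^ 4) ∧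
    ∫ y : ℝ, Real.exp (-|y|) * (1 + |y|) ^ 4 ≤ C := by
  have hb : ∀ y : ℝ, Real.exp (-|y|) * (1 + |y|) ^ 4 ≤ 720 * Real.exp 1 * (1 + y ^ 2)⁻¹ := by
    intro y
    have h := Real.pow_div_factorial_le_exp (1 + |y|) (by positivity) 6
    have h2 : ((Nat.factorial 6 : ℕ) : ℝ) = 720 := by norm_num [Nat.factorial]
    rw [h2, div_le_iff₀ (by norm_num), Real.exp_add] at h
    rw [← div_eq_mul_inv, le_div_iff₀ (by positivity)]
    have h3 : 1 + y ^ 2 ≤ (1 + |y|) ^ 2 := by rw [← sq_abs]; nlinarith [abs_nonneg y]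
    have h4 : Real.exp (-|y|) * Real.exp |y| = 1 := by rw [← Real.exp_add]; simp
    calc Real.exp (-|y|) * (1 + |y|) ^ 4 * (1 + y ^ 2) ≤ Real.exp (-|y|) * (1 + |y|) ^ 4 * (1 + |y|) ^ 2 := by gcongr
      _ = Real.exp (-|y|) * (1 + |y|) ^ 6 := by ring
      _ ≤ Real.exp (-|y|) * (Real.exp 1 * Real.exp |y| * 720) := by gcongr
      _ = 720 * Real.exp 1 := by linear_combination (720 * Real.exp 1) * h4
  have hi : Integrable (fun y : ℝ => Real.exp (-|y|) * (1 + |y|) ^ 4) := by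
    apply (integrable_inv_one_add_sq.const_mul (720 * Real.exp 1)).mono'
    · exact (by fun_prop : Continuous (fun y : ℝ => Real.exp (-|y|) * (1 + |y|) ^ 4)).aestronglyMeasurable
    · refine Eventually.of_forall fun y => ?_
      rw [Real.norm_eq_abs, abs_of_nonneg (by positivity)]
      exact hb y
  refine ⟨_ + 1, ?_, hi, (le_add_of_nonneg_right zero_le_one)⟩
  have : 0 ≤ ∫ y : ℝ, Real.exp (-|y|) * (1 + |y|) ^ 4 := integral_nonneg fun y => by positivity
  linarith

end


section

open MeasureTheory Set Filter
open scoped ENNReal NNReal Topology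

noncomputable def k0 (s z : ℝ) : ℝ := z / (z ^ 2 + s ^ 2)
noncomputable def k1 (s z : ℝ) : ℝ := (s ^ 2 - z ^ 2) / (z ^ 2 + s ^ 2) ^ 2
noncomputable def k2 (s z : ℝ) : ℝ := (2 * z ^ 3 - 6 * z * s ^ 2) / (z ^ 2 + s ^ 2) ^ 3
noncomputable def Kd (a z : ℝ) : ℝ := k0 a z - k0 1 z
noncomputable def Kd1 (a z : ℝ) : ℝ := k1 a z - k1 1 z
noncomputable def Kd2 (a z : ℝ) : ℝ := k2 a z - k2 1 z

theorem k0_deriv {s : ℝ} (hs : 0 < s) (z : ℝ) : HasDerivAt (k0 s) (k1 s z) z := by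
  have h : z ^ 2 + s ^ 2 ≠ 0 := by positivity
  have := (hasDerivAt_id z).div (((hasDerivAt_pow 2 z)).add_const (s ^ 2)) h
  refine this.congr_deriv ?_
  unfold k1
  simp only [id]
  congr 1
  push_cast
  ring

theorem k1_deriv {s : ℝ} (hs : 0 < s) (z : ℝ) : HasDerivAt (k1 s) (k2 s z) z := by
  have h : (z ^ 2 + s ^ 2) ^ 2 ≠ 0 := by positivity
  have h' : (z ^ 2 + s ^ 2) ≠ 0 := by positivity
  have := (((hasDerivAt_pow 2 z)).const_sub (s ^ 2)).div ((((hasDerivAt_pow 2 z)).add_const (s ^ 2)).pow 2) h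
  refine this.congr_deriv ?_
  unfold k2
  field_simp
  simp
  ring

theorem Kd_deriv {a : ℝ} (ha : 0 < a) (z : ℝ) : HasDerivAt (Kd a) (Kd1 a z) z :=
  (k0_deriv ha z).sub (k0_deriv one_pos z)
theorem Kd1_deriv {a : ℝ} (ha : 0 < a) (z : ℝ) : HasDerivAt (Kd1 a) (Kd2 a z) z :=
  (k1_deriv ha z).sub (k1_deriv one_pos z)

theorem k2_cont {s : ℝ} (hs : 0 < s) : Continuous (k2 s) := by
  unfold k2
  apply Continuous.div (by fun_prop) (by fun_prop)
  intro z; positivity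

theorem Kd_cont {a : ℝ} (ha : 0 < a) : Continuous (Kd a) :=
  continuous_iff_continuousAt.mpr fun z => (Kd_deriv ha z).continuousAt
theorem Kd1_cont {a : ℝ} (ha : 0 < a) : Continuous (Kd1 a) :=
  continuous_iff_continuousAt.mpr fun z => (Kd1_deriv ha z).continuousAt
theorem Kd2_cont {a : ℝ} (ha : 0 < a) : Continuous (Kd2 a) := (k2_cont ha).sub (k2_cont one_pos)

theorem Kd_odd (a z : ℝ) : Kd a (-z) = - Kd a z := by unfold Kd k0; simp; ring
theorem Kd1_even (a z : ℝ) : Kd1 a (-z) = Kd1 a z := by unfold Kd1 k1; simp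
theorem Kd2_odd (a z : ℝ) : Kd2 a (-z) = - Kd2 a z := by unfold Kd2 k2; simp; ring

theorem Kd_eq {a : ℝ} (ha : 0 < a) (z : ℝ) : Kd a z = (1 - a ^ 2) * z / ((z ^ 2 + a ^ 2) * (z ^ 2 + 1)) := by
  unfold Kd k0
  have h' : (z ^ 2 + a ^ 2) ≠ 0 := by positivity
  field_simp
  ring

theorem k1_abs {s : ℝ} (hs : 0 < s) (z : ℝ) : |k1 s z| ≤ 1 / (z ^ 2 + s ^ 2) := by
  unfold k1
  rw [abs_div, abs_of_pos (by positivity : 0 < (z ^ 2 + s ^ 2) ^ 2), div_le_div_iff₀ (by positivity) (by positivity)]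
  have : |s ^ 2 - z ^ 2| ≤ z ^ 2 + s ^ 2 := by rw [abs_le]; constructor <;> nlinarith [sq_nonneg z, sq_nonneg s]
  have h2 : 0 < z ^ 2 + s ^ 2 := by positivity
  nlinarith

theorem k2_abs {s : ℝ} (hs : 0 < s) (z : ℝ) : |k2 s z| ≤ 6 * |z| / (z ^ 2 + s ^ 2) ^ 2 := by
  unfold k2
  have h2 : 0 < z ^ 2 + s ^ 2 := by positivity
  rw [abs_div, abs_of_pos (by positivity : 0 < (z ^ 2 + s ^ 2) ^ 3), div_le_div_iff₀ (by positivity) (by positivity)]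
  have : |2 * z ^ 3 - 6 * z * s ^ 2| ≤ 6 * |z| * (z ^ 2 + s ^ 2) := by
    have e : 2 * z ^ 3 - 6 * z * s ^ 2 = z * (2 * z ^ 2 - 6 * s ^ 2) := by ring
    rw [e, abs_mul, mul_comm 6 |z|, mul_assoc]
    apply mul_le_mul_of_nonneg_left _ (abs_nonneg z)
    rw [abs_le]; constructor <;> nlinarith [sq_nonneg z, sq_nonneg s]
  calc _ ≤ (6 * |z| * (z ^ 2 + s ^ 2)) * (z ^ 2 + s ^ 2) ^ 2 := by gcongr
    _ = _ := by ring

theorem inv_cmp {a s : ℝ} (ha : 0 < a) (has : a ≤ s) (ha1 : a ≤ 1) (z : ℝ) : 1 / (z ^ 2 + s ^ 2) ≤ (1 / a ^ 2) * (1 + z ^ 2)⁻¹ := by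
  rw [← one_div, div_mul_div_comm, one_mul]
  apply one_div_le_one_div_of_le (by positivity)
  have : a ^ 2 ≤ s ^ 2 := by gcongr
  have h2 : a ^ 2 ≤ 1 := by nlinarith
  nlinarith [sq_nonneg z, mul_nonneg (sq_nonneg z) (sub_nonneg.mpr h2)]

theorem Kd_bd {a : ℝ} (ha : 0 < a) (ha1 : a ≤ 1) (z : ℝ) : |Kd a z| ≤ (6 / a ^ 3) * (1 + z ^ 2)⁻¹ := by
  rw [Kd_eq ha, abs_div, abs_mul, abs_of_nonneg (by nlinarith : 0 ≤ 1 - a ^ 2),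
    abs_of_pos (by positivity : 0 < (z ^ 2 + a ^ 2) * (z ^ 2 + 1)), ← div_eq_mul_inv, div_div, div_le_div_iff₀ (by positivity) (by positivity)]
  have h1 : 2 * |z| * a ≤ z ^ 2 + a ^ 2 := by rw [← sq_abs z]; nlinarith [sq_nonneg (|z| - a)]
  have h2 : (1 - a ^ 2) * |z| * a ^ 3 ≤ 6 * (z ^ 2 + a ^ 2) := by
    have : (1 - a ^ 2) * |z| * a ^ 3 ≤ 1 * |z| * a := by
      have h3 : a ^ 3 ≤ a := by
        have := pow_le_one₀ ha.le ha1 (n := 2)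
        nlinarith
      gcongr
      nlinarith
    nlinarith [sq_nonneg z, sq_nonneg a]
  have h4 : 0 < 1 + z ^ 2 := by positivity
  nlinarith

theorem Kd1_bd {a : ℝ} (ha : 0 < a) (ha1 : a ≤ 1) (z : ℝ) : |Kd1 a z| ≤ (6 / a ^ 3) * (1 + z ^ 2)⁻¹ := by
  have h1 := (k1_abs ha z).trans (inv_cmp ha le_rfl ha1 z)
  have h2 := (k1_abs one_pos z).trans (inv_cmp ha ha1 ha1 z)
  have h3 : |Kd1 a z| ≤ |k1 a z| + |k1 1 z| := abs_sub _ _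
  have h4 : 2 * (1 / a ^ 2) ≤ 6 / a ^ 3 := by
    rw [mul_one_div, div_le_div_iff₀ (by positivity) (by positivity)]
    have := pow_pos ha 2
    nlinarith
  have h5 : 0 ≤ (1 + z ^ 2)⁻¹ := by positivity
  nlinarith

theorem k2_bd {a s : ℝ} (ha : 0 < a) (has : a ≤ s) (ha1 : a ≤ 1) (z : ℝ) : |k2 s z| ≤ (3 / a ^ 3) * (1 + z ^ 2)⁻¹ := by
  have hs : 0 < s := ha.trans_le has
  have h1 := k2_abs hs z
  have h2 := inv_cmp ha has ha1 z
  have h3 : 6 * |z| / (z ^ 2 + s ^ 2) ^ 2 ≤ (3 / a) * (1 / (z ^ 2 + s ^ 2)) := by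
    rw [div_mul_div_comm, div_le_div_iff₀ (by positivity) (by positivity)]
    have h1 : 2 * |z| * a ≤ z ^ 2 + s ^ 2 := by rw [← sq_abs z]; nlinarith [sq_nonneg (|z| - a), pow_le_pow_left₀ ha.le has 2]
    have h0 : 0 < z ^ 2 + s ^ 2 := by positivity
    nlinarith [mul_le_mul_of_nonneg_right h1 h0.le]
  have h4 : (3 / a) * ((1 / a ^ 2) * (1 + z ^ 2)⁻¹) = (3 / a ^ 3) * (1 + z ^ 2)⁻¹ := by field_simp
  rw [← h4]
  exact h1.trans (h3.trans (mul_le_mul_of_nonneg_left h2 (by positivity)))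

theorem Kd2_bd {a : ℝ} (ha : 0 < a) (ha1 : a ≤ 1) (z : ℝ) : |Kd2 a z| ≤ (6 / a ^ 3) * (1 + z ^ 2)⁻¹ := by
  have h1 := k2_bd ha le_rfl ha1 z
  have h2 := k2_bd ha ha1 ha1 z
  have h3 : |Kd2 a z| ≤ |k2 a z| + |k2 1 z| := abs_sub _ _
  have h4 : 6 / a ^ 3 * (1 + z ^ 2)⁻¹ = 3 / a ^ 3 * (1 + z ^ 2)⁻¹ + 3 / a ^ 3 * (1 + z ^ 2)⁻¹ := by ring
  linarith

theorem Kd1_sq {a : ℝ} (ha : 0 < a) (z : ℝ) : |Kd1 a z| ≤ 2 / z ^ 2 ∨ z = 0 := by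
  by_cases hz : z = 0
  · right; exact hz
  left
  have hz2 : 0 < z ^ 2 := by positivity
  have h : ∀ s : ℝ, 0 < s → |k1 s z| ≤ 1 / z ^ 2 := fun s hs => (k1_abs hs z).trans
    (one_div_le_one_div_of_le hz2 (by nlinarith [sq_nonneg s]))
  have h3 : |Kd1 a z| ≤ |k1 a z| + |k1 1 z| := abs_sub _ _
  have e : 2 / z ^ 2 = 1 / z ^ 2 + 1 / z ^ 2 := by ring
  linarith [h a ha, h 1 one_pos]

theorem Kd2_sq {a : ℝ} (ha : 0 < a) (z : ℝ) : |z| * |Kd2 a z| ≤ 12 / z ^ 2 ∨ z = 0 := by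
  by_cases hz : z = 0
  · right; exact hz
  left
  have hz2 : 0 < z ^ 2 := by positivity
  have h : ∀ s : ℝ, 0 < s → |z| * |k2 s z| ≤ 6 / z ^ 2 := fun s hs => by
    have := mul_le_mul_of_nonneg_left (k2_abs hs z) (abs_nonneg z)
    refine this.trans ?_
    rw [mul_div_assoc', div_le_div_iff₀ (by positivity) (by positivity)]
    have e : |z| * (6 * |z|) * z ^ 2 = 6 * (z ^ 2) ^ 2 := by
      have := sq_abs z
      calc |z| * (6 * |z|) * z ^ 2 = 6 * |z| ^ 2 * z ^ 2 := by ring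
        _ = _ := by rw [this]; ring
    rw [e]
    gcongr
    nlinarith [sq_nonneg s]
  have h3 : |Kd2 a z| ≤ |k2 a z| + |k2 1 z| := abs_sub _ _
  have e : 12 / z ^ 2 = 6 / z ^ 2 + 6 / z ^ 2 := by ring
  have := mul_le_mul_of_nonneg_left h3 (abs_nonneg z)
  linarith [h a ha, h 1 one_pos]

theorem Kd_mul {a : ℝ} (ha : 0 < a) (ha1 : a ≤ 1) (z : ℝ) : |z| * |Kd a z| ≤ (1 + z ^ 2)⁻¹ := by
  rw [Kd_eq ha, abs_div, abs_mul, abs_of_nonneg (by nlinarith : 0 ≤ 1 - a ^ 2),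
    abs_of_pos (by positivity : 0 < (z ^ 2 + a ^ 2) * (z ^ 2 + 1)), ← one_div, mul_div_assoc', div_le_div_iff₀ (by positivity) (by positivity)]
  have e : |z| * ((1 - a ^ 2) * |z|) = (1 - a ^ 2) * z ^ 2 := by rw [← sq_abs z]; ring
  rw [e]
  have : (1 - a ^ 2) * z ^ 2 ≤ z ^ 2 + a ^ 2 := by nlinarith [mul_nonneg (sq_nonneg a) (sq_nonneg z), sq_nonneg a]
  have h : 0 < 1 + z ^ 2 := by positivity
  nlinarith

theorem Kd_nonneg {a : ℝ} (ha : 0 < a) (ha1 : a ≤ 1) {z : ℝ} (hz : 0 ≤ z) : 0 ≤ Kd a z := by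
  rw [Kd_eq ha]
  have : 0 ≤ 1 - a ^ 2 := by nlinarith
  positivity

theorem Kd_abs {a : ℝ} (ha : 0 < a) (ha1 : a ≤ 1) (z : ℝ) : |Kd a z| = Kd a |z| := by
  rcases le_total 0 z with h | h
  · rw [abs_of_nonneg h, abs_of_nonneg (Kd_nonneg ha ha1 h)]
  · rw [abs_of_nonpos h, Kd_odd, abs_of_nonpos]
    have := Kd_nonneg ha ha1 (neg_nonneg.mpr h)
    rw [Kd_odd] at this
    linarith

theorem Kd_integrable {a : ℝ} (ha : 0 < a) (ha1 : a ≤ 1) : Integrable (Kd a) :=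
  (integrable_inv_one_add_sq.const_mul (6 / a ^ 3)).mono' (Kd_cont ha).aestronglyMeasurable
    (Eventually.of_forall fun z => Kd_bd ha ha1 z)
theorem Kd1_integrable {a : ℝ} (ha : 0 < a) (ha1 : a ≤ 1) : Integrable (Kd1 a) :=
  (integrable_inv_one_add_sq.const_mul (6 / a ^ 3)).mono' (Kd1_cont ha).aestronglyMeasurable
    (Eventually.of_forall fun z => Kd1_bd ha ha1 z)
theorem Kd2_integrable {a : ℝ} (ha : 0 < a) (ha1 : a ≤ 1) : Integrable (Kd2 a) :=
  (integrable_inv_one_add_sq.const_mul (6 / a ^ 3)).mono' (Kd2_cont ha).aestronglyMeasurable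
    (Eventually.of_forall fun z => Kd2_bd ha ha1 z)

theorem Kd_L1 {a : ℝ} (ha : 0 < a) (ha1 : a ≤ 1) : ∫ z, |Kd a z| = 2 * Real.log (1 / a) := by
  have e1 : ∫ z, |Kd a z| = ∫ z, Kd a |z| := by congr 1; ext z; exact Kd_abs ha ha1 z
  rw [e1, integral_comp_abs]
  congr 1
  have hd : ∀ z ∈ Ici (0:ℝ), HasDerivAt (fun z => (1/2) * (Real.log ((z ^ 2 + a ^ 2) / (z ^ 2 + 1)))) (Kd a z) z := by
    intro z _
    have h1 : z ^ 2 + a ^ 2 ≠ 0 := by positivity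
    have h2 : z ^ 2 + 1 ≠ 0 := by positivity
    have := (((((hasDerivAt_pow 2 z)).add_const (a ^ 2)).div (((hasDerivAt_pow 2 z)).add_const 1) h2).log (div_ne_zero h1 h2)).const_mul (1/2:ℝ)
    refine this.congr_deriv ?_
    simp only [Pi.div_apply]
    unfold Kd k0
    field_simp
    simp
  have ht : Tendsto (fun z : ℝ => (1/2) * (Real.log ((z ^ 2 + a ^ 2) / (z ^ 2 + 1)))) atTop (𝓝 0) := by
    have h1 : Tendsto (fun z : ℝ => (z ^ 2 + a ^ 2) / (z ^ 2 + 1)) atTop (𝓝 1) := by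
      have h2 : Tendsto (fun z : ℝ => 1 + (a ^ 2 - 1) / (z ^ 2 + 1)) atTop (𝓝 (1 + 0)) := by
        apply Tendsto.const_add
        apply Tendsto.div_atTop tendsto_const_nhds
        exact tendsto_atTop_add_const_right _ _ (tendsto_pow_atTop two_ne_zero)
      rw [add_zero] at h2
      refine h2.congr fun z => ?_
      have : z ^ 2 + 1 ≠ 0 := by positivity
      field_simp
      ring
    have h3 := (h1.log one_ne_zero).const_mul (1/2:ℝ)
    simpa using h3
  rw [integral_Ioi_of_hasDerivAt_of_tendsto' hd (Kd_integrable ha ha1).integrableOn ht]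
  simp

theorem integrable_a {a : ℝ} (ha : 0 < a) : Integrable (fun z : ℝ => a / (z ^ 2 + a ^ 2)) ∧
    ∫ z : ℝ, a / (z ^ 2 + a ^ 2) = Real.pi := by
  have e : (fun z : ℝ => a / (z ^ 2 + a ^ 2)) = fun z => a⁻¹ * (1 + (a⁻¹ * z) ^ 2)⁻¹ := by
    ext z; field_simp; ring
  rw [e]
  refine ⟨(integrable_inv_one_add_sq.comp_mul_left' (inv_pos.mpr ha).ne').const_mul _, ?_⟩
  rw [integral_scale (fun z => (1 + z ^ 2)⁻¹) (inv_pos.mpr ha), integral_univ_inv_one_add_sq]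

theorem Kd1_mul_L1 {a : ℝ} (ha : 0 < a) (ha1 : a ≤ 1) : Integrable (fun z => |z| * |Kd1 a z|) ∧
    ∫ z, |z| * |Kd1 a z| ≤ 2 * Real.log (1 / a) + 2 * Real.pi := by
  have hb : ∀ z, |z| * |Kd1 a z| ≤ |Kd a z| + a / (z ^ 2 + a ^ 2) + 1 / (z ^ 2 + 1 ^ 2) := by
    intro z
    have e : z * Kd1 a z = - Kd a z + 2 * a ^ 2 * z / (z ^ 2 + a ^ 2) ^ 2 - 2 * z / (z ^ 2 + 1) ^ 2 := by
      unfold Kd1 Kd k1 k0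
      have h1 : z ^ 2 + a ^ 2 ≠ 0 := by positivity
      have h2 : z ^ 2 + 1 ≠ 0 := by positivity
      field_simp
      ring
    have h : ∀ s : ℝ, 0 < s → |2 * s ^ 2 * z / (z ^ 2 + s ^ 2) ^ 2| ≤ s / (z ^ 2 + s ^ 2) := by
      intro s hs
      rw [abs_div, abs_of_pos (by positivity : 0 < (z ^ 2 + s ^ 2) ^ 2), div_le_div_iff₀ (by positivity) (by positivity),
        abs_mul, abs_of_pos (by positivity : 0 < 2 * s ^ 2)]
      have h1 : 2 * |z| * s ≤ z ^ 2 + s ^ 2 := by rw [← sq_abs z]; nlinarith [sq_nonneg (|z| - s)]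
      have h0 : 0 < z ^ 2 + s ^ 2 := by positivity
      nlinarith [mul_le_mul_of_nonneg_right h1 (by positivity : 0 ≤ s * (z ^ 2 + s ^ 2))]
    have h1 := h 1 one_pos
    rw [one_pow, mul_one] at h1
    rw [← abs_mul, e]
    refine (abs_sub _ _).trans ?_
    rw [one_pow]
    refine add_le_add ((abs_add_le _ _).trans ?_) h1
    rw [abs_neg]
    exact add_le_add le_rfl (h a ha)
  obtain ⟨i1, e1⟩ := integrable_a ha
  obtain ⟨i2, e2⟩ := integrable_a one_pos
  have hi : Integrable (fun z => |Kd a z| + a / (z ^ 2 + a ^ 2) + 1 / (z ^ 2 + 1 ^ 2)) := ((Kd_integrable ha ha1).abs.add i1).add i2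
  have hI : Integrable (fun z => |z| * |Kd1 a z|) := hi.mono' (continuous_abs.mul (Kd1_cont ha).abs).aestronglyMeasurable
    (Eventually.of_forall fun z => by rw [Real.norm_eq_abs, abs_of_nonneg (by positivity)]; exact hb z)
  refine ⟨hI, ?_⟩
  refine (integral_mono hI hi hb).trans ?_
  rw [integral_add (f := fun z => |Kd a z| + a / (z ^ 2 + a ^ 2)) ((Kd_integrable ha ha1).abs.add i1) i2, integral_add (Kd_integrable ha ha1).abs i1, e1, e2, Kd_L1 ha ha1]
  linarith

theorem odd_integral {f : ℝ → ℝ} (h : ∀ z, f (-z) = - f z) : ∫ z, f z = 0 := by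
  have := integral_neg_eq_self f volume
  simp only [h, integral_neg] at this
  linarith

theorem Kd1_int {a : ℝ} (ha : 0 < a) (ha1 : a ≤ 1) : ∫ z, Kd1 a z = 0 :=
  integral_eq_zero_of_hasDerivAt_of_integrable (fun z => Kd_deriv ha z) (Kd1_integrable ha ha1) (Kd_integrable ha ha1)

end


section

open MeasureTheory Set Filter
open scoped ENNReal NNReal Topology

noncomputable def A0c (D : LPData) : ℝ := ∫ z, |KK D z|
noncomputable def A1c (D : LPData) : ℝ := ∫ y, |y| * |KK D y|
theorem A0c_nonneg (D : LPData) : 0 ≤ A0c D := integral_nonneg fun _ => abs_nonneg _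
theorem A1c_nonneg (D : LPData) : 0 ≤ A1c D := integral_nonneg fun _ => by positivity

theorem heaviside_meas : Measurable heaviside := by
  unfold heaviside
  exact Measurable.ite measurableSet_Ici measurable_const measurable_const

theorem heaviside_bd (x : ℝ) : |heaviside x| ≤ 1 := by
  unfold heaviside; split_ifs <;> simp

theorem H_eq (D : LPData) (N : ℕ) (x : ℝ) : SNsum D N heaviside x = ∫ y in Iic x, 2 ^ N * KK D (2 ^ N * y) := by
  have h1 : SNsum D N heaviside x = SS D (2 ^ N) heaviside x := by
    unfold SNsum
    rw [← blk_sum]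
    exact Finset.sum_congr rfl fun j _ => LPblock_blk D j heaviside_meas heaviside_bd x
  rw [h1]
  unfold SS
  rw [← integral_indicator measurableSet_Iic]
  congr 1
  ext y
  unfold heaviside indicator
  by_cases h : y ≤ x
  · simp [h]
  · simp [h]

theorem H_deriv (D : LPData) (N : ℕ) (x : ℝ) : HasDerivAt (SNsum D N heaviside) (2 ^ N * KK D (2 ^ N * x)) x := by
  have hK := KK_continuous D
  have hc : Continuous (fun z => (2:ℝ) ^ N * KK D (2 ^ N * z)) := by fun_prop
  have hi := KK_scale_integrable D (s := 2 ^ N) (by positivity)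
  have e : SNsum D N heaviside = fun x => (∫ z in Iic 0, 2 ^ N * KK D (2 ^ N * z)) + ∫ z in (0:ℝ)..x, 2 ^ N * KK D (2 ^ N * z) := by
    ext y
    rw [← intervalIntegral.integral_Iic_sub_Iic hi.integrableOn hi.integrableOn, H_eq]; ring
  rw [e]
  exact (intervalIntegral.integral_hasDerivAt_right (hc.intervalIntegrable _ _) (hc.stronglyMeasurableAtFilter _ _) hc.continuousAt).const_add _

theorem H_cont (D : LPData) (N : ℕ) : Continuous (SNsum D N heaviside) :=
  continuous_iff_continuousAt.mpr fun z => (H_deriv D N z).continuousAt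

theorem KKs_L1 (D : LPData) (N : ℕ) : ∫ z, |2 ^ N * KK D (2 ^ N * z)| = A0c D := by
  have := integral_scale (fun z => |KK D z|) (s := 2 ^ N) (by positivity)
  unfold A0c
  rw [← this]
  congr 1; ext z; rw [abs_mul, abs_of_pos (by positivity)]

theorem H_bd (D : LPData) (N : ℕ) (x : ℝ) : |SNsum D N heaviside x| ≤ A0c D := by
  rw [H_eq, ← KKs_L1 D N]
  refine (abs_integral_le_integral_abs).trans ?_
  exact setIntegral_le_integral (KK_scale_integrable D (by positivity)).abs (Eventually.of_forall fun _ => abs_nonneg _)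

theorem H_sub (D : LPData) (N : ℕ) (x : ℝ) : 1 - SNsum D N heaviside x = ∫ y in Ioi x, 2 ^ N * KK D (2 ^ N * y) := by
  have hi := KK_scale_integrable D (s := 2 ^ N) (by positivity)
  have := intervalIntegral.integral_Iic_add_Ioi (b := x) hi.integrableOn hi.integrableOn
  rw [integral_scale _ (by positivity), KK_integral] at this
  rw [H_eq]; linarith

theorem H_symm (D : LPData) (N : ℕ) (x : ℝ) : SNsum D N heaviside (-x) = 1 - SNsum D N heaviside x := by
  rw [H_sub, H_eq]
  have := integral_comp_neg_Ioi x (fun y => 2 ^ N * KK D (2 ^ N * y))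
  rw [← this]
  congr 1; ext y
  rw [mul_neg, KK_even]

theorem H_tail (D : LPData) (N : ℕ) {x : ℝ} (hx : 0 < x) : |1 - SNsum D N heaviside x| ≤ A1c D * ((2 ^ N)⁻¹ / x) := by
  rw [H_sub]
  have hs : (0:ℝ) < 2 ^ N := by positivity
  have hi0 : Integrable (fun y => 2 ^ N * (|2 ^ N * y| * |KK D (2 ^ N * y)|)) :=
    ((KK_abs_mul_integrable D).comp_mul_left' hs.ne').const_mul _
  have hi : Integrable (fun y => 2 ^ N * (|2 ^ N * y| * |KK D (2 ^ N * y)|) * ((2 ^ N)⁻¹ / x)) := hi0.mul_const _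
  have h1 : ‖∫ y in Ioi x, 2 ^ N * KK D (2 ^ N * y)‖ ≤ ∫ y in Ioi x, 2 ^ N * (|2 ^ N * y| * |KK D (2 ^ N * y)|) * ((2 ^ N)⁻¹ / x) := by
    apply norm_integral_le_of_norm_le hi.integrableOn
    refine (ae_restrict_iff' measurableSet_Ioi).mpr (Eventually.of_forall fun y hy => ?_)
    have hy' : x < y := hy
    have hy0 : 0 < y := hx.trans hy'
    rw [Real.norm_eq_abs, abs_mul, abs_of_pos hs, abs_mul, abs_of_pos hs, abs_of_pos hy0]
    have : 1 ≤ y / x := by rw [le_div_iff₀ hx]; linarith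
    calc 2 ^ N * |KK D (2 ^ N * y)| ≤ (2 ^ N * |KK D (2 ^ N * y)|) * (y / x) := le_mul_of_one_le_right (by positivity) this
      _ = _ := by field_simp
  refine h1.trans ((setIntegral_le_integral hi (Eventually.of_forall fun y => ?_)).trans (le_of_eq ?_))
  · show 0 ≤ _; positivity
  · rw [integral_mul_const, integral_scale (fun y => |y| * |KK D y|) hs]; rfl

/-- profile of the datum -/
noncomputable def fdat (D : LPData) (N : ℕ) (ε : ℝ) (y : ℝ) : ℝ :=
  Real.cos ((2:ℝ) ^ (N + 5) * y) * (1 + ε * SNsum D N heaviside y)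

noncomputable def fdat' (D : LPData) (N : ℕ) (ε : ℝ) (y : ℝ) : ℝ :=
  -Real.sin ((2:ℝ) ^ (N + 5) * y) * 2 ^ (N + 5) * (1 + ε * SNsum D N heaviside y) +
    Real.cos ((2:ℝ) ^ (N + 5) * y) * (ε * (2 ^ N * KK D (2 ^ N * y)))

theorem fdat_deriv (D : LPData) (N : ℕ) (ε : ℝ) (y : ℝ) : HasDerivAt (fdat D N ε) (fdat' D N ε y) y := by
  have h1 : HasDerivAt (fun y : ℝ => (2:ℝ) ^ (N + 5) * y) (2 ^ (N + 5)) y := by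
    simpa using (hasDerivAt_id y).const_mul ((2:ℝ) ^ (N + 5))
  exact h1.cos.mul (((H_deriv D N y).const_mul ε).const_add 1)

theorem g_bd (D : LPData) (N : ℕ) {ε : ℝ} (h0 : 0 < ε) (h1 : ε ≤ 1) (y : ℝ) :
    |1 + ε * SNsum D N heaviside y| ≤ 1 + A0c D := by
  refine (abs_add_le _ _).trans ?_
  rw [abs_one, abs_mul, abs_of_pos h0]
  have := H_bd D N y
  have := abs_nonneg (SNsum D N heaviside y)
  nlinarith

theorem fdat_bd (D : LPData) (N : ℕ) {ε : ℝ} (h0 : 0 < ε) (h1 : ε ≤ 1) (y : ℝ) : |fdat D N ε y| ≤ 1 + A0c D := by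
  unfold fdat
  rw [abs_mul]
  have h2 := g_bd D N h0 h1 y
  have h3 := Real.abs_cos_le_one ((2:ℝ) ^ (N + 5) * y)
  have := A0c_nonneg D
  calc _ ≤ 1 * (1 + A0c D) := by gcongr
    _ = _ := one_mul _

theorem fdat_cont (D : LPData) (N : ℕ) (ε : ℝ) : Continuous (fdat D N ε) :=
  continuous_iff_continuousAt.mpr fun z => (fdat_deriv D N ε z).continuousAt

theorem KK_bd (D : LPData) : ∃ C : ℝ, 0 < C ∧ ∀ x, |KK D x| ≤ C := by
  obtain ⟨C, hC, h1, -⟩ := KK_decay D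
  refine ⟨C, hC, fun x => le_trans ?_ (h1 x)⟩
  apply le_mul_of_one_le_right (abs_nonneg _)
  exact one_le_pow₀ (by nlinarith [sq_nonneg x])

theorem fdat'_bd (D : LPData) (N : ℕ) {ε : ℝ} (h0 : 0 < ε) (h1 : ε ≤ 1) : ∃ C, ∀ y, |fdat' D N ε y| ≤ C := by
  obtain ⟨C, hC, hK⟩ := KK_bd D
  have hA := A0c_nonneg D
  refine ⟨1 * 2 ^ (N + 5) * (1 + A0c D) + 1 * (1 * (2 ^ N * C)), fun y => ?_⟩
  unfold fdat'
  refine (abs_add_le _ _).trans (add_le_add ?_ ?_)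
  · rw [abs_mul, abs_mul, abs_neg, abs_of_pos (by positivity : (0:ℝ) < 2 ^ (N + 5))]
    gcongr
    · exact Real.abs_sin_le_one _
    · exact g_bd D N h0 h1 y
  · rw [abs_mul, abs_mul, abs_mul, abs_of_pos (by positivity : (0:ℝ) < 2 ^ N), abs_of_pos h0]
    gcongr
    · exact Real.abs_cos_le_one _
    · exact hK _

theorem fdat'_cont (D : LPData) (N : ℕ) (ε : ℝ) : Continuous (fdat' D N ε) := by
  have := KK_continuous D
  have := H_cont D N
  unfold fdat'
  fun_prop

theorem u0_eq (D : LPData) (N : ℕ) {ε : ℝ} (hε : ε = (N:ℝ) ^ (-(1:ℝ)/10)) (h0 : 0 < ε) (h1 : ε ≤ 1) :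
    u0def D N = fun x => -ε * A1op (fdat D N ε) x := by
  ext x
  unfold u0def
  rw [← hε]
  have hd : deriv (fun y => Real.cos ((2:ℝ) ^ (N + 5) * y) * (1 + ε * SNsum D N heaviside y)) = fdat' D N ε := by
    ext y; exact (fdat_deriv D N ε y).deriv
  rw [hd]
  congr 1
  obtain ⟨C, hC⟩ := fdat'_bd D N h0 h1
  exact inv_of_deriv (fdat_deriv D N ε) (fdat'_cont D N ε) (M := max (1 + A0c D) C)
    (fun x => (fdat_bd D N h0 h1 x).trans (le_max_left _ _)) (fun x => (hC x).trans (le_max_right _ _)) x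

theorem u0_bd (D : LPData) (N : ℕ) {ε : ℝ} (hε : ε = (N:ℝ) ^ (-(1:ℝ)/10)) (h0 : 0 < ε) (h1 : ε ≤ 1) (x : ℝ) :
    |u0def D N x| ≤ ε * (1 + A0c D) := by
  rw [u0_eq D N hε h0 h1, abs_mul, abs_neg, abs_of_pos h0]
  apply mul_le_mul_of_nonneg_left _ h0.le
  exact (A1op_abs_le (fdat_cont D N ε) (fdat_bd D N h0 h1) x).trans (invOneSub_le (fdat_bd D N h0 h1) x)

theorem u0_deriv (D : LPData) (N : ℕ) {ε : ℝ} (hε : ε = (N:ℝ) ^ (-(1:ℝ)/10)) (h0 : 0 < ε) (h1 : ε ≤ 1) (x : ℝ) :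
    deriv (u0def D N) x = ε * (fdat D N ε x - invOneSub (fdat D N ε) x) := by
  rw [u0_eq D N hε h0 h1]
  have := (A1op_deriv (fdat_cont D N ε) (fdat_bd D N h0 h1) x).const_mul (-ε)
  rw [this.deriv]; ring

theorem Af_bd (D : LPData) (N : ℕ) {ε : ℝ} (h0 : 0 < ε) (h1 : ε ≤ 1) (x : ℝ) :
    |invOneSub (fdat D N ε) x| ≤ (1 + 2 * A0c D) / 2 ^ (N + 5) := by
  set l : ℝ := 2 ^ (N + 5) with hl
  have hl0 : 0 < l := by positivity
  have hA := A0c_nonneg D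
  have hKc := KK_continuous D
  have hHc := H_cont D N
  set B : ℝ → ℝ := fun y => Real.sin (l * y) / l with hB
  have hBb : ∀ y, |B y| ≤ 1 / l := by
    intro y
    simp only [hB]
    rw [abs_div, abs_of_pos hl0]
    gcongr
    exact Real.abs_sin_le_one _
  set F : ℝ → ℝ := fun y => B y * (1 + ε * SNsum D N heaviside y) with hF
  set E : ℝ → ℝ := fun y => B y * (ε * (2 ^ N * KK D (2 ^ N * y))) with hE
  have hFd : ∀ y, HasDerivAt F (fdat D N ε y + E y) y := by
    intro y
    have h1 : HasDerivAt (fun y : ℝ => l * y) l y := by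
      simpa using (hasDerivAt_id y).const_mul l
    have h2 : HasDerivAt B (Real.cos (l * y)) y := by
      have := h1.sin.div_const l
      refine this.congr_deriv ?_
      field_simp
    exact h2.mul (((H_deriv D N y).const_mul ε).const_add 1)
  have hEc : Continuous E := by simp only [hE, hB]; fun_prop
  have hFb : ∀ y, |F y| ≤ (1 + A0c D) / l := by
    intro y
    simp only [hF]
    rw [abs_mul]
    calc _ ≤ 1 / l * (1 + A0c D) := mul_le_mul (hBb y) (g_bd D N h0 h1 y) (abs_nonneg _) (by positivity)
      _ = _ := by ring
  obtain ⟨C, hC, hK⟩ := KK_bd D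
  have hEb' : ∀ y, |E y| ≤ 1 / l * |2 ^ N * KK D (2 ^ N * y)| := by
    intro y
    simp only [hE]
    rw [abs_mul, abs_mul, abs_of_pos h0]
    apply mul_le_mul (hBb y) _ (by positivity) (by positivity)
    nlinarith [abs_nonneg (2 ^ N * KK D (2 ^ N * y))]
  have hEb : ∀ y, |E y| ≤ 1 / l * (2 ^ N * C) := by
    intro y
    refine (hEb' y).trans ?_
    rw [abs_mul, abs_of_pos (by positivity : (0:ℝ) < 2 ^ N)]
    gcongr
    exact hK _
  have hfb := fdat_bd D N h0 h1
  have hfc := fdat_cont D N ε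
  have e1 := inv_of_deriv (F := F) hFd (hfc.add hEc) (M := max ((1 + A0c D) / l) ((1 + A0c D) + 1 / l * (2 ^ N * C)))
    (fun y => (hFb y).trans (le_max_left _ _)) (fun y => ((abs_add_le _ _).trans (add_le_add (hfb y) (hEb y))).trans (le_max_right _ _)) x
  have e2 : invOneSub (fun y => fdat D N ε y + E y) x = invOneSub (fdat D N ε) x + invOneSub E x := by
    unfold invOneSub
    rw [← mul_add, ← integral_add (inv_integrable hfc hfb x) (inv_integrable hEc hEb x)]
    congr 2; ext y; ring
  have hFc : Continuous F := continuous_iff_continuousAt.mpr fun z => (hFd z).continuousAt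
  have b1 : |A1op F x| ≤ (1 + A0c D) / l := (A1op_abs_le hFc hFb x).trans (invOneSub_le hFb x)
  have b2 : |invOneSub E x| ≤ A0c D / l := by
    refine (invOneSub_abs_le x).trans ?_
    unfold invOneSub
    have hi : Integrable (fun y => 1 / l * |2 ^ N * KK D (2 ^ N * (x - y))|) :=
      ((KK_scale_integrable D (s := 2 ^ N) (by positivity)).abs.comp_sub_left x).const_mul _
    have : ∫ y : ℝ, Real.exp (-|y|) * |E (x - y)| ≤ ∫ y, 1 / l * |2 ^ N * KK D (2 ^ N * (x - y))| := by
      apply integral_mono_of_nonneg (Eventually.of_forall fun y => by positivity) hi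
      refine Eventually.of_forall fun y => ?_
      have h3 := hEb' (x - y)
      have h4 : Real.exp (-|y|) ≤ 1 := by simp
      show Real.exp (-|y|) * |E (x - y)| ≤ _
      nlinarith [abs_nonneg (E (x - y))]
    rw [integral_const_mul, integral_sub_left_eq_self (fun y => |2 ^ N * KK D (2 ^ N * y)|) volume x, KKs_L1] at this
    have h5 : 0 ≤ A0c D / l := by positivity
    have h6 : 1 / l * A0c D = A0c D / l := by ring
    rw [h6] at this
    linarith
  have e3 : invOneSub (fdat D N ε) x = A1op F x - invOneSub E x := by
    rw [← e1, e2]; ring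
  rw [e3]
  refine (abs_sub _ _).trans ((add_le_add b1 b2).trans (le_of_eq ?_))
  ring

theorem cos_lower {a l : ℝ} (ha : 0 < a) (ha1 : a ≤ 1/2) (hla : 1 ≤ l * a) :
    Real.log (1 / a) / 8 - 1 ≤ ∫ z in a..1, Real.cos (l * z) ^ 2 * (1 / (4 * z)) := by
  have hl : 0 < l := by
    by_contra h
    push Not at h
    nlinarith
  have hpos : ∀ z ∈ uIcc a 1, 0 < z := by
    intro z hz
    rw [uIcc_of_le (by linarith)] at hz
    exact ha.trans_le hz.1
  set Ψ : ℝ → ℝ := fun z => Real.log z / 8 + (Real.sin (2 * l * z) + 1) / (16 * l * z) with hΨ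
  have hd : ∀ z ∈ uIcc a 1, HasDerivAt Ψ (Real.cos (l * z) ^ 2 * (1 / (4 * z)) - (Real.sin (2 * l * z) + 1) / (16 * l * z ^ 2)) z := by
    intro z hz
    have hz := hpos z hz
    have h1 : HasDerivAt (fun y : ℝ => 2 * l * y) (2 * l) z := by
      simpa using (hasDerivAt_id z).const_mul (2 * l)
    have h2 : HasDerivAt (fun y : ℝ => 16 * l * y) (16 * l) z := by
      simpa using (hasDerivAt_id z).const_mul (16 * l)
    have := ((Real.hasDerivAt_log hz.ne').div_const 8).add ((h1.sin.add_const 1).div h2 (by positivity))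
    refine this.congr_deriv ?_
    have e : Real.cos (2 * l * z) = 2 * Real.cos (l * z) ^ 2 - 1 := by rw [← Real.cos_two_mul]; ring_nf
    rw [e]
    field_simp
    ring
  have hc1 : ContinuousOn (fun z => Real.cos (l * z) ^ 2 * (1 / (4 * z))) (uIcc a 1) := by
    apply ContinuousOn.mul (by fun_prop)
    apply ContinuousOn.div (by fun_prop) (by fun_prop)
    intro z hz; have := hpos z hz; positivity
  have hc2 : ContinuousOn (fun z => (Real.sin (2 * l * z) + 1) / (16 * l * z ^ 2)) (uIcc a 1) := by
    apply ContinuousOn.div (by fun_prop) (by fun_prop)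
    intro z hz; have := hpos z hz; positivity
  have h1 := intervalIntegral.integral_eq_sub_of_hasDerivAt hd (hc1.sub hc2).intervalIntegrable
  have h2 : ∫ z in a..1, (Real.cos (l * z) ^ 2 * (1 / (4 * z)) - (Real.sin (2 * l * z) + 1) / (16 * l * z ^ 2)) ≤
      ∫ z in a..1, Real.cos (l * z) ^ 2 * (1 / (4 * z)) := by
    apply intervalIntegral.integral_mono_on (by linarith) (hc1.sub hc2).intervalIntegrable hc1.intervalIntegrable
    intro z hz
    have hz0 : 0 < z := ha.trans_le hz.1
    have : 0 ≤ (Real.sin (2 * l * z) + 1) / (16 * l * z ^ 2) := by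
      have := Real.neg_one_le_sin (2 * l * z)
      apply div_nonneg (by linarith) (by positivity)
    simp only [Pi.sub_apply]
    linarith
  rw [h1] at h2
  refine le_trans ?_ h2
  simp only [hΨ, Real.log_one, one_div, Real.log_inv, mul_one]
  have h3 : 0 ≤ (Real.sin (2 * l) + 1) / (16 * l) := by
    have := Real.neg_one_le_sin (2 * l)
    apply div_nonneg (by linarith) (by positivity)
  have h4 : (Real.sin (2 * l * a) + 1) / (16 * l * a) ≤ 1 := by
    have := Real.sin_le_one (2 * l * a)
    rw [div_le_one (by positivity)]; linarith
  linarith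

set_option maxHeartbeats 2000000 in
theorem P0_lower (D : LPData) : ∃ C : ℝ, 0 < C ∧ ∀ N : ℕ, 1 ≤ N → ∀ ε : ℝ, 0 < ε → ε ≤ 1 →
    ε ^ 3 * N / 16 - C ≤ ∫ z, (ε * (fdat D N ε z - invOneSub (fdat D N ε) z)) ^ 2 * Kd (2 ^ N)⁻¹ z := by
  have hA0 := A0c_nonneg D
  have hA1 := A1c_nonneg D
  set F0 := 1 + A0c D with hF0
  set G0 := 1 + 2 * A0c D with hG0
  refine ⟨(2 * F0 * G0 + G0 ^ 2) * 2 + 6 * (2 + Real.pi * A1c D), by positivity, ?_⟩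
  intro N hN ε h0 h1
  set a : ℝ := (2 ^ N)⁻¹ with ha
  have ha0 : 0 < a := by positivity
  have ha2 : a ≤ 1 / 2 := by
    rw [ha, one_div]
    apply inv_anti₀ (by norm_num)
    calc (2:ℝ) = 2 ^ 1 := by norm_num
      _ ≤ 2 ^ N := pow_le_pow_right₀ (by norm_num) hN
  have ha1 : a ≤ 1 := by linarith
  have hlog : Real.log (1 / a) = N * Real.log 2 := by
    rw [ha, one_div, inv_inv, Real.log_pow]
  set f := fdat D N ε with hf
  set w := invOneSub f with hw
  set l : ℝ := 2 ^ (N + 5) with hl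
  have hl1 : (N:ℝ) ≤ l := by
    have h : N < 2 ^ (N + 5) := (Nat.lt_two_pow_self).trans_le (Nat.pow_le_pow_right (by norm_num) (by omega))
    rw [hl]; exact_mod_cast h.le
  have hN1 : (1:ℝ) ≤ N := by exact_mod_cast hN
  have hl2 : 1 ≤ l := by linarith
  have hfb : ∀ x, |f x| ≤ F0 := fdat_bd D N h0 h1
  have hfc : Continuous f := fdat_cont D N ε
  have hwc : Continuous w := continuous_iff_continuousAt.mpr fun z => (inv_deriv hfc hfb z).continuousAt
  have hwb : ∀ x, |w x| ≤ G0 / l := Af_bd D N h0 h1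
  have hG : 0 ≤ G0 / l := by positivity
  have hGl : G0 / l ≤ G0 := div_le_self (by positivity) hl2
  have hK := Kd_integrable ha0 ha1
  have hKL : ∫ z, |Kd a z| ≤ 2 * N := by
    rw [Kd_L1 ha0 ha1, hlog]
    have := Real.log_two_lt_d9
    nlinarith
  -- step 1 : compare with f²
  have i1 : Integrable (fun z => (ε * f z) ^ 2 * Kd a z) := by
    apply hK.bdd_mul (c := F0 ^ 2) (by fun_prop)
    refine Eventually.of_forall fun z => ?_
    rw [norm_pow, Real.norm_eq_abs, abs_mul, abs_of_pos h0]
    apply pow_le_pow_left₀ (by positivity)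
    nlinarith [hfb z, abs_nonneg (f z)]
  have hdiff : ∀ z, ‖(ε * (f z - w z)) ^ 2 - (ε * f z) ^ 2‖ ≤ (2 * F0 * G0 + G0 ^ 2) / l := by
    intro z
    have e : (ε * (f z - w z)) ^ 2 - (ε * f z) ^ 2 = ε ^ 2 * (w z * (w z - 2 * f z)) := by ring
    rw [e, Real.norm_eq_abs, abs_mul, abs_mul, abs_of_pos (by positivity : 0 < ε ^ 2)]
    have h3 : |w z - 2 * f z| ≤ G0 + 2 * F0 := by
      refine (abs_sub _ _).trans ?_
      rw [abs_mul, abs_two]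
      linarith [hwb z, hfb z]
    have h4 : ε ^ 2 ≤ 1 := pow_le_one₀ h0.le h1
    calc ε ^ 2 * (|w z| * |w z - 2 * f z|) ≤ 1 * ((G0 / l) * (G0 + 2 * F0)) := by
          gcongr
          exact hwb z
      _ = _ := by ring
  have i2 : Integrable (fun z => ((ε * (f z - w z)) ^ 2 - (ε * f z) ^ 2) * Kd a z) :=
    hK.bdd_mul (by fun_prop) (Eventually.of_forall hdiff)
  have s1 : |∫ z, ((ε * (f z - w z)) ^ 2 - (ε * f z) ^ 2) * Kd a z| ≤ (2 * F0 * G0 + G0 ^ 2) * 2 := by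
    have := norm_integral_le_of_norm_le (f := fun z => ((ε * (f z - w z)) ^ 2 - (ε * f z) ^ 2) * Kd a z)
      (hK.abs.const_mul ((2 * F0 * G0 + G0 ^ 2) / l))
      (Eventually.of_forall fun z => by
        rw [norm_mul]; exact mul_le_mul_of_nonneg_right (hdiff z) (norm_nonneg _))
    rw [integral_const_mul] at this
    refine this.trans ?_
    have h3 : (2 * F0 * G0 + G0 ^ 2) / l * ∫ z, |Kd a z| ≤ (2 * F0 * G0 + G0 ^ 2) / l * (2 * l) := by
      apply mul_le_mul_of_nonneg_left _ (by positivity)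
      linarith
    refine h3.trans (le_of_eq ?_)
    field_simp
  have e1 : ∫ z, (ε * (f z - w z)) ^ 2 * Kd a z = (∫ z, (ε * f z) ^ 2 * Kd a z) + ∫ z, ((ε * (f z - w z)) ^ 2 - (ε * f z) ^ 2) * Kd a z := by
    rw [← integral_add i1 i2]; congr 1; ext z; ring
  -- step 2 : symmetrize
  have hHc := H_cont D N
  set H := SNsum D N heaviside with hH
  have hHs : ∀ z, H (-z) = 1 - H z := H_symm D N
  have e2 : ∫ z, (ε * f z) ^ 2 * Kd a z = (ε ^ 3 * (2 + ε) / 2) * ∫ z, Real.cos (l * z) ^ 2 * ((2 * H z - 1) * Kd a z) := by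
    have h3 := integral_neg_eq_self (fun z => (ε * f z) ^ 2 * Kd a z) volume
    have h4 : Integrable (fun z => (ε * f (-z)) ^ 2 * Kd a (-z)) := i1.comp_neg
    have h5 : (∫ z, (ε * f z) ^ 2 * Kd a z) + (∫ z, (ε * f (-z)) ^ 2 * Kd a (-z)) = 2 * ∫ z, (ε * f z) ^ 2 * Kd a z := by
      rw [h3]; ring
    rw [← integral_add i1 h4] at h5
    have h6 : ∫ z, ((ε * f z) ^ 2 * Kd a z + (ε * f (-z)) ^ 2 * Kd a (-z)) = (ε ^ 3 * (2 + ε)) * ∫ z, Real.cos (l * z) ^ 2 * ((2 * H z - 1) * Kd a z) := by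
      rw [← integral_const_mul]
      congr 1
      ext z
      simp only [hf, fdat, Kd_odd, mul_neg, Real.cos_neg]
      rw [← hH, ← hl, hHs]
      ring
    rw [h6] at h5
    linarith
  -- step 3 : replace by |Kd|
  have hKb : ∀ z, abs ((2 * H z - 1) * Kd a z - |Kd a z|) ≤ 2 * A1c D * (a / (z ^ 2 + a ^ 2)) := by
    have hp : ∀ z, 0 < z → abs ((2 * H z - 1) * Kd a z - |Kd a z|) ≤ 2 * A1c D * (a / (z ^ 2 + a ^ 2)) := by
      intro z hz
      have hk := Kd_nonneg ha0 ha1 hz.le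
      rw [abs_of_nonneg hk]
      have e : (2 * H z - 1) * Kd a z - Kd a z = -(2 * ((1 - H z) * Kd a z)) := by ring
      rw [e, abs_neg, abs_mul, abs_mul, abs_two, abs_of_nonneg hk, mul_assoc]
      apply mul_le_mul_of_nonneg_left _ (by norm_num)
      have h3 := H_tail D N hz
      have h4 : Kd a z ≤ z / (z ^ 2 + a ^ 2) := by
        unfold Kd k0
        have : 0 ≤ z / (z ^ 2 + 1 ^ 2) := by positivity
        linarith
      calc |1 - H z| * Kd a z ≤ (A1c D * (a / z)) * (z / (z ^ 2 + a ^ 2)) := by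
            apply mul_le_mul h3 h4 hk (by positivity)
        _ = _ := by field_simp
    intro z
    rcases lt_trichotomy z 0 with h | h | h
    · have h3 := hp (-z) (by linarith)
      rw [hHs, Kd_odd, abs_neg, neg_sq] at h3
      refine le_trans (le_of_eq ?_) h3
      congr 1; ring
    · subst h
      have : Kd a 0 = 0 := by unfold Kd k0; simp
      rw [this]; simp; positivity
    · exact hp z h
  have hHb : ∀ z, ‖2 * H z - 1‖ ≤ 2 * A0c D + 1 := by
    intro z
    refine (abs_sub _ _).trans ?_
    rw [abs_mul, abs_two, abs_one]
    linarith [H_bd D N z]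
  have i3 : Integrable (fun z => (2 * H z - 1) * Kd a z) := hK.bdd_mul (by fun_prop) (Eventually.of_forall hHb)
  have hcosb : ∀ z, ‖Real.cos (l * z) ^ 2‖ ≤ 1 := by
    intro z
    rw [norm_pow]; exact pow_le_one₀ (norm_nonneg _) (Real.abs_cos_le_one _)
  have i4 : Integrable (fun z => Real.cos (l * z) ^ 2 * ((2 * H z - 1) * Kd a z)) :=
    i3.bdd_mul (by fun_prop) (Eventually.of_forall hcosb)
  have i5 : Integrable (fun z => Real.cos (l * z) ^ 2 * |Kd a z|) :=
    hK.abs.bdd_mul (by fun_prop) (Eventually.of_forall hcosb)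
  obtain ⟨ia, ea⟩ := integrable_a ha0
  have s3 : (∫ z, Real.cos (l * z) ^ 2 * |Kd a z|) - 2 * A1c D * Real.pi ≤ ∫ z, Real.cos (l * z) ^ 2 * ((2 * H z - 1) * Kd a z) := by
    have : ∫ z, (Real.cos (l * z) ^ 2 * |Kd a z| - 2 * A1c D * (a / (z ^ 2 + a ^ 2))) ≤ ∫ z, Real.cos (l * z) ^ 2 * ((2 * H z - 1) * Kd a z) := by
      apply integral_mono (i5.sub (ia.const_mul _)) i4
      intro z
      have h3 := (abs_le.mp (hKb z)).1
      have h4 := (abs_le.mp (hcosb z)).2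
      have h5 := sq_nonneg (Real.cos (l * z))
      have h6 : 0 ≤ 2 * A1c D * (a / (z ^ 2 + a ^ 2)) := by positivity
      show Real.cos (l * z) ^ 2 * |Kd a z| - 2 * A1c D * (a / (z ^ 2 + a ^ 2)) ≤ Real.cos (l * z) ^ 2 * ((2 * H z - 1) * Kd a z)
      nlinarith
    rw [integral_sub i5 (ia.const_mul _), integral_const_mul, ea] at this
    exact this
  -- step 4 : lower bound
  have s4 : N * Real.log 2 / 8 - 1 ≤ ∫ z, Real.cos (l * z) ^ 2 * |Kd a z| := by
    have e4 : ∫ z, Real.cos (l * z) ^ 2 * |Kd a z| = ∫ z, (fun y => Real.cos (l * y) ^ 2 * Kd a y) |z| := by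
      congr 1; ext z
      simp only
      rw [Kd_abs ha0 ha1]
      congr 2
      rcases abs_choice z with h | h
      · rw [h]
      · rw [h, mul_neg, Real.cos_neg]
    rw [e4, integral_comp_abs (f := fun y => Real.cos (l * y) ^ 2 * Kd a y)]
    have hla : 1 ≤ l * a := by
      rw [hl, ha, pow_add]
      field_simp
      norm_num
    have h3 := cos_lower ha0 ha2 hla
    rw [hlog] at h3
    refine h3.trans ?_
    have hcc : ContinuousOn (fun z => Real.cos (l * z) ^ 2 * (1 / (4 * z))) (Icc a 1) := by
      apply ContinuousOn.mul (by fun_prop)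
      apply ContinuousOn.div (by fun_prop) (by fun_prop)
      intro z hz; have := ha0.trans_le hz.1; positivity
    have hci : IntegrableOn (fun z => Real.cos (l * z) ^ 2 * (1 / (4 * z))) (Ioc a 1) :=
      (hcc.integrableOn_Icc).mono_set Ioc_subset_Icc_self
    rw [intervalIntegral.integral_of_le ha1]
    have hic : IntegrableOn (fun z => Real.cos (l * z) ^ 2 * Kd a z) (Ioi 0) :=
      (hK.bdd_mul (by fun_prop) (Eventually.of_forall hcosb)).integrableOn
    have hsub : Ioc a 1 ⊆ Ioi 0 := fun z hz => ha0.trans hz.1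
    calc ∫ z in Ioc a 1, Real.cos (l * z) ^ 2 * (1 / (4 * z)) ≤ ∫ z in Ioc a 1, 2 * (Real.cos (l * z) ^ 2 * Kd a z) := by
          apply setIntegral_mono_on hci ((hic.mono_set hsub).const_mul 2) measurableSet_Ioc
          intro z hz
          have hz0 : 0 < z := hsub hz
          have hk : 1 / (4 * z) ≤ 2 * Kd a z := by
            unfold Kd k0
            have e : z / (z ^ 2 + a ^ 2) - z / (z ^ 2 + 1 ^ 2) = z * (1 - a ^ 2) / ((z ^ 2 + a ^ 2) * (z ^ 2 + 1)) := by
              field_simp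
              ring
            rw [e, ← mul_div_assoc, div_le_div_iff₀ (by positivity) (by positivity)]
            have h1 : a ^ 2 ≤ z ^ 2 := pow_le_pow_left₀ ha0.le hz.1.le 2
            have h2 : z ^ 2 ≤ 1 := pow_le_one₀ hz0.le hz.2
            have h3 : a ^ 2 ≤ 1 / 4 := by nlinarith
            have h5 : (z ^ 2 + a ^ 2) * (z ^ 2 + 1) ≤ (2 * z ^ 2) * 2 := by
              apply mul_le_mul <;> nlinarith
            nlinarith [sq_nonneg z]
          have := mul_le_mul_of_nonneg_left hk (sq_nonneg (Real.cos (l * z)))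
          linarith
      _ = 2 * ∫ z in Ioc a 1, (Real.cos (l * z) ^ 2 * Kd a z) := integral_const_mul _ _
      _ ≤ _ := by
          apply mul_le_mul_of_nonneg_left _ (by norm_num)
          apply setIntegral_mono_set hic
          · refine (ae_restrict_iff' measurableSet_Ioi).mpr (Eventually.of_forall fun z hz => ?_)
            exact mul_nonneg (sq_nonneg _) (Kd_nonneg ha0 ha1 (le_of_lt hz))
          · exact hsub.eventuallyLE
  rw [e1, e2]
  have h7 := (abs_le.mp s1).1
  have h8 : N * Real.log 2 / 8 - 1 - 2 * A1c D * Real.pi ≤ ∫ z, Real.cos (l * z) ^ 2 * ((2 * H z - 1) * Kd a z) := by linarith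
  set J := ∫ z, Real.cos (l * z) ^ 2 * ((2 * H z - 1) * Kd a z)
  have h9 := mul_le_mul_of_nonneg_left h8 (by positivity : 0 ≤ ε ^ 3 * (2 + ε) / 2)
  have hl2 := Real.log_two_gt_d9
  have h10 : ε ^ 3 * N / 16 ≤ (ε ^ 3 * (2 + ε) / 2) * (N * Real.log 2 / 8) := by
    have : (N:ℝ) / 16 ≤ N * Real.log 2 / 8 := by nlinarith
    calc ε ^ 3 * N / 16 = (ε ^ 3 * 2 / 2) * (N / 16) := by ring
      _ ≤ _ := by gcongr; linarith
  have h11 : (ε ^ 3 * (2 + ε) / 2) * (1 + 2 * A1c D * Real.pi) ≤ 6 * (2 + Real.pi * A1c D) := by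
    have h12 : ε ^ 3 ≤ 1 := pow_le_one₀ h0.le h1
    have h13 : ε ^ 3 * (2 + ε) / 2 ≤ 3 / 2 := by nlinarith [pow_pos h0 3]
    have h14 : 0 ≤ A1c D * Real.pi := by positivity
    calc (ε ^ 3 * (2 + ε) / 2) * (1 + 2 * A1c D * Real.pi) ≤ 3 / 2 * (1 + 2 * A1c D * Real.pi) := by gcongr
      _ ≤ _ := by nlinarith
  nlinarith

end


section

open MeasureTheory Set Filter
open scoped ENNReal NNReal Topology

theorem shift_bd {b B : ℝ} (hb : |b| ≤ B) (z : ℝ) : (1 + (z - b) ^ 2)⁻¹ ≤ 2 * (1 + B ^ 2) * (1 + z ^ 2)⁻¹ := by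
  have hb2 : b ^ 2 ≤ B ^ 2 := by
    rw [← sq_abs b]; exact pow_le_pow_left₀ (abs_nonneg _) hb 2
  rw [inv_eq_one_div, ← div_eq_mul_inv, div_le_div_iff₀ (by positivity) (by positivity)]
  have h1 : z ^ 2 ≤ 2 * (z - b) ^ 2 + 2 * b ^ 2 := by nlinarith [sq_nonneg (z - b - b)]
  nlinarith [mul_nonneg (sq_nonneg B) (sq_nonneg (z - b)), sq_nonneg (z - b)]

theorem bi {f κ : ℝ → ℝ} {M : ℝ} (hf : Continuous f) (hM : ∀ z, |f z| ≤ M) (hκ : Integrable κ) (b : ℝ) :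
    Integrable (fun z => f z * κ (z - b)) :=
  (hκ.comp_sub_right b).bdd_mul hf.aestronglyMeasurable (Eventually.of_forall hM)

theorem DI {T M A B : ℝ} {f f' : ℝ → ℝ → ℝ} {κ κ' q q' : ℝ → ℝ}
    (hf : ∀ t ∈ Icc 0 T, ∀ z, |f t z| ≤ M) (hf' : ∀ t ∈ Icc 0 T, ∀ z, |f' t z| ≤ M)
    (hfd : ∀ t ∈ Icc 0 T, ∀ z, HasDerivAt (fun s => f s z) (f' t z) t)
    (hfc : ∀ t ∈ Icc 0 T, Continuous (f t)) (hfc' : ∀ t ∈ Icc 0 T, Continuous (f' t))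
    (hκ : ∀ z, HasDerivAt κ (κ' z) z) (hκc : Continuous κ')
    (hκb : ∀ z, |κ z| ≤ A * (1 + z ^ 2)⁻¹) (hκb' : ∀ z, |κ' z| ≤ A * (1 + z ^ 2)⁻¹)
    (hq : ContinuousOn q (Icc 0 T)) (hqd : ∀ t ∈ Ioo 0 T, HasDerivAt q (q' t) t)
    (hqb : ∀ t ∈ Icc 0 T, |q t| ≤ B) (hqb' : ∀ t ∈ Icc 0 T, |q' t| ≤ B) :
    ContinuousOn (fun t => ∫ z, f t z * κ (z - q t)) (Icc 0 T) ∧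
    ∀ t ∈ Ioo 0 T, HasDerivAt (fun t => ∫ z, f t z * κ (z - q t))
      (∫ z, (f' t z * κ (z - q t) - f t z * κ' (z - q t) * q' t)) t := by
  have hκcont : Continuous κ := continuous_iff_continuousAt.mpr fun z => (hκ z).continuousAt
  have hA : 0 ≤ A := by
    have := (abs_nonneg _).trans (hκb 0)
    simpa using this
  have kb : ∀ t ∈ Icc 0 T, ∀ z, |κ (z - q t)| ≤ A * (2 * (1 + B ^ 2) * (1 + z ^ 2)⁻¹) := by
    intro t ht z
    refine (hκb _).trans ?_
    exact mul_le_mul_of_nonneg_left (shift_bd (hqb t ht) z) hA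
  have kb' : ∀ t ∈ Icc 0 T, ∀ z, |κ' (z - q t)| ≤ A * (2 * (1 + B ^ 2) * (1 + z ^ 2)⁻¹) := by
    intro t ht z
    refine (hκb' _).trans ?_
    exact mul_le_mul_of_nonneg_left (shift_bd (hqb t ht) z) hA
  have hInt0 : Integrable (fun z : ℝ => A * (2 * (1 + B ^ 2) * (1 + z ^ 2)⁻¹)) :=
    (integrable_inv_one_add_sq.const_mul _).const_mul _
  have b1 : ∀ t ∈ Icc 0 T, ∀ z, ‖f t z * κ (z - q t)‖ ≤ M * (A * (2 * (1 + B ^ 2) * (1 + z ^ 2)⁻¹)) := by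
    intro t ht z
    rw [norm_mul]
    exact mul_le_mul (hf t ht z) (kb t ht z) (norm_nonneg _) ((abs_nonneg _).trans (hf t ht z))
  have m1 : ∀ t ∈ Icc 0 T, AEStronglyMeasurable (fun z => f t z * κ (z - q t)) := by
    intro t ht
    have := hfc t ht
    exact (by fun_prop : Continuous (fun z => f t z * κ (z - q t))).aestronglyMeasurable
  constructor
  · apply continuousOn_of_dominated m1 (fun t ht => Eventually.of_forall (b1 t ht)) (hInt0.const_mul M)
    refine Eventually.of_forall fun z => ?_
    apply ContinuousOn.mul
    · intro t ht
      exact (hfd t ht z).continuousAt.continuousWithinAt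
    · exact hκcont.comp_continuousOn (continuousOn_const.sub hq)
  · intro t ht
    have hs : Ioo 0 T ∈ 𝓝 t := isOpen_Ioo.mem_nhds ht
    have htI : t ∈ Icc 0 T := Ioo_subset_Icc_self ht
    refine (hasDerivAt_integral_of_dominated_loc_of_deriv_le (s := Ioo 0 T) (F := fun t z => f t z * κ (z - q t))
      (F' := fun t z => (f' t z * κ (z - q t) - f t z * κ' (z - q t) * q' t))
      (bound := fun z => (M + M * B) * (A * (2 * (1 + B ^ 2) * (1 + z ^ 2)⁻¹))) hs ?_ ?_ ?_ ?_ ?_ ?_).2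
    · filter_upwards [hs] with s hs
      exact m1 s (Ioo_subset_Icc_self hs)
    · exact (hInt0.const_mul M).mono' (m1 t htI) (Eventually.of_forall (b1 t htI))
    · have h1 := hfc t htI
      have h2 := hfc' t htI
      exact (by fun_prop : Continuous (fun z => (f' t z * κ (z - q t) - f t z * κ' (z - q t) * q' t))).aestronglyMeasurable
    · refine Eventually.of_forall fun z s hs => ?_
      have hs := Ioo_subset_Icc_self hs
      refine (norm_sub_le _ _).trans ?_
      rw [norm_mul, norm_mul, norm_mul]
      have hM : 0 ≤ M := (abs_nonneg _).trans (hf s hs z)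
      have h1 : ‖f' s z‖ * ‖κ (z - q s)‖ ≤ M * (A * (2 * (1 + B ^ 2) * (1 + z ^ 2)⁻¹)) :=
        mul_le_mul (hf' s hs z) (kb s hs z) (norm_nonneg _) hM
      have h2 : ‖f s z‖ * ‖κ' (z - q s)‖ * ‖q' s‖ ≤ M * (A * (2 * (1 + B ^ 2) * (1 + z ^ 2)⁻¹)) * B :=
        mul_le_mul (mul_le_mul (hf s hs z) (kb' s hs z) (norm_nonneg _) hM) (hqb' s hs) (norm_nonneg _) (by positivity)
      linarith
    · exact hInt0.const_mul _
    · refine Eventually.of_forall fun z s hs => ?_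
      have h1 := hfd s (Ioo_subset_Icc_self hs) z
      have h2 : HasDerivAt (fun s => κ (z - q s)) (κ' (z - q s) * (-q' s)) s :=
        (hκ (z - q s)).comp s ((hqd s hs).const_sub z)
      refine (h1.mul h2).congr_deriv ?_
      ring

structure Core (T L R B J : ℝ) (u ux G G' Q : ℝ → ℝ → ℝ) (q : ℝ → ℝ) : Prop where
  hT : 0 < T
  hL : 0 ≤ L
  hR : 0 ≤ R
  hJ : 0 ≤ J
  ub : ∀ t ∈ Icc 0 T, ∀ x, |u t x| ≤ 2
  ud : ∀ t ∈ Icc 0 T, ∀ x, HasDerivAt (u t) (ux t x) x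
  uxc : ∀ t ∈ Icc 0 T, Continuous (ux t)
  uxb : ∀ t ∈ Icc 0 T, ∀ x, |ux t x| ≤ L
  Gd : ∀ t ∈ Icc 0 T, ∀ x, HasDerivAt (G t) (G' t x) x
  Gc' : ∀ t ∈ Icc 0 T, Continuous (G' t)
  Gb : ∀ t ∈ Icc 0 T, ∀ x, |G t x| ≤ R
  Gb' : ∀ t ∈ Icc 0 T, ∀ x, |G' t x| ≤ R
  split : ∀ t ∈ Icc 0 T, ∀ x, G' t x = ux t x ^ 2 / 2 + Q t x
  Ql : ∀ t ∈ Icc 0 T, ∀ x y, |Q t x - Q t y| ≤ R * |x - y|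
  ut : ∀ t ∈ Icc 0 T, ∀ x, HasDerivAt (fun s => u s x) (- u t x * ux t x + G t x) t
  qc : ContinuousOn q (Icc 0 T)
  qd : ∀ t ∈ Ioo 0 T, HasDerivAt q (u t (q t)) t
  qb : ∀ t ∈ Icc 0 T, |q t| ≤ B
  D2 : ∀ t ∈ Icc 0 T, ∀ y, ∫⁻ z, ENNReal.ofReal (|u t (y + z) + u t (y - z) - 2 * u t y| / z ^ 2) ≤ ENNReal.ofReal J

variable {T L R B J : ℝ} {u ux G G' Q : ℝ → ℝ → ℝ} {q : ℝ → ℝ}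

theorem Core.uc (h : Core T L R B J u ux G G' Q q) {t : ℝ} (ht : t ∈ Icc 0 T) : Continuous (u t) :=
  continuous_iff_continuousAt.mpr fun z => (h.ud t ht z).continuousAt

theorem Core.Gc (h : Core T L R B J u ux G G' Q q) {t : ℝ} (ht : t ∈ Icc 0 T) : Continuous (G t) :=
  continuous_iff_continuousAt.mpr fun z => (h.Gd t ht z).continuousAt

theorem Core.Qc (h : Core T L R B J u ux G G' Q q) {t : ℝ} (ht : t ∈ Icc 0 T) : Continuous (Q t) := by
  have h1 : Q t = fun x => G' t x - ux t x ^ 2 / 2 := by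
    ext x; rw [h.split t ht]; ring
  have := h.Gc' t ht
  have := h.uxc t ht
  rw [h1]; fun_prop

theorem lip_of_deriv {f f' : ℝ → ℝ} {L : ℝ} (hd : ∀ x, HasDerivAt f (f' x) x) (hb : ∀ x, |f' x| ≤ L) (x y : ℝ) :
    |f x - f y| ≤ L * |x - y| :=
  Convex.norm_image_sub_le_of_norm_hasDerivWithin_le (s := univ) (fun z _ => (hd z).hasDerivWithinAt) (fun z _ => hb z)
    convex_univ (mem_univ y) (mem_univ x)

theorem Core.ul (h : Core T L R B J u ux G G' Q q) {t : ℝ} (ht : t ∈ Icc 0 T) (x y : ℝ) :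
    |u t x - u t y| ≤ L * |x - y| := lip_of_deriv (h.ud t ht) (h.uxb t ht) x y

theorem Core.Gl (h : Core T L R B J u ux G G' Q q) {t : ℝ} (ht : t ∈ Icc 0 T) (x y : ℝ) :
    |G t x - G t y| ≤ R * |x - y| := lip_of_deriv (h.Gd t ht) (h.Gb' t ht) x y

/-- I bound -/
theorem Core.I_bd (h : Core T L R B J u ux G G' Q q) {a : ℝ} (ha : 0 < a) (ha1 : a ≤ 1) {t : ℝ} (ht : t ∈ Icc 0 T) :
    |∫ z, u t z * Kd1 a (z - q t)| ≤ J := by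
  have hc := h.uc ht
  set b := q t
  have e1 : ∫ z, u t z * Kd1 a (z - b) = ∫ z, u t (b + z) * Kd1 a z := by
    rw [← integral_add_right_eq_self (fun z => u t z * Kd1 a (z - b)) b]
    congr 1; ext z; rw [add_sub_cancel_right, add_comm]
  have e2 : ∫ z, u t (b + z) * Kd1 a z = ∫ z, u t (b - z) * Kd1 a z := by
    rw [← integral_neg_eq_self (fun z => u t (b + z) * Kd1 a z) volume]
    congr 1; ext z; rw [Kd1_even, ← sub_eq_add_neg]
  have hK := Kd1_integrable ha ha1
  have i1 : Integrable (fun z => u t (b + z) * Kd1 a z) :=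
    hK.bdd_mul (c := 2) (by fun_prop) (Eventually.of_forall fun z => h.ub t ht _)
  have i2 : Integrable (fun z => u t (b - z) * Kd1 a z) :=
    hK.bdd_mul (c := 2) (by fun_prop) (Eventually.of_forall fun z => h.ub t ht _)
  have i3 : Integrable (fun z => (2 * u t b) * Kd1 a z) := hK.const_mul _
  have e3 : ∫ z, (u t (b + z) + u t (b - z) - 2 * u t b) * Kd1 a z = 2 * ∫ z, u t z * Kd1 a (z - b) := by
    have : (fun z => (u t (b + z) + u t (b - z) - 2 * u t b) * Kd1 a z) =
      fun z => (u t (b + z) * Kd1 a z + u t (b - z) * Kd1 a z) - (2 * u t b) * Kd1 a z := by ext z; ring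
    rw [this, integral_sub (f := fun z => u t (b + z) * Kd1 a z + u t (b - z) * Kd1 a z) (i1.add i2) i3, integral_add i1 i2, integral_const_mul, Kd1_int ha ha1, ← e2, e1]
    ring
  have s := norm_integral_le_lintegral_norm (μ := volume) (fun z => (u t (b + z) + u t (b - z) - 2 * u t b) * Kd1 a z)
  rw [e3] at s
  have hle : ∫⁻ z, ENNReal.ofReal ‖(u t (b + z) + u t (b - z) - 2 * u t b) * Kd1 a z‖ ≤ ENNReal.ofReal (2 * J) := by
    calc _ ≤ ∫⁻ z, ENNReal.ofReal 2 * ENNReal.ofReal (|u t (b + z) + u t (b - z) - 2 * u t b| / z ^ 2) := by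
          apply lintegral_mono
          intro z
          beta_reduce
          rw [← ENNReal.ofReal_mul (by norm_num)]
          apply ENNReal.ofReal_le_ofReal
          rw [norm_mul, Real.norm_eq_abs, Real.norm_eq_abs]
          rcases Kd1_sq ha z with h1 | h1
          · calc _ ≤ |u t (b + z) + u t (b - z) - 2 * u t b| * (2 / z ^ 2) := by gcongr
              _ = _ := by ring
          · subst h1; simp [← two_mul]
      _ = ENNReal.ofReal 2 * ∫⁻ z, ENNReal.ofReal (|u t (b + z) + u t (b - z) - 2 * u t b| / z ^ 2) :=
          lintegral_const_mul' _ _ ENNReal.ofReal_ne_top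
      _ ≤ ENNReal.ofReal 2 * ENNReal.ofReal J := by gcongr; exact h.D2 t ht b
      _ = _ := by rw [← ENNReal.ofReal_mul (by norm_num)]
  have s2 := ENNReal.toReal_mono ENNReal.ofReal_ne_top hle
  rw [ENNReal.toReal_ofReal (by have := h.hJ; positivity)] at s2
  rw [norm_mul, Real.norm_eq_abs, Real.norm_eq_abs, abs_two] at s
  linarith

end


section

open MeasureTheory Set Filter
open scoped ENNReal NNReal Topology

variable {T L R B J : ℝ} {u ux G G' Q : ℝ → ℝ → ℝ} {q : ℝ → ℝ}

theorem lin3 {f g k : ℝ → ℝ} (hf : Integrable f) (hg : Integrable g) (hk : Integrable k) (c d e : ℝ) :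
    ∫ z, (c * f z + d * g z + e * k z) = c * (∫ z, f z) + d * (∫ z, g z) + e * ∫ z, k z := by
  have h1 : Integrable (fun z => c * f z + d * g z) := (hf.const_mul c).add (hg.const_mul d)
  rw [integral_add h1 (hk.const_mul e), integral_add (hf.const_mul c) (hg.const_mul d), integral_const_mul,
    integral_const_mul, integral_const_mul]

theorem Kd_shift_deriv {a : ℝ} (ha : 0 < a) (b z : ℝ) : HasDerivAt (fun y => Kd a (y - b)) (Kd1 a (z - b)) z := by
  have := (Kd_deriv ha (z - b)).comp_sub_const z b
  exact this

theorem Kd1_shift_deriv {a : ℝ} (ha : 0 < a) (b z : ℝ) : HasDerivAt (fun y => Kd1 a (y - b)) (Kd2 a (z - b)) z := by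
  have := (Kd1_deriv ha (z - b)).comp_sub_const z b
  exact this

theorem Core.I_ident (h : Core T L R B J u ux G G' Q q) {a : ℝ} (ha : 0 < a) (ha1 : a ≤ 1) {t : ℝ} (ht : t ∈ Icc 0 T) :
    -∫ z, ((- u t z * ux t z + G t z) * Kd1 a (z - q t) - u t z * Kd2 a (z - q t) * u t (q t)) =
    -(1 / 2) * (∫ z, (u t z - u t (q t)) ^ 2 * Kd2 a (z - q t)) + ∫ z, G' t z * Kd a (z - q t) := by
  have hc := h.uc ht
  have hxc := h.uxc t ht
  have hGc := h.Gc ht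
  have hGc' := h.Gc' t ht
  have hK := Kd_integrable ha ha1
  have hK1 := Kd1_integrable ha ha1
  have hK2 := Kd2_integrable ha ha1
  have hub := h.ub t ht
  have hxb := h.uxb t ht
  have hL := h.hL
  set b := q t
  have iG : Integrable (fun z => G' t z * Kd a (z - b)) := bi hGc' (h.Gb' t ht) hK b
  have iG1 : Integrable (fun z => G t z * Kd1 a (z - b)) := bi hGc (h.Gb t ht) hK1 b
  have iG0 : Integrable (fun z => G t z * Kd a (z - b)) := bi hGc (h.Gb t ht) hK b
  have u2b : ∀ z, |u t z ^ 2| ≤ 4 := by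
    intro z; rw [abs_pow]; nlinarith [hub z, abs_nonneg (u t z)]
  have iu2 : Integrable (fun z => u t z ^ 2 * Kd2 a (z - b)) := bi (by fun_prop) u2b hK2 b
  have iu1 : Integrable (fun z => u t z ^ 2 * Kd1 a (z - b)) := bi (by fun_prop) u2b hK1 b
  have iux : Integrable (fun z => (u t z * ux t z) * Kd1 a (z - b)) := by
    apply bi (M := 2 * L) (by fun_prop) _ hK1
    intro z; rw [abs_mul]; exact mul_le_mul (hub z) (hxb z) (abs_nonneg _) (by norm_num)
  have iu : Integrable (fun z => u t z * Kd2 a (z - b)) := bi hc hub hK2 b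
  have i2 : Integrable (fun z => Kd2 a (z - b)) := hK2.comp_sub_right b
  have t1 : ∫ z, ((u t z * ux t z) * Kd1 a (z - b) + (1 / 2) * (u t z ^ 2 * Kd2 a (z - b))) = 0 := by
    apply integral_eq_zero_of_hasDerivAt_of_integrable (f := fun z => (1 / 2) * (u t z ^ 2 * Kd1 a (z - b)))
    · intro z
      refine ((((h.ud t ht z).pow 2).mul (Kd1_shift_deriv ha b z)).const_mul (1 / 2)).congr_deriv ?_
      simp only [Pi.pow_apply]
      push_cast; ring
    · exact iux.add (iu2.const_mul _)
    · exact iu1.const_mul _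
  have t2 : ∫ z, (G' t z * Kd a (z - b) + G t z * Kd1 a (z - b)) = 0 := by
    apply integral_eq_zero_of_hasDerivAt_of_integrable (f := fun z => (G t z * Kd a (z - b)))
    · intro z
      exact (h.Gd t ht z).mul (Kd_shift_deriv ha b z)
    · exact iG.add iG1
    · exact iG0
  have t3 : ∫ z, Kd2 a (z - b) = 0 :=
    integral_eq_zero_of_hasDerivAt_of_integrable (f := fun z => (Kd1 a (z - b))) (fun z => Kd1_shift_deriv ha b z)
      i2 (hK1.comp_sub_right b)
  rw [integral_add iux (iu2.const_mul _), integral_const_mul] at t1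
  rw [integral_add iG iG1] at t2
  have e1 : ∫ z, ((- u t z * ux t z + G t z) * Kd1 a (z - b) - u t z * Kd2 a (z - b) * u t b) =
      (-(∫ z, (u t z * ux t z) * Kd1 a (z - b)) + ∫ z, G t z * Kd1 a (z - b)) - u t b * ∫ z, u t z * Kd2 a (z - b) := by
    refine Eq.trans ?_ ((lin3 iux iG1 iu (-1) 1 (-u t b)).trans (by ring))
    congr 1; ext z; ring
  have e2 : ∫ z, (u t z - u t b) ^ 2 * Kd2 a (z - b) =
      ((∫ z, u t z ^ 2 * Kd2 a (z - b)) - (2 * u t b) * ∫ z, u t z * Kd2 a (z - b)) + (u t b) ^ 2 * ∫ z, Kd2 a (z - b) := by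
    refine Eq.trans ?_ ((lin3 iu2 iu i2 1 (-(2 * u t b)) (u t b ^ 2)).trans (by ring))
    congr 1; ext z; ring
  rw [e1, e2, t3]
  linarith

theorem Core.sq_bd (h : Core T L R B J u ux G G' Q q) {a : ℝ} (ha : 0 < a) (ha1 : a ≤ 1) {t : ℝ} (ht : t ∈ Icc 0 T) :
    |∫ z, (u t z - u t (q t)) ^ 2 * Kd2 a (z - q t)| ≤ 12 * L * J := by
  have hc := h.uc ht
  have hL := h.hL
  have hJ := h.hJ
  set b := q t
  have e1 : ∫ z, (u t z - u t b) ^ 2 * Kd2 a (z - b) = ∫ z, (u t (b + z) - u t b) ^ 2 * Kd2 a z := by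
    rw [← integral_add_right_eq_self (fun z => (u t z - u t b) ^ 2 * Kd2 a (z - b)) b]
    congr 1; ext z; rw [add_sub_cancel_right, add_comm]
  have e2 : ∫ z, (u t (b + z) - u t b) ^ 2 * Kd2 a z = -∫ z, (u t (b - z) - u t b) ^ 2 * Kd2 a z := by
    rw [← integral_neg_eq_self (fun z => (u t (b + z) - u t b) ^ 2 * Kd2 a z) volume, ← integral_neg]
    congr 1; ext z; rw [Kd2_odd, ← sub_eq_add_neg]; ring
  have hK := Kd2_integrable ha ha1
  have db : ∀ x, ‖(u t x - u t b) ^ 2‖ ≤ 16 := by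
    intro x
    have h1 := abs_sub (u t x) (u t b)
    have h2 := h.ub t ht x
    have h3 := h.ub t ht b
    rw [norm_pow, Real.norm_eq_abs]
    nlinarith [abs_nonneg (u t x - u t b)]
  have i1 : Integrable (fun z => (u t (b + z) - u t b) ^ 2 * Kd2 a z) :=
    hK.bdd_mul (by fun_prop) (Eventually.of_forall fun z => db _)
  have i2 : Integrable (fun z => (u t (b - z) - u t b) ^ 2 * Kd2 a z) :=
    hK.bdd_mul (by fun_prop) (Eventually.of_forall fun z => db _)
  have e3 : ∫ z, ((u t (b + z) - u t b) ^ 2 - (u t (b - z) - u t b) ^ 2) * Kd2 a z = 2 * ∫ z, (u t z - u t b) ^ 2 * Kd2 a (z - b) := by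
    simp_rw [sub_mul]
    rw [integral_sub i1 i2, e1, e2]
    ring
  have s := norm_integral_le_lintegral_norm (μ := volume) (fun z => ((u t (b + z) - u t b) ^ 2 - (u t (b - z) - u t b) ^ 2) * Kd2 a z)
  rw [e3] at s
  have hle : ∫⁻ z, ENNReal.ofReal ‖((u t (b + z) - u t b) ^ 2 - (u t (b - z) - u t b) ^ 2) * Kd2 a z‖ ≤ ENNReal.ofReal (24 * L * J) := by
    calc _ ≤ ∫⁻ z, ENNReal.ofReal (24 * L) * ENNReal.ofReal (|u t (b + z) + u t (b - z) - 2 * u t b| / z ^ 2) := by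
          apply lintegral_mono
          intro z
          beta_reduce
          rw [← ENNReal.ofReal_mul (by positivity)]
          apply ENNReal.ofReal_le_ofReal
          rw [norm_mul, Real.norm_eq_abs, Real.norm_eq_abs]
          have e : (u t (b + z) - u t b) ^ 2 - (u t (b - z) - u t b) ^ 2 = (u t (b + z) + u t (b - z) - 2 * u t b) * (u t (b + z) - u t (b - z)) := by ring
          rw [e, abs_mul]
          have h2 : |u t (b + z) - u t (b - z)| ≤ 2 * L * |z| := by
            refine (h.ul ht _ _).trans (le_of_eq ?_)
            have : b + z - (b - z) = 2 * z := by ring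
            rw [this, abs_mul, abs_two]; ring
          rcases Kd2_sq ha z with h1 | h1
          · calc _ ≤ |u t (b + z) + u t (b - z) - 2 * u t b| * (2 * L * |z|) * |Kd2 a z| := by gcongr
              _ = |u t (b + z) + u t (b - z) - 2 * u t b| * (2 * L) * (|z| * |Kd2 a z|) := by ring
              _ ≤ |u t (b + z) + u t (b - z) - 2 * u t b| * (2 * L) * (12 / z ^ 2) := by gcongr
              _ = _ := by ring
          · subst h1; simp
      _ = ENNReal.ofReal (24 * L) * ∫⁻ z, ENNReal.ofReal (|u t (b + z) + u t (b - z) - 2 * u t b| / z ^ 2) :=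
          lintegral_const_mul' _ _ ENNReal.ofReal_ne_top
      _ ≤ ENNReal.ofReal (24 * L) * ENNReal.ofReal J := by gcongr; exact h.D2 t ht b
      _ = _ := by rw [← ENNReal.ofReal_mul (by positivity)]
  have s2 := ENNReal.toReal_mono ENNReal.ofReal_ne_top hle
  rw [ENNReal.toReal_ofReal (by positivity)] at s2
  rw [norm_mul, Real.norm_eq_abs, Real.norm_eq_abs, abs_two] at s
  linarith

theorem Core.G_lower (h : Core T L R B J u ux G G' Q q) {a : ℝ} (ha : 0 < a) (ha1 : a ≤ 1) {t : ℝ} (ht : t ∈ Icc 0 T) :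
    (1 / 2) * (∫ z, ux t z ^ 2 * Kd a (z - q t)) - R * Real.pi ≤ ∫ z, G' t z * Kd a (z - q t) := by
  have hxc := h.uxc t ht
  have hQc := h.Qc ht
  have hL := h.hL
  set b := q t
  have hK := Kd_integrable ha ha1
  have i1 : Integrable (fun z => ux t z ^ 2 * Kd a (z - b)) := by
    apply bi (M := L ^ 2) (by fun_prop) _ hK
    intro z; rw [abs_pow]; exact pow_le_pow_left₀ (abs_nonneg _) (h.uxb t ht z) 2
  have ig : Integrable (fun z => G' t z * Kd a (z - b)) := bi (h.Gc' t ht) (h.Gb' t ht) hK b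
  have iQ : Integrable (fun z => Q t z * Kd a (z - b)) := by
    have : (fun z => Q t z * Kd a (z - b)) = fun z => G' t z * Kd a (z - b) - (1 / 2) * (ux t z ^ 2 * Kd a (z - b)) := by
      ext z; rw [h.split t ht z]; ring
    rw [this]; exact ig.sub (i1.const_mul _)
  have e1 : ∫ z, G' t z * Kd a (z - b) = (1 / 2) * (∫ z, ux t z ^ 2 * Kd a (z - b)) + ∫ z, Q t z * Kd a (z - b) := by
    rw [← integral_const_mul, ← integral_add (i1.const_mul _) iQ]
    congr 1; ext z; rw [h.split t ht z]; ring
  have e0 : ∫ z, Kd a (z - b) = 0 := by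
    rw [integral_sub_right_eq_self (fun z => Kd a z) b]
    exact odd_integral (Kd_odd a)
  have e2 : ∫ z, Q t z * Kd a (z - b) = ∫ z, (Q t z - Q t b) * Kd a (z - b) := by
    simp_rw [sub_mul]
    rw [integral_sub iQ ((hK.comp_sub_right b).const_mul _), integral_const_mul, e0]; ring
  have s : ‖∫ z, (Q t z - Q t b) * Kd a (z - b)‖ ≤ ∫ z : ℝ, R * (1 + (z - b) ^ 2)⁻¹ := by
    apply norm_integral_le_of_norm_le ((integrable_inv_one_add_sq.comp_sub_right b).const_mul R)
    refine Eventually.of_forall fun z => ?_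
    rw [norm_mul, Real.norm_eq_abs, Real.norm_eq_abs]
    calc _ ≤ (R * |z - b|) * |Kd a (z - b)| := by gcongr; exact h.Ql t ht z b
      _ = R * (|z - b| * |Kd a (z - b)|) := by ring
      _ ≤ _ := mul_le_mul_of_nonneg_left (Kd_mul ha ha1 _) h.hR
  rw [integral_const_mul, integral_sub_right_eq_self (fun z : ℝ => (1 + z ^ 2)⁻¹) b, integral_univ_inv_one_add_sq] at s
  rw [e1, e2]
  have := (abs_le.mp s).1
  linarith

/-- derivative and lower bound of I -/
theorem Core.I_deriv (h : Core T L R B J u ux G G' Q q) {a : ℝ} (ha : 0 < a) (ha1 : a ≤ 1) :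
    ContinuousOn (fun t => -∫ z, u t z * Kd1 a (z - q t)) (Icc 0 T) ∧ ∀ t ∈ Ioo 0 T, ∃ d,
      HasDerivAt (fun t => -∫ z, u t z * Kd1 a (z - q t)) d t ∧
      (1 / 2) * (∫ z, ux t z ^ 2 * Kd a (z - q t)) - R * Real.pi - 6 * L * J ≤ d := by
  have hL := h.hL
  have hR := h.hR
  have hq : ∀ t ∈ Icc 0 T, |u t (q t)| ≤ max B 2 := fun t ht => (h.ub t ht _).trans (le_max_right _ _)
  obtain ⟨h1, h2⟩ := DI (T := T) (M := 2 + (2 * L + R)) (A := 6 / a ^ 3) (B := max B 2) (f := u)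
    (f' := fun t z => - u t z * ux t z + G t z) (κ := Kd1 a) (κ' := Kd2 a) (q := q) (q' := fun t => u t (q t))
    (fun t ht z => (h.ub t ht z).trans (by linarith))
    (fun t ht z => by
      refine (abs_add_le _ _).trans ?_
      rw [abs_mul, abs_neg]
      have := mul_le_mul (h.ub t ht z) (h.uxb t ht z) (abs_nonneg _) (by norm_num)
      linarith [h.Gb t ht z])
    h.ut (fun t ht => h.uc ht)
    (fun t ht => by have := h.uc ht; have := h.Gc ht; have := h.uxc t ht; fun_prop)
    (Kd1_deriv ha) (Kd2_cont ha) (Kd1_bd ha ha1) (Kd2_bd ha ha1) h.qc h.qd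
    (fun t ht => (h.qb t ht).trans (le_max_left _ _)) hq
  refine ⟨h1.neg, fun t ht => ⟨_, (h2 t ht).neg, ?_⟩⟩
  have ht := Ioo_subset_Icc_self ht
  rw [h.I_ident ha ha1 ht]
  have s1 := (abs_le.mp (h.sq_bd ha ha1 ht)).2
  have s2 := h.G_lower ha ha1 ht
  linarith

end


section

open MeasureTheory Set Filter
open scoped ENNReal NNReal Topology

variable {T L R B J : ℝ} {u ux G G' Q : ℝ → ℝ → ℝ} {q : ℝ → ℝ}

theorem Core.r_bd (h : Core T L R B J u ux G G' Q q) {k : ℝ} (hk : 0 < k) {t : ℝ} (ht : t ∈ Icc 0 T) (z : ℝ) :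
    |(u t (z + k) - u t z) / k| ≤ L := by
  rw [abs_div, abs_of_pos hk, div_le_iff₀ hk]
  refine (h.ul ht _ _).trans ?_
  rw [add_sub_cancel_left, abs_of_pos hk]

theorem Core.dG_bd (h : Core T L R B J u ux G G' Q q) {k : ℝ} (hk : 0 < k) {t : ℝ} (ht : t ∈ Icc 0 T) (z : ℝ) :
    |(G t (z + k) - G t z) / k| ≤ R := by
  rw [abs_div, abs_of_pos hk, div_le_iff₀ hk]
  refine (h.Gl ht _ _).trans ?_
  rw [add_sub_cancel_left, abs_of_pos hk]

theorem Core.Ph_deriv (h : Core T L R B J u ux G G' Q q) {a : ℝ} (ha : 0 < a) (ha1 : a ≤ 1) {k : ℝ} (hk : 0 < k) :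
    ContinuousOn (fun t => ∫ z, ((u t (z + k) - u t z) / k) ^ 2 * Kd a (z - q t)) (Icc 0 T) ∧ ∀ t ∈ Ioo 0 T, ∃ d,
      HasDerivAt (fun t => ∫ z, ((u t (z + k) - u t z) / k) ^ 2 * Kd a (z - q t)) d t ∧
      |d| ≤ (3 * L ^ 3 + 2 * L * R) * (∫ z, |Kd a z|) + L ^ 3 * ∫ z, |z| * |Kd1 a z| := by
  have hL := h.hL
  have hR := h.hR
  have hK := Kd_integrable ha ha1
  have hK1 := Kd1_integrable ha ha1
  have hq : ∀ t ∈ Icc 0 T, |u t (q t)| ≤ max B 2 := fun t ht => (h.ub t ht _).trans (le_max_right _ _)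
  set f' : ℝ → ℝ → ℝ := fun t z => 2 * ((u t (z + k) - u t z) / k) *
    (((- u t (z + k) * ux t (z + k) + G t (z + k)) - (- u t z * ux t z + G t z)) / k) with hf'
  have r2b : ∀ t ∈ Icc 0 T, ∀ z, |((u t (z + k) - u t z) / k) ^ 2| ≤ L ^ 2 := by
    intro t ht z
    rw [abs_pow]; exact pow_le_pow_left₀ (abs_nonneg _) (h.r_bd hk ht z) 2
  have utb : ∀ t ∈ Icc 0 T, ∀ z, |- u t z * ux t z + G t z| ≤ 2 * L + R := by
    intro t ht z
    refine (abs_add_le _ _).trans ?_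
    rw [abs_mul, abs_neg]
    have := mul_le_mul (h.ub t ht z) (h.uxb t ht z) (abs_nonneg _) (by norm_num)
    linarith [h.Gb t ht z]
  have f'b : ∀ t ∈ Icc 0 T, ∀ z, |f' t z| ≤ 2 * L * ((2 * (2 * L + R)) / k) := by
    intro t ht z
    rw [hf']
    beta_reduce
    rw [abs_mul, abs_mul, abs_two, abs_div (_ - _ : ℝ) k, abs_of_pos hk]
    have h1 := h.r_bd hk ht z
    rw [abs_div, abs_of_pos hk] at h1
    have h2 := (abs_sub (- u t (z + k) * ux t (z + k) + G t (z + k)) (- u t z * ux t z + G t z))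
    have h3 := utb t ht z
    have h4 := utb t ht (z + k)
    rw [abs_div, abs_of_pos hk]
    apply mul_le_mul
    · linarith
    · gcongr; linarith
    · positivity
    · positivity
  have f'c : ∀ t ∈ Icc 0 T, Continuous (f' t) := by
    intro t ht
    have := h.uc ht; have := h.Gc ht; have := h.uxc t ht
    rw [hf']
    fun_prop
  obtain ⟨h1, h2⟩ := DI (T := T) (M := L ^ 2 + 2 * L * ((2 * (2 * L + R)) / k)) (A := 6 / a ^ 3) (B := max B 2)
    (f := fun t z => ((u t (z + k) - u t z) / k) ^ 2)
    (f' := f') (κ := Kd a) (κ' := Kd1 a) (q := q) (q' := fun t => u t (q t))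
    (fun t ht z => (r2b t ht z).trans (le_add_of_nonneg_right (by positivity)))
    (fun t ht z => (f'b t ht z).trans (le_add_of_nonneg_left (by positivity)))
    (fun t ht z => by
      refine ((((h.ut t ht (z + k)).sub (h.ut t ht z)).div_const k).pow 2).congr_deriv ?_
      simp only [hf', Pi.sub_apply]
      push_cast; ring)
    (fun t ht => by have := h.uc ht; fun_prop)
    f'c
    (Kd_deriv ha) (Kd1_cont ha) (Kd_bd ha ha1) (Kd1_bd ha ha1) h.qc h.qd
    (fun t ht => (h.qb t ht).trans (le_max_left _ _)) hq
  refine ⟨h1, fun t ht => ⟨_, h2 t ht, ?_⟩⟩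
  have ht := Ioo_subset_Icc_self ht
  have hc := h.uc ht
  have hxc := h.uxc t ht
  have hGc := h.Gc ht
  have hub := h.ub t ht
  have hxb := h.uxb t ht
  set b := q t
  set r : ℝ → ℝ := fun z => (u t (z + k) - u t z) / k with hr
  set r' : ℝ → ℝ := fun z => (ux t (z + k) - ux t z) / k with hr'
  have rc : Continuous r := by rw [hr]; fun_prop
  have rc' : Continuous r' := by rw [hr']; fun_prop
  have rb : ∀ z, |r z| ≤ L := h.r_bd hk ht
  have rb' : ∀ z, |r' z| ≤ 2 * L / k := by
    intro z
    rw [hr']; beta_reduce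
    rw [abs_div, abs_of_pos hk]
    gcongr
    have := abs_sub (ux t (z + k)) (ux t z)
    linarith [hxb z, hxb (z + k)]
  have r2b' : ∀ z, |r z ^ 2| ≤ L ^ 2 := r2b t ht
  have rd : ∀ z, HasDerivAt r (r' z) z := by
    intro z
    exact (((h.ud t ht (z + k)).comp_add_const z k).sub (h.ud t ht z)).div_const k
  -- total derivative
  have j1 : Integrable (fun z => (2 * r z * r' z * u t z + r z ^ 2 * ux t z) * Kd a (z - b)) := by
    apply bi (M := 2 * L * (2 * L / k) * 2 + L ^ 2 * L) (by fun_prop) _ hK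
    intro z
    refine (abs_add_le _ _).trans ?_
    rw [abs_mul, abs_mul, abs_mul, abs_two, abs_mul (r z ^ 2)]
    have := rb z; have := rb' z; have := hub z; have := hxb z; have := r2b' z
    gcongr
  have j2 : Integrable (fun z => (r z ^ 2 * u t z) * Kd1 a (z - b)) := by
    apply bi (M := L ^ 2 * 2) (by fun_prop) _ hK1
    intro z
    rw [abs_mul]
    have := hub z; have := r2b' z
    gcongr
  have j3 : Integrable (fun z => (r z ^ 2 * u t z) * Kd a (z - b)) := by
    apply bi (M := L ^ 2 * 2) (by fun_prop) _ hK
    intro z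
    rw [abs_mul]
    have := hub z; have := r2b' z
    gcongr
  have j12 : Integrable (fun z => (2 * r z * r' z * u t z + r z ^ 2 * ux t z) * Kd a (z - b) + (r z ^ 2 * u t z) * Kd1 a (z - b)) := j1.add j2
  have t1 : ∫ z, ((2 * r z * r' z * u t z + r z ^ 2 * ux t z) * Kd a (z - b) + (r z ^ 2 * u t z) * Kd1 a (z - b)) = 0 := by
    apply integral_eq_zero_of_hasDerivAt_of_integrable (f := fun z => (r z ^ 2 * u t z) * Kd a (z - b))
    · intro z
      refine ((((rd z).pow 2).mul (h.ud t ht z)).mul (Kd_shift_deriv ha b z)).congr_deriv ?_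
      simp only [Pi.pow_apply, Pi.mul_apply]
      push_cast; ring
    · exact j12
    · exact j3
  have j4 : Integrable (fun z => f' t z * Kd a (z - b) - r z ^ 2 * Kd1 a (z - b) * u t b) := by
    apply (bi (f'c t ht) (f'b t ht) hK b).sub
    exact (bi (by fun_prop) r2b' hK1 b).mul_const _
  have e1 : ∫ z, (f' t z * Kd a (z - b) - r z ^ 2 * Kd1 a (z - b) * u t b) =
      ∫ z, ((f' t z * Kd a (z - b) - r z ^ 2 * Kd1 a (z - b) * u t b) +
        ((2 * r z * r' z * u t z + r z ^ 2 * ux t z) * Kd a (z - b) + (r z ^ 2 * u t z) * Kd1 a (z - b))) := by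
    rw [integral_add j4 j12, t1, add_zero]
  show |∫ z, (f' t z * Kd a (z - b) - r z ^ 2 * Kd1 a (z - b) * u t b)| ≤ _
  rw [e1]
  obtain ⟨iz, -⟩ := Kd1_mul_L1 ha ha1
  have ib : Integrable (fun z => (3 * L ^ 3 + 2 * L * R) * |Kd a (z - b)| + L ^ 3 * (|z - b| * |Kd1 a (z - b)|)) :=
    ((hK.abs.comp_sub_right b).const_mul _).add ((iz.comp_sub_right b).const_mul _)
  have s := norm_integral_le_of_norm_le (f := fun z => ((f' t z * Kd a (z - b) - r z ^ 2 * Kd1 a (z - b) * u t b) +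
        ((2 * r z * r' z * u t z + r z ^ 2 * ux t z) * Kd a (z - b) + (r z ^ 2 * u t z) * Kd1 a (z - b)))) ib
    (Eventually.of_forall fun z => by
      have e : ((f' t z * Kd a (z - b) - r z ^ 2 * Kd1 a (z - b) * u t b) +
        ((2 * r z * r' z * u t z + r z ^ 2 * ux t z) * Kd a (z - b) + (r z ^ 2 * u t z) * Kd1 a (z - b))) =
        (-2 * r z ^ 2 * ux t (z + k) + 2 * r z * ((G t (z + k) - G t z) / k) + r z ^ 2 * ux t z) * Kd a (z - b)
        + r z ^ 2 * (u t z - u t b) * Kd1 a (z - b) := by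
        simp only [hf', hr, hr']
        field_simp
        ring
      rw [e]
      refine (norm_add_le _ _).trans ?_
      rw [norm_mul, norm_mul, Real.norm_eq_abs, Real.norm_eq_abs, Real.norm_eq_abs, Real.norm_eq_abs]
      have g1 : |-2 * r z ^ 2 * ux t (z + k) + 2 * r z * ((G t (z + k) - G t z) / k) + r z ^ 2 * ux t z| ≤ 3 * L ^ 3 + 2 * L * R := by
        refine (abs_add_three _ _ _).trans ?_
        rw [abs_mul, abs_mul, abs_mul, abs_mul, abs_mul (r z ^ 2), abs_neg, abs_two]
        have := rb z; have := hxb (z + k); have := hxb z; have := r2b' z; have := h.dG_bd hk ht z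
        calc _ ≤ 2 * L ^ 2 * L + 2 * L * R + L ^ 2 * L := by gcongr
          _ = _ := by ring
      have g2 : |r z ^ 2 * (u t z - u t b)| ≤ L ^ 3 * |z - b| := by
        rw [abs_mul]
        have := r2b' z; have := h.ul ht z b
        calc _ ≤ L ^ 2 * (L * |z - b|) := by gcongr
          _ = _ := by ring
      calc _ ≤ (3 * L ^ 3 + 2 * L * R) * |Kd a (z - b)| + (L ^ 3 * |z - b|) * |Kd1 a (z - b)| := by gcongr
        _ = _ := by ring)
  refine s.trans (le_of_eq ?_)
  rw [integral_add (f := fun z => (3 * L ^ 3 + 2 * L * R) * |Kd a (z - b)|) (g := fun z => L ^ 3 * (|z - b| * |Kd1 a (z - b)|))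
    ((hK.abs.comp_sub_right b).const_mul _) ((iz.comp_sub_right b).const_mul _), integral_const_mul, integral_const_mul,
    integral_sub_right_eq_self (fun z => |Kd a z|) b, integral_sub_right_eq_self (fun z => |z| * |Kd1 a z|) b]

theorem Core.P_diff (h : Core T L R B J u ux G G' Q q) {a : ℝ} (ha : 0 < a) (ha1 : a ≤ 1) {t : ℝ} (ht : t ∈ Icc 0 T) :
    |(∫ z, ux t z ^ 2 * Kd a (z - q t)) - ∫ z, ux 0 z ^ 2 * Kd a (z - q 0)| ≤
      ((3 * L ^ 3 + 2 * L * R) * (2 * Real.log (1 / a)) + L ^ 3 * (2 * Real.log (1 / a) + 2 * Real.pi)) * t := by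
  have hL := h.hL
  have hR := h.hR
  have hK := Kd_integrable ha ha1
  set W := ((3 * L ^ 3 + 2 * L * R) * (2 * Real.log (1 / a)) + L ^ 3 * (2 * Real.log (1 / a) + 2 * Real.pi))
  have lim : ∀ s ∈ Icc 0 T, Tendsto (fun k : ℝ => ∫ z, ((u s (z + k) - u s z) / k) ^ 2 * Kd a (z - q s)) (𝓝[>] 0)
      (𝓝 (∫ z, ux s z ^ 2 * Kd a (z - q s))) := by
    intro s hs
    have hc := h.uc hs
    have hKc := Kd_cont ha
    apply tendsto_integral_filter_of_dominated_convergence (fun z => L ^ 2 * |Kd a (z - q s)|)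
    · refine Eventually.of_forall fun k => ?_
      exact (by fun_prop : Continuous (fun z => ((u s (z + k) - u s z) / k) ^ 2 * Kd a (z - q s))).aestronglyMeasurable
    · filter_upwards [self_mem_nhdsWithin] with k hk
      refine Eventually.of_forall fun z => ?_
      rw [norm_mul, norm_pow, Real.norm_eq_abs, Real.norm_eq_abs]
      have := h.r_bd hk hs z
      gcongr
    · exact (hK.abs.comp_sub_right (q s)).const_mul _
    · refine Eventually.of_forall fun z => ?_
      apply Tendsto.mul_const
      apply Tendsto.pow
      have := (h.ud s hs z).tendsto_slope_zero_right
      refine this.congr fun k => ?_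
      rw [smul_eq_mul]; ring
  have h0 : (0:ℝ) ∈ Icc 0 T := ⟨le_rfl, h.hT.le⟩
  have key : ∀ᶠ k : ℝ in 𝓝[>] 0, |(∫ z, ((u t (z + k) - u t z) / k) ^ 2 * Kd a (z - q t)) - ∫ z, ((u 0 (z + k) - u 0 z) / k) ^ 2 * Kd a (z - q 0)| ≤ W * t := by
    filter_upwards [self_mem_nhdsWithin] with k hk
    obtain ⟨h1, h2⟩ := h.Ph_deriv ha ha1 hk
    rcases ht.1.eq_or_lt with h3 | h3
    · rw [← h3]; simp
    · have hsub : Icc 0 t ⊆ Icc 0 T := Icc_subset_Icc_right ht.2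
      choose! d hd using h2
      obtain ⟨c, hc, e⟩ := exists_hasDerivAt_eq_slope (fun t => ∫ z, ((u t (z + k) - u t z) / k) ^ 2 * Kd a (z - q t)) d h3 (h1.mono hsub)
        (fun s hs => (hd s ⟨hs.1, hs.2.trans_le ht.2⟩).1)
      have h4 := (hd c ⟨hc.1, hc.2.trans_le ht.2⟩).2
      rw [e, Kd_L1 ha ha1, abs_div, sub_zero, abs_of_pos h3, div_le_iff₀ h3] at h4
      refine h4.trans ?_
      apply mul_le_mul_of_nonneg_right _ h3.le
      have := (Kd1_mul_L1 ha ha1).2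
      have := mul_le_mul_of_nonneg_left this (by positivity : 0 ≤ L ^ 3)
      linarith
  exact le_of_tendsto ((lim t ht).sub (lim 0 h0)).abs key

/-- main abstract conclusion -/
theorem Core.main (h : Core T L R B J u ux G G' Q q) {a : ℝ} (ha : 0 < a) (ha1 : a ≤ 1) :
    T * ((1 / 2) * ((∫ z, ux 0 z ^ 2 * Kd a (z - q 0)) -
      ((3 * L ^ 3 + 2 * L * R) * (2 * Real.log (1 / a)) + L ^ 3 * (2 * Real.log (1 / a) + 2 * Real.pi)) * T)
      - R * Real.pi - 6 * L * J) ≤ 2 * J := by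
  have hL := h.hL
  have hR := h.hR
  set W := ((3 * L ^ 3 + 2 * L * R) * (2 * Real.log (1 / a)) + L ^ 3 * (2 * Real.log (1 / a) + 2 * Real.pi)) with hW
  have hlog : 0 ≤ Real.log (1 / a) := Real.log_nonneg (by rw [le_div_iff₀ ha]; linarith)
  have hW0 : 0 ≤ W := by positivity
  obtain ⟨h1, h2⟩ := h.I_deriv ha ha1
  choose! d hd using h2
  obtain ⟨c, hc, e⟩ := exists_hasDerivAt_eq_slope (fun t => -∫ z, u t z * Kd1 a (z - q t)) d h.hT h1 (fun s hs => (hd s hs).1)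
  have hcI := Ioo_subset_Icc_self hc
  have h3 := (hd c hc).2
  rw [sub_zero, eq_div_iff h.hT.ne'] at e
  have h4 := (abs_le.mp (h.I_bd ha ha1 (t := T) ⟨h.hT.le, le_rfl⟩)).1
  have h5 := (abs_le.mp (h.I_bd ha ha1 (t := 0) ⟨le_rfl, h.hT.le⟩)).2
  have h6 := (abs_le.mp (h.P_diff ha ha1 hcI)).1
  have h7 : W * c ≤ W * T := mul_le_mul_of_nonneg_left hc.2.le hW0
  have h8 : T * d c ≤ 2 * J := by linarith
  refine le_trans (mul_le_mul_of_nonneg_left ?_ h.hT.le) h8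
  linarith

end


section

open MeasureTheory Set Filter
open scoped ENNReal NNReal Topology

noncomputable def wf (c₁ c₂ c₃ : ℝ) (v : ℝ → ℝ) : ℝ → ℝ := fun y =>
  (deriv v y) ^ 2 / 2 + c₁ * v y ^ 2 + c₂ * v y ^ 3 + c₃ * v y ^ 4

theorem poly_bd (c₁ c₂ c₃ : ℝ) {s m : ℝ} (hs : |s| ≤ m) (hm : 1 ≤ m) :
    |c₁ * s ^ 2 + c₂ * s ^ 3 + c₃ * s ^ 4| ≤ (|c₁| + |c₂| + |c₃|) * m ^ 4 := by
  refine (abs_add_three _ _ _).trans ?_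
  rw [abs_mul, abs_mul, abs_mul, abs_pow, abs_pow, abs_pow]
  have h2 : |s| ^ 2 ≤ m ^ 4 := (pow_le_pow_left₀ (abs_nonneg _) hs 2).trans (pow_le_pow_right₀ hm (by norm_num))
  have h3 : |s| ^ 3 ≤ m ^ 4 := (pow_le_pow_left₀ (abs_nonneg _) hs 3).trans (pow_le_pow_right₀ hm (by norm_num))
  have h4 : |s| ^ 4 ≤ m ^ 4 := (pow_le_pow_left₀ (abs_nonneg _) hs 4)
  have := mul_le_mul_of_nonneg_left h2 (abs_nonneg c₁)
  have := mul_le_mul_of_nonneg_left h3 (abs_nonneg c₂)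
  have := mul_le_mul_of_nonneg_left h4 (abs_nonneg c₃)
  linarith

theorem wf_bd (c₁ c₂ c₃ : ℝ) {v : ℝ → ℝ} {L m y : ℝ} (hd : |deriv v y| ≤ L) (hs : |v y| ≤ m) (hm : 1 ≤ m) :
    |wf c₁ c₂ c₃ v y| ≤ L ^ 2 + (|c₁| + |c₂| + |c₃|) * m ^ 4 := by
  have e : wf c₁ c₂ c₃ v y = (deriv v y) ^ 2 / 2 + (c₁ * v y ^ 2 + c₂ * v y ^ 3 + c₃ * v y ^ 4) := by
    unfold wf; ring
  rw [e]
  refine (abs_add_le _ _).trans (add_le_add ?_ (poly_bd c₁ c₂ c₃ hs hm))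
  rw [abs_div, abs_pow, abs_two]
  have := pow_le_pow_left₀ (abs_nonneg _) hd 2
  have := sq_nonneg L
  linarith

theorem uniform_bd (c₁ c₂ c₃ : ℝ) : ∃ C : ℝ, 0 < C ∧ ∀ (T L : ℝ) (u : ℝ → ℝ → ℝ), 0 < T → 1 ≤ L → C * L ^ 4 * T ≤ 1 →
    IsRCHSol c₁ c₂ c₃ T u → (∀ x, |u 0 x| ≤ 1) →
    (∀ t ∈ Icc 0 T, ∃ M, ∀ x, |u t x| ≤ M) →
    (∀ t ∈ Icc 0 T, (∀ x, HasDerivAt (u t) (deriv (u t) x) x) ∧ Continuous (deriv (u t)) ∧ ∀ x, |deriv (u t) x| ≤ L) →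
    ∀ t ∈ Icc 0 T, ∀ x, |u t x| ≤ 2 := by
  obtain ⟨Cm, hCm, im, bm⟩ := moment_bound
  set cc := |c₁| + |c₂| + |c₃| with hcc
  have hcc0 : 0 ≤ cc := by positivity
  refine ⟨3 + (1 + 16 * cc) * Cm, by positivity, ?_⟩
  intro T L u hT hL hsmall hsol h0 hM hD
  set M := (3 + (1 + 16 * cc) * Cm) * L ^ 4 with hMdef
  have hM0 : 0 < M := by positivity
  intro t ht x
  have hLL : L ≤ L ^ 4 := by
    calc L = L ^ 1 := (pow_one L).symm
      _ ≤ L ^ 4 := pow_le_pow_right₀ hL (by norm_num)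
  have hL1 : 1 ≤ L ^ 4 := one_le_pow₀ hL
  have key : ∀ s ∈ Icc 0 T, |u s x| ≤ 2 → |- u s x * deriv (u s) x + RCHForce c₁ c₂ c₃ (u s) x| < M := by
    intro s hs hus
    obtain ⟨hd, hc, hb⟩ := hD s hs
    obtain ⟨M0, hM0⟩ := hM s hs
    have huc : Continuous (u s) := continuous_iff_continuousAt.mpr fun z => (hd z).continuousAt
    have hwc : Continuous (wf c₁ c₂ c₃ (u s)) := by unfold wf; fun_prop
    have hwb : ∀ y, |wf c₁ c₂ c₃ (u s) y| ≤ L ^ 2 + cc * (max M0 1) ^ 4 := fun y =>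
      wf_bd c₁ c₂ c₃ (hb y) ((hM0 y).trans (le_max_left _ _)) (le_max_right _ _)
    have e : RCHForce c₁ c₂ c₃ (u s) x = - A1op (wf c₁ c₂ c₃ (u s)) x := by
      unfold RCHForce
      rw [← (inv_deriv hwc hwb x).deriv]
      rfl
    rw [e]
    refine (abs_add_le _ _).trans_lt ?_
    rw [abs_mul, abs_neg, abs_neg]
    have h1 := A1op_abs_le hwc hwb x
    have h2 : invOneSub (fun y => |wf c₁ c₂ c₃ (u s) y|) x ≤ (1 + 16 * cc) * Cm * L ^ 4 := by
      unfold invOneSub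
      have h3 : ∫ y : ℝ, Real.exp (-|y|) * |wf c₁ c₂ c₃ (u s) (x - y)| ≤ ∫ y : ℝ, ((1 + 16 * cc) * L ^ 4) * (Real.exp (-|y|) * (1 + |y|) ^ 4) := by
        apply integral_mono (inv_integrable (w := fun y => |wf c₁ c₂ c₃ (u s) y|) hwc.abs (fun y => (abs_abs _).le.trans (hwb y)) x) (im.const_mul _)
        intro y
        beta_reduce
        have h4 : |u s (x - y)| ≤ 2 * L * (1 + |y|) := by
          have h5 := lip_of_deriv hd hb (x - y) x
          have e5 : x - y - x = -y := by ring
          rw [e5, abs_neg] at h5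
          have h6 := abs_sub_abs_le_abs_sub (u s (x - y)) (u s x)
          nlinarith [abs_nonneg y]
        have h5 := wf_bd c₁ c₂ c₃ (hb (x - y)) h4 (by nlinarith [abs_nonneg y])
        rw [← hcc] at h5
        have h7 : 1 ≤ (1 + |y|) ^ 4 := one_le_pow₀ (by linarith [abs_nonneg y])
        have h8 : L ^ 2 ≤ L ^ 4 * (1 + |y|) ^ 4 := by
          calc L ^ 2 ≤ L ^ 4 := pow_le_pow_right₀ hL (by norm_num)
            _ ≤ _ := le_mul_of_one_le_right (by positivity) h7
        have h9 : |wf c₁ c₂ c₃ (u s) (x - y)| ≤ (1 + 16 * cc) * L ^ 4 * (1 + |y|) ^ 4 := by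
          calc _ ≤ L ^ 2 + cc * (2 * L * (1 + |y|)) ^ 4 := h5
            _ ≤ L ^ 4 * (1 + |y|) ^ 4 + cc * (2 * L * (1 + |y|)) ^ 4 := by linarith
            _ = _ := by ring
        calc _ ≤ Real.exp (-|y|) * ((1 + 16 * cc) * L ^ 4 * (1 + |y|) ^ 4) := by gcongr
          _ = _ := by ring
      rw [integral_const_mul] at h3
      have h4 : (1 + 16 * cc) * L ^ 4 * ∫ y : ℝ, (Real.exp (-|y|) * (1 + |y|) ^ 4) ≤ (1 + 16 * cc) * L ^ 4 * Cm := by gcongr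
      have h5 : 0 ≤ (1 + 16 * cc) * L ^ 4 * Cm := by positivity
      linarith
    have h3 : |u s x| * |deriv (u s) x| ≤ 2 * L := mul_le_mul hus (hb x) (abs_nonneg _) (by norm_num)
    calc _ ≤ 2 * L + (1 + 16 * cc) * Cm * L ^ 4 := by linarith
      _ < M := by rw [hMdef]; nlinarith
  have hfin := image_norm_le_of_norm_deriv_right_lt_deriv_boundary' (f := fun s => u s x) (a := 0) (b := T)
    (f' := fun s => - u s x * deriv (u s) x + RCHForce c₁ c₂ c₃ (u s) x) (B := fun s => 1 + M * s) (B' := fun _ => M)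
    (fun s hs => (hsol s hs x).continuousAt.continuousWithinAt)
    (fun s hs => (hsol s (Ico_subset_Icc_self hs) x).hasDerivWithinAt)
    (by simpa using h0 x) (by fun_prop)
    (fun s hs => by
      have : HasDerivAt (fun s : ℝ => 1 + M * s) M s := by
        simpa using ((hasDerivAt_id s).const_mul M).const_add 1
      exact this.hasDerivWithinAt)
    (fun s hs e => by
      apply key s (Ico_subset_Icc_self hs)
      have h1 : M * s ≤ M * T := mul_le_mul_of_nonneg_left hs.2.le hM0.le
      have e' : |u s x| = 1 + M * s := e
      linarith) ht
  have hfin' : |u t x| ≤ 1 + M * t := hfin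
  have h1 : M * t ≤ M * T := mul_le_mul_of_nonneg_left ht.2 hM0.le
  linarith

theorem core_exists (D : LPData) (c₁ c₂ c₃ : ℝ) : ∃ C : ℝ, 1 ≤ C ∧ ∀ (T L : ℝ) (u : ℝ → ℝ → ℝ), 0 < T → T ≤ 1 → 1 ≤ L → C * L ^ 4 * T ≤ 1 →
    IsRCHSol c₁ c₂ c₃ T u → (∀ x, |u 0 x| ≤ 1) →
    (∀ t ∈ Icc 0 T, MemC01 (u t)) →
    (∀ t ∈ Icc 0 T, besovNorm D 0 ⊤ (deriv (u t)) ≤ ENNReal.ofReal L) →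
    ∃ B G G' Q q, q 0 = 0 ∧ Core T L (C * L ^ 2) B (C * (L + 2)) u (fun t => deriv (u t)) G G' Q q := by
  obtain ⟨C1, hC1, hU⟩ := uniform_bd c₁ c₂ c₃
  obtain ⟨C2, hC2, hF⟩ := lemF D
  set cc := |c₁| + |c₂| + |c₃| with hcc
  have hcc0 : 0 ≤ cc := by positivity
  refine ⟨C1 + C2 + (2 + 64 * cc), by linarith, ?_⟩
  intro T L u hT hT1 hL hsmall hsol h0 hmem hbes
  set C := C1 + C2 + (2 + 64 * cc) with hC
  have hM : ∀ t ∈ Icc 0 T, ∃ M, ∀ x, |u t x| ≤ M := by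
    intro t ht
    obtain ⟨M, hM⟩ := (hmem t ht).2
    exact ⟨M, fun x => hM ⟨x, rfl⟩⟩
  have hD : ∀ t ∈ Icc 0 T, (∀ x, HasDerivAt (u t) (deriv (u t) x) x) ∧ Continuous (deriv (u t)) ∧ ∀ x, |deriv (u t) x| ≤ L := by
    intro t ht
    obtain ⟨k, hk⟩ := (hmem t ht).1
    obtain ⟨M, hM⟩ := hM t ht
    obtain ⟨a, b, c, -⟩ := hF (u t) k M L hk hM (by linarith) (hbes t ht)
    exact ⟨a, b, c⟩
  have hub : ∀ t ∈ Icc 0 T, ∀ x, |u t x| ≤ 2 := by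
    apply hU T L u hT hL _ hsol h0 hM hD
    refine le_trans ?_ hsmall
    gcongr
    rw [hC]; linarith
  have hD2 : ∀ t ∈ Icc 0 T, ∀ y, ∫⁻ z, ENNReal.ofReal (|u t (y + z) + u t (y - z) - 2 * u t y| / z ^ 2) ≤ ENNReal.ofReal (C * (L + 2)) := by
    intro t ht y
    obtain ⟨k, hk⟩ := (hmem t ht).1
    obtain ⟨-, -, -, d⟩ := hF (u t) k 2 L hk (hub t ht) (by linarith) (hbes t ht)
    refine (d y).trans (ENNReal.ofReal_le_ofReal ?_)
    gcongr
    rw [hC]; linarith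
  -- characteristic
  obtain ⟨q, hq0, hq⟩ : ∃ q : ℝ → ℝ, q 0 = 0 ∧ ∀ t ∈ Icc 0 T, HasDerivWithinAt q (u t (q t)) (Icc 0 T) t := by
    have hP : IsPicardLindelof (fun t x => u t x) (tmin := 0) (tmax := T) ⟨0, le_rfl, hT.le⟩ 0 2 0 2 ⟨L, by linarith⟩ := by
      refine ⟨?_, ?_, ?_, ?_⟩
      · intro t ht
        apply LipschitzWith.lipschitzOnWith
        apply LipschitzWith.of_dist_le_mul
        intro x y
        exact lip_of_deriv (hD t ht).1 (hD t ht).2.2 x y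
      · intro x _ t ht
        exact (hsol t ht x).continuousAt.continuousWithinAt
      · intro t ht x _
        exact hub t ht x
      · show (2:ℝ) * max (T - 0) (0 - 0) ≤ 2 - 0
        rw [max_eq_left (by linarith)]
        linarith
    obtain ⟨α, h1, h2⟩ := hP.exists_eq_forall_mem_Icc_hasDerivWithinAt (x := 0) (by simp)
    exact ⟨α, h1, h2⟩
  have hqc : ContinuousOn q (Icc 0 T) := fun t ht => (hq t ht).continuousWithinAt
  obtain ⟨B, hB⟩ := isCompact_Icc.exists_bound_of_continuousOn hqc
  set w : ℝ → ℝ → ℝ := fun t => wf c₁ c₂ c₃ (u t) with hw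
  have huc : ∀ t ∈ Icc 0 T, Continuous (u t) := fun t ht => continuous_iff_continuousAt.mpr fun z => ((hD t ht).1 z).continuousAt
  have hwc : ∀ t ∈ Icc 0 T, Continuous (w t) := by
    intro t ht
    have := huc t ht
    have := (hD t ht).2.1
    simp only [hw]; unfold wf; fun_prop
  have hL2 : L ≤ L ^ 2 := by nlinarith
  have hL1 : 1 ≤ L ^ 2 := by nlinarith
  have hwb : ∀ t ∈ Icc 0 T, ∀ y, |w t y| ≤ (1 + 16 * cc) * L ^ 2 := by
    intro t ht y
    have := wf_bd c₁ c₂ c₃ ((hD t ht).2.2 y) (hub t ht y) (by norm_num)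
    rw [← hcc] at this
    have h2 : cc * 1 ≤ cc * L ^ 2 := by gcongr
    refine this.trans ?_
    linarith
  have hAb : ∀ t ∈ Icc 0 T, ∀ y, |A1op (w t) y| ≤ (1 + 16 * cc) * L ^ 2 := fun t ht y =>
    (A1op_abs_le (hwc t ht) (hwb t ht) y).trans (invOneSub_le (hwb t ht) y)
  have hib : ∀ t ∈ Icc 0 T, ∀ y, |invOneSub (w t) y| ≤ (1 + 16 * cc) * L ^ 2 := fun t ht y =>
    (invOneSub_abs_le y).trans (invOneSub_le (hwb t ht) y)
  have hCR : (2 + 64 * cc) * L ^ 2 ≤ C * L ^ 2 := by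
    gcongr; rw [hC]; linarith
  have hccL : 0 ≤ cc * L ^ 2 := by positivity
  refine ⟨B, fun t x => - A1op (w t) x, fun t x => w t x - invOneSub (w t) x,
    fun t x => (c₁ * u t x ^ 2 + c₂ * u t x ^ 3 + c₃ * u t x ^ 4) - invOneSub (w t) x, q, hq0, ?_⟩
  refine ⟨hT, by linarith, by positivity, by positivity, hub, fun t ht => (hD t ht).1, fun t ht => (hD t ht).2.1, fun t ht => (hD t ht).2.2,
    ?_, ?_, ?_, ?_, ?_, ?_, ?_, hqc, ?_, hB, hD2⟩
  · intro t ht x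
    refine (A1op_deriv (hwc t ht) (hwb t ht) x).neg.congr_deriv ?_
    ring
  · intro t ht
    apply (hwc t ht).sub
    exact continuous_iff_continuousAt.mpr fun z => (inv_deriv (hwc t ht) (hwb t ht) z).continuousAt
  · intro t ht x
    rw [abs_neg]
    linarith [hAb t ht x]
  · intro t ht x
    refine (abs_sub _ _).trans ?_
    linarith [hwb t ht x, hib t ht x]
  · intro t ht x
    simp only [hw]; unfold wf; ring
  · intro t ht
    apply lip_of_deriv (f' := fun x => (c₁ * (2 * u t x * deriv (u t) x) + c₂ * (3 * u t x ^ 2 * deriv (u t) x) + c₃ * (4 * u t x ^ 3 * deriv (u t) x)) - A1op (w t) x)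
    · intro x
      have h1 := (hD t ht).1 x
      refine ((((h1.pow 2).const_mul c₁).add ((h1.pow 3).const_mul c₂)).add ((h1.pow 4).const_mul c₃)).sub (inv_deriv (hwc t ht) (hwb t ht) x) |>.congr_deriv ?_
      push_cast; ring
    · intro x
      refine (abs_sub _ _).trans ?_
      have h1 := hub t ht x
      have h2 := (hD t ht).2.2 x
      have h3 : |c₁ * (2 * u t x * deriv (u t) x) + c₂ * (3 * u t x ^ 2 * deriv (u t) x) + c₃ * (4 * u t x ^ 3 * deriv (u t) x)| ≤ cc * (32 * L) := by
        refine (abs_add_three _ _ _).trans ?_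
        simp only [abs_mul, abs_pow]
        have g1 : |(2:ℝ)| * |u t x| * |deriv (u t) x| ≤ 32 * L := by
          calc _ ≤ |(2:ℝ)| * 2 * L := by gcongr
            _ ≤ _ := by norm_num; linarith
        have g2 : |(3:ℝ)| * |u t x| ^ 2 * |deriv (u t) x| ≤ 32 * L := by
          calc _ ≤ |(3:ℝ)| * 2 ^ 2 * L := by gcongr
            _ ≤ _ := by norm_num; linarith
        have g3 : |(4:ℝ)| * |u t x| ^ 3 * |deriv (u t) x| ≤ 32 * L := by
          calc _ ≤ |(4:ℝ)| * 2 ^ 3 * L := by gcongr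
            _ ≤ _ := by norm_num
        calc _ ≤ |c₁| * (32 * L) + |c₂| * (32 * L) + |c₃| * (32 * L) := by gcongr
          _ = _ := by rw [hcc]; ring
      have h4 : cc * L ≤ cc * L ^ 2 := by gcongr
      linarith [hAb t ht x]
  · intro t ht x
    have := hsol t ht x
    have e : RCHForce c₁ c₂ c₃ (u t) x = - A1op (w t) x := by
      unfold RCHForce
      rw [← (inv_deriv (hwc t ht) (hwb t ht) x).deriv]
      rfl
    rw [e] at this
    exact this
  · intro t ht
    exact (hq t (Ioo_subset_Icc_self ht)).hasDerivAt (Icc_mem_nhds ht.1 ht.2)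

end


section

open MeasureTheory Set Filter
open scoped ENNReal NNReal Topology

theorem asym (K : ℝ) (hK : 0 < K) : ∃ N₀ : ℕ, ∀ N : ℕ, N₀ ≤ N → 1 ≤ N ∧ 1 ≤ Real.log N ∧
    K * Real.log N ^ 4 < ((N:ℝ) ^ ((1:ℝ) / 10)) ^ 2 := by
  have h1 := (isLittleO_log_rpow_rpow_atTop (s := 1 / 5) 4 (by norm_num)).def (c := 1 / (2 * K)) (by positivity)
  have h2 := h1.and ((Real.tendsto_log_atTop.eventually_ge_atTop 1).and (eventually_ge_atTop (1:ℝ)))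
  obtain ⟨N₀, h3⟩ := eventually_atTop.mp ((tendsto_natCast_atTop_atTop (R := ℝ)).eventually h2)
  refine ⟨N₀, fun N hN => ?_⟩
  obtain ⟨h4, h5, h6⟩ := h3 N hN
  refine ⟨by exact_mod_cast h6, h5, ?_⟩
  have hN0 : (0:ℝ) < N := by linarith
  have e1 : ((N:ℝ) ^ ((1:ℝ) / 10)) ^ 2 = (N:ℝ) ^ ((1:ℝ) / 5) := by
    rw [← Real.rpow_natCast, ← Real.rpow_mul hN0.le]; norm_num
  have e2 : Real.log N ^ (4:ℝ) = Real.log N ^ 4 := by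
    rw [← Real.rpow_natCast]; norm_num
  rw [e2, Real.norm_of_nonneg (by positivity), Real.norm_of_nonneg (by positivity)] at h4
  rw [e1]
  have hp : 0 < (N:ℝ) ^ ((1:ℝ) / 5) := by positivity
  have h7 := mul_le_mul_of_nonneg_left h4 hK.le
  have e3 : K * (1 / (2 * K) * (N:ℝ) ^ ((1:ℝ) / 5)) = (N:ℝ) ^ ((1:ℝ) / 5) / 2 := by field_simp
  rw [e3] at h7
  linarith

set_option maxHeartbeats 1000000 in
theorem main_lower (D : LPData) (c₁ c₂ c₃ : ℝ) :
    ∃ N₀ : ℕ, ∀ N : ℕ, N₀ ≤ N → ∀ u : ℝ → ℝ → ℝ,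
        IsRCHSol c₁ c₂ c₃ (2 * (N:ℝ) ^ (-(1:ℝ)/2)) u →
        (∀ x, u 0 x = u0def D N x) →
        (∀ t ∈ Set.Icc (0:ℝ) (2 * (N:ℝ) ^ (-(1:ℝ)/2)), MemC01 (u t)) →
        ENNReal.ofReal (Real.log N) ≤
          ⨆ t ∈ Set.Icc (0:ℝ) (2 * (N:ℝ) ^ (-(1:ℝ)/2)),
            besovNorm D 0 ⊤ (deriv (u t)) := by
  obtain ⟨C, hC, hcore⟩ := core_exists D c₁ c₂ c₃
  obtain ⟨C0, hC0, hP0⟩ := P0_lower D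
  have hA := A0c_nonneg D
  obtain ⟨N₀, hN₀⟩ := asym (32 * (C0 + 45 * C) + (2 + A0c D) ^ 2 + 2 * C) (by positivity)
  refine ⟨N₀, fun N hN u hsol hu0 hmem => ?_⟩
  obtain ⟨hN1, hL, hbig⟩ := hN₀ N hN
  by_contra hcon
  push Not at hcon
  set L := Real.log N with hLdef
  set n := (N:ℝ) ^ ((1:ℝ) / 10) with hn
  have hNr : (1:ℝ) ≤ N := by exact_mod_cast hN1
  have hN0 : (0:ℝ) < N := by linarith
  have hn0 : 0 < n := by positivity
  have hL4 : 1 ≤ L ^ 4 := one_le_pow₀ hL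
  have hL34 : L ^ 3 ≤ L ^ 4 := pow_le_pow_right₀ hL (by norm_num)
  have hn2 : (2 + A0c D) ^ 2 ≤ n ^ 2 := by
    have : (2 + A0c D) ^ 2 * 1 ≤ (32 * (C0 + 45 * C) + (2 + A0c D) ^ 2 + 2 * C) * L ^ 4 := by
      apply mul_le_mul _ hL4 (by norm_num) (by positivity)
      have : 0 ≤ 32 * (C0 + 45 * C) + 2 * C := by positivity
      linarith
    linarith
  have hn1 : 2 + A0c D ≤ n := (sq_le_sq₀ (by positivity) hn0.le).mp hn2
  have hnge1 : 1 ≤ n := by linarith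
  have hnN : n ^ 10 = N := by
    rw [hn, ← Real.rpow_natCast, ← Real.rpow_mul hN0.le]; norm_num
  have hTn : 2 * (N:ℝ) ^ (-(1:ℝ)/2) = 2 / n ^ 5 := by
    have : (N:ℝ) ^ (-(1:ℝ)/2) = (n ^ 5)⁻¹ := by
      rw [hn, ← Real.rpow_natCast, ← Real.rpow_mul hN0.le, ← Real.rpow_neg hN0.le]; norm_num
    rw [this]; rfl
  have hεn : (N:ℝ) ^ (-(1:ℝ)/10) = n⁻¹ := by
    rw [hn, ← Real.rpow_neg hN0.le]; norm_num
  set T := 2 * (N:ℝ) ^ (-(1:ℝ)/2) with hT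
  have hn25 : n ^ 2 ≤ n ^ 5 := pow_le_pow_right₀ hnge1 (by norm_num)
  have hT0 : 0 < T := by positivity
  have hT1 : T ≤ 1 := by
    rw [hTn, div_le_one (by positivity)]
    nlinarith
  have hsm : C * L ^ 4 * T ≤ 1 := by
    rw [hTn, ← mul_div_assoc, div_le_one (by positivity)]
    have : 0 ≤ (32 * (C0 + 45 * C) + (2 + A0c D) ^ 2) * L ^ 4 := by positivity
    nlinarith
  have hε0 : 0 < n⁻¹ := by positivity
  have hε1 : n⁻¹ ≤ 1 := inv_le_one_of_one_le₀ hnge1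
  have hu0f : u 0 = u0def D N := funext hu0
  have hb : ∀ t ∈ Icc 0 T, besovNorm D 0 ⊤ (deriv (u t)) ≤ ENNReal.ofReal L := by
    intro t ht
    exact (le_iSup₂ (f := fun t (_ : t ∈ Icc 0 T) => besovNorm D 0 ⊤ (deriv (u t))) t ht).trans hcon.le
  have h0 : ∀ x, |u 0 x| ≤ 1 := by
    intro x
    rw [hu0]
    refine (u0_bd D N hεn.symm hε0 hε1 x).trans ?_
    rw [inv_mul_le_iff₀ hn0]; linarith
  obtain ⟨B, G, G', Q, q, hq0, hco⟩ := hcore T L u hT0 hT1 hL hsm hsol h0 hmem hb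
  have ha0 : (0:ℝ) < (2 ^ N)⁻¹ := by positivity
  have ha1 : ((2:ℝ) ^ N)⁻¹ ≤ 1 := inv_le_one_of_one_le₀ (one_le_pow₀ (by norm_num))
  have hm := hco.main ha0 ha1
  have hlog : Real.log (1 / ((2:ℝ) ^ N)⁻¹) = N * Real.log 2 := by
    rw [one_div, inv_inv, Real.log_pow]
  have hlogN : Real.log (1 / ((2:ℝ) ^ N)⁻¹) ≤ N := by
    rw [hlog]
    have := Real.log_two_lt_d9
    nlinarith
  have hP := hP0 N hN1 n⁻¹ hε0 hε1
  have eP : ∫ z, deriv (u 0) z ^ 2 * Kd (2 ^ N)⁻¹ (z - q 0) = ∫ z, (n⁻¹ * (fdat D N n⁻¹ z - invOneSub (fdat D N n⁻¹) z)) ^ 2 * Kd (2 ^ N)⁻¹ z := by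
    congr 1; ext z
    rw [hq0, sub_zero, hu0f, u0_deriv D N hεn.symm hε0 hε1]
  rw [eP] at hm
  set P := ∫ z, (n⁻¹ * (fdat D N n⁻¹ z - invOneSub (fdat D N n⁻¹) z)) ^ 2 * Kd (2 ^ N)⁻¹ z
  have e7 : n⁻¹ ^ 3 * (N:ℝ) / 16 = n ^ 7 / 16 := by
    rw [← hnN]; field_simp
  rw [e7] at hP
  set ℓ := Real.log (1 / ((2:ℝ) ^ N)⁻¹)
  have hW : ((3 * L ^ 3 + 2 * L * (C * L ^ 2)) * (2 * ℓ) + L ^ 3 * (2 * ℓ + 2 * Real.pi)) ≤ 20 * C * L ^ 3 * N := by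
    have hpi := Real.pi_le_four
    calc _ ≤ (3 * L ^ 3 + 2 * L * (C * L ^ 2)) * (2 * N) + L ^ 3 * (2 * N + 2 * (4 * N)) := by
          gcongr
          linarith
      _ = L ^ 3 * N * (16 + 4 * C) := by ring
      _ ≤ L ^ 3 * N * (20 * C) := by gcongr; linarith
      _ = _ := by ring
  have hWT := mul_le_mul_of_nonneg_right hW hT0.le
  have eWT : 20 * C * L ^ 3 * N * T = 40 * C * L ^ 3 * n ^ 5 := by
    rw [hTn, ← hnN]; field_simp; ring
  rw [eWT] at hWT
  have hpi4 : C * L ^ 2 * Real.pi ≤ 4 * C * L ^ 2 := by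
    have := mul_le_mul_of_nonneg_left Real.pi_le_four (by positivity : 0 ≤ C * L ^ 2)
    linarith
  have hJ : C * (L + 2) ≤ 3 * C * L := by
    have := mul_le_mul_of_nonneg_left hL (by linarith : 0 ≤ C)
    linarith
  have hLJ : 6 * L * (C * (L + 2)) ≤ 18 * C * L ^ 2 := by
    have := mul_le_mul_of_nonneg_left hJ (by linarith : 0 ≤ 6 * L)
    linarith
  have hm2 : T * ((1 / 2) * ((n ^ 7 / 16 - C0) - 40 * C * L ^ 3 * n ^ 5) - 4 * C * L ^ 2 - 18 * C * L ^ 2) ≤ 6 * C * L := by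
    refine le_trans (mul_le_mul_of_nonneg_left ?_ hT0.le) (hm.trans (by linarith))
    linarith
  rw [hTn, div_mul_eq_mul_div, div_le_iff₀ (by positivity)] at hm2
  -- final numeric contradiction
  have hn5 : 1 ≤ n ^ 5 := one_le_pow₀ hnge1
  have hL3 : 1 ≤ L ^ 3 := one_le_pow₀ hL
  have hLn : 1 ≤ L ^ 3 * n ^ 5 := one_le_mul_of_one_le_of_one_le hL3 hn5
  have b1 : C0 ≤ C0 * (L ^ 3 * n ^ 5) := le_mul_of_one_le_right hC0.le hLn
  have b2 : C * L ^ 2 ≤ C * (L ^ 3 * n ^ 5) := by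
    have : L ^ 2 ≤ L ^ 3 * n ^ 5 := (pow_le_pow_right₀ hL (by norm_num : 2 ≤ 3)).trans (le_mul_of_one_le_right (by positivity) hn5)
    gcongr
  have b3 : C * L * n ^ 5 ≤ C * (L ^ 3 * n ^ 5) := by
    have : L ≤ L ^ 3 := by
      calc L = L ^ 1 := (pow_one L).symm
        _ ≤ L ^ 3 := pow_le_pow_right₀ hL (by norm_num)
    rw [mul_assoc]; gcongr
  have f1 : n ^ 7 ≤ 32 * (C0 + 45 * C) * (L ^ 3 * n ^ 5) := by
    linarith
  have f2 : n ^ 2 ≤ 32 * (C0 + 45 * C) * L ^ 3 := by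
    have : n ^ 5 * n ^ 2 ≤ n ^ 5 * (32 * (C0 + 45 * C) * L ^ 3) := by linarith
    exact le_of_mul_le_mul_left this (by positivity)
  have f3 : 32 * (C0 + 45 * C) * L ^ 3 ≤ 32 * (C0 + 45 * C) * L ^ 4 := by gcongr
  have f4 : 0 ≤ ((2 + A0c D) ^ 2 + 2 * C) * L ^ 4 := by positivity
  linarith

end

/-- bootstrap lower bound leading to norm inflation for the solution
starting from the explicit initial datum `u₀` built from `N`. -/
theorem rch_bootstrap_norm_inflation (D : LPData) (c₁ c₂ c₃ : ℝ) :
    ∃ C > (0:ℝ), ∃ N₀ : ℕ, ∀ N : ℕ, N₀ ≤ N →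
      ∀ u : ℝ → ℝ → ℝ,
        IsRCHSol c₁ c₂ c₃ (2 * (N:ℝ) ^ (-(1:ℝ)/2)) u →
        (∀ x, u 0 x = u0def D N x) →
        (∀ t ∈ Set.Icc (0:ℝ) (2 * (N:ℝ) ^ (-(1:ℝ)/2)), MemC01 (u t)) →
        -- conditional lower bound under the bootstrap hypothesis
        ((⨆ t ∈ Set.Icc (0:ℝ) (2 * (N:ℝ) ^ (-(1:ℝ)/2)),
              besovNorm D 0 ⊤ (deriv (u t))) < ENNReal.ofReal (Real.log N) →
          (∀ t ∈ Set.Icc (0:ℝ) ((N:ℝ) ^ (-(1:ℝ)/2)),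
            ENNReal.ofReal (t * (N:ℝ) ^ ((3:ℝ)/5) / 8 - C) ≤ besovNorm D 1 ⊤ (u t)) ∧
          ENNReal.ofReal ((N:ℝ) ^ ((1:ℝ)/10) / 16 - C) ≤
            (⨆ t ∈ Set.Icc (0:ℝ) ((N:ℝ) ^ (-(1:ℝ)/2)), besovNorm D 1 ⊤ (u t)) ∧
          Real.log N < (N:ℝ) ^ ((1:ℝ)/10) / 16 - C) ∧
        -- hence the unconditional norm inflation
        ENNReal.ofReal (Real.log N) ≤
          ⨆ t ∈ Set.Icc (0:ℝ) (2 * (N:ℝ) ^ (-(1:ℝ)/2)),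
            besovNorm D 0 ⊤ (deriv (u t)) := by
  obtain ⟨N₀, h⟩ := main_lower D c₁ c₂ c₃
  refine ⟨1, one_pos, N₀, fun N hN u h1 h2 h3 => ?_⟩
  have h4 := h N hN u h1 h2 h3
  exact ⟨fun h5 => absurd h5 (not_lt.mpr h4), h4⟩
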